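/- Let ρ be a ray with ρ([0,∞)) ⊆ H. Then the following are equivalent: (1) H is unknotted in ℝ³; (2) ρ is unknotted in ℝ³; (3) both A and B are diffeomorphic to ℝ³₊. (Proposition 8.5 of the paper.) -/

import Mathlib

open Set

/-- `S` is diffeomorphic to `T` (as subsets of ℝ³): there are maps `g, h : ℝ³ → ℝ³`, smooth on
`S` resp. `T`, carrying `S` onto `T` and `T` onto `S`, and inverse to each other on `S` and `T`. -/
def SetDiffeo (S T : Set (EuclideanSpace ℝ (Fin 3))) : Prop :=
  ∃ g h : EuclideanSpace ℝ (Fin 3) → EuclideanSpace ℝ (Fin 3),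
    ContDiffOn ℝ (⊤ : ℕ∞) g S ∧ ContDiffOn ℝ (⊤ : ℕ∞) h T ∧ g '' S = T ∧ h '' T = S ∧
      Set.EqOn (h ∘ g) id S ∧ Set.EqOn (g ∘ h) id T

/-- `Φ` is a diffeomorphism of ℝ³: a bijection with `Φ` and `Φ⁻¹` both `C^∞`. -/
def DiffeoR3 (Φ : EuclideanSpace ℝ (Fin 3) → EuclideanSpace ℝ (Fin 3)) : Prop :=
  Function.Bijective Φ ∧ ContDiff ℝ (⊤ : ℕ∞) Φ ∧ ContDiff ℝ (⊤ : ℕ∞) (Function.invFun Φ)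

/-- A hyperplane `H ⊆ ℝ³` is unknotted if some diffeomorphism of ℝ³ maps it onto `ℝ² × {0}`. -/
def HyperplaneUnknotted (H : Set (EuclideanSpace ℝ (Fin 3))) : Prop :=
  ∃ Φ, DiffeoR3 Φ ∧ Φ '' H = {x : EuclideanSpace ℝ (Fin 3) | x 2 = 0}

/-- A ray (given by its image `r ⊆ ℝ³`) is unknotted if some diffeomorphism of ℝ³ maps it onto
the standard straight ray `{(t,0,0) : t ≥ 0}`. -/
def RayUnknotted (r : Set (EuclideanSpace ℝ (Fin 3))) : Prop :=
  ∃ Φ, DiffeoR3 Φ ∧ Φ '' r = {x : EuclideanSpace ℝ (Fin 3) | 0 ≤ x 0 ∧ x 1 = 0 ∧ x 2 = 0}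

section
open Filter Topology
open scoped ContDiff

open scoped Manifold Topology in
/-- Smooth selection from a family of convex sets. -/
theorem exists_smooth_mem_convex {E F : Type} [NormedAddCommGroup E] [NormedSpace ℝ E]
    [FiniteDimensional ℝ E] [NormedAddCommGroup F] [NormedSpace ℝ F] (t : E → Set F)
    (ht : ∀ x, Convex ℝ (t x))
    (hloc : ∀ x, ∃ U ∈ 𝓝 x, ∃ g : E → F, ContDiffOn ℝ ∞ g U ∧ ∀ y ∈ U, g y ∈ t y) :
    ∃ g : E → F, ContDiff ℝ ∞ g ∧ ∀ x, g x ∈ t x := by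
  obtain ⟨g, hg⟩ := exists_contMDiffMap_forall_mem_convex_of_local (n := ⊤) 𝓘(ℝ, E) ht
    (fun x => by
      obtain ⟨U, hU, g, hg, h⟩ := hloc x
      exact ⟨U, hU, g, hg.contMDiffOn, h⟩)
  exact ⟨g, g.contMDiff.contDiff, hg⟩

open scoped Topology in
theorem exists_smooth_mem_convex_of_const {E F : Type} [NormedAddCommGroup E] [NormedSpace ℝ E]
    [FiniteDimensional ℝ E] [NormedAddCommGroup F] [NormedSpace ℝ F] (t : E → Set F)
    (ht : ∀ x, Convex ℝ (t x)) (hloc : ∀ x, ∃ c : F, ∀ᶠ y in 𝓝 x, c ∈ t y) :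
    ∃ g : E → F, ContDiff ℝ ∞ g ∧ ∀ x, g x ∈ t x :=
  exists_smooth_mem_convex t ht fun x =>
    let ⟨c, hc⟩ := hloc x
    ⟨_, hc, fun _ => c, contDiffOn_const, fun _ hy => hy⟩

/-- Smooth Urysohn function: one near `Z`, zero off the open set `O`. -/
theorem exists_smooth_one_nhds_of_subset {E : Type} [NormedAddCommGroup E] [NormedSpace ℝ E]
    [FiniteDimensional ℝ E] {Z O : Set E} (hZ : IsClosed Z) (hO : IsOpen O) (hZO : Z ⊆ O) :
    ∃ χ : E → ℝ, ContDiff ℝ ∞ χ ∧ (∃ U, IsOpen U ∧ Z ⊆ U ∧ ∀ x ∈ U, χ x = 1) ∧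
      tsupport χ ⊆ O ∧ ∀ x, χ x ∈ Icc (0 : ℝ) 1 := by
  obtain ⟨V, hV, hZV, hVO⟩ := normal_exists_closure_subset hZ hO hZO
  obtain ⟨V', hV', hZV', hVO'⟩ := normal_exists_closure_subset hZ hV hZV
  obtain ⟨χ, h0, h1, h2⟩ := exists_contMDiffMap_zero_one_of_isClosed
    (modelWithCornersSelf ℝ E) (n := ⊤) (s := Vᶜ) (t := closure V') hV.isClosed_compl
    isClosed_closure (disjoint_left.2 fun x hx hx' => hx (hVO' hx'))
  refine ⟨χ, χ.contMDiff.contDiff, ⟨V', hV', hZV', fun x hx => h1 (subset_closure hx)⟩, ?_, h2⟩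
  refine (closure_mono ?_).trans hVO
  intro x hx
  by_contra h
  exact hx (h0 h)

/-- A smooth diffeomorphism between normed spaces. -/
structure Dfm (E F : Type) [NormedAddCommGroup E] [NormedSpace ℝ E]
    [NormedAddCommGroup F] [NormedSpace ℝ F] extends E ≃ F where
  smooth : ContDiff ℝ ∞ toFun
  smooth_symm : ContDiff ℝ ∞ invFun

namespace Dfm
variable {E F G : Type} [NormedAddCommGroup E] [NormedSpace ℝ E]
    [NormedAddCommGroup F] [NormedSpace ℝ F] [NormedAddCommGroup G] [NormedSpace ℝ G]

instance : CoeFun (Dfm E F) (fun _ => E → F) := ⟨fun d => ⇑d.toEquiv⟩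

def symm (d : Dfm E F) : Dfm F E := ⟨d.toEquiv.symm, d.smooth_symm, d.smooth⟩

def trans (d : Dfm E F) (e : Dfm F G) : Dfm E G :=
  ⟨d.toEquiv.trans e.toEquiv, e.smooth.comp d.smooth, d.smooth_symm.comp e.smooth_symm⟩

def ofCLE (L : E ≃L[ℝ] F) : Dfm E F := ⟨L.toEquiv, L.contDiff, L.symm.contDiff⟩

@[simp] theorem symm_apply_apply (d : Dfm E F) (x : E) : d.symm (d x) = x := d.left_inv x
@[simp] theorem apply_symm_apply (d : Dfm E F) (x : F) : d (d.symm x) = x := d.right_inv x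
@[simp] theorem trans_apply (d : Dfm E F) (e : Dfm F G) (x : E) : d.trans e x = e (d x) := rfl
@[simp] theorem ofCLE_apply (L : E ≃L[ℝ] F) (x : E) : ofCLE L x = L x := rfl
theorem injective (d : Dfm E F) : Function.Injective d := d.toEquiv.injective
theorem surjective (d : Dfm E F) : Function.Surjective d := d.toEquiv.surjective
theorem bijective (d : Dfm E F) : Function.Bijective d := d.toEquiv.bijective
theorem contDiff (d : Dfm E F) : ContDiff ℝ ∞ d := d.smooth
theorem continuous (d : Dfm E F) : Continuous d := d.smooth.continuous
@[simp] theorem symm_symm (d : Dfm E F) : d.symm.symm = d := rfl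

def toHomeo (d : Dfm E F) : E ≃ₜ F := ⟨d.toEquiv, d.continuous, d.symm.continuous⟩

@[simp] theorem toHomeo_apply (d : Dfm E F) (x : E) : d.toHomeo x = d x := rfl

end Dfm

/-- `L` is an invertible derivative. -/
theorem ContDiffAt.of_inverse {E F : Type} [NormedAddCommGroup E] [NormedSpace ℝ E]
    [CompleteSpace E] [NormedAddCommGroup F] [NormedSpace ℝ F] {f : E → F} {g : F → E} {a : E}
    (hf : ContDiffAt ℝ ∞ f a) (hg : ContinuousAt g (f a)) (hga : g (f a) = a)
    (hfg : ∀ᶠ y in nhds (f a), f (g y) = y)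
    (L : E ≃L[ℝ] F) (hL : HasFDerivAt f (L : E →L[ℝ] F) a) : ContDiffAt ℝ ∞ g (f a) := by
  have hn : (∞ : WithTop ℕ∞) ≠ 0 := by simp
  set Ψ := hf.toOpenPartialHomeomorph f hL hn with hΨ
  have h1 := hf.to_localInverse hL hn
  refine h1.congr_of_eventuallyEq ?_
  have hs : ∀ᶠ y in nhds (f a), g y ∈ Ψ.source := by
    apply hg.eventually_mem
    rw [hga]
    exact Ψ.open_source.mem_nhds (hf.mem_toOpenPartialHomeomorph_source hL hn)
  filter_upwards [hs, hfg] with y hy hy'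
  have : Ψ.symm (Ψ (g y)) = g y := Ψ.left_inv hy
  rw [← this]
  congr 1

/-- Bijective derivative of a smooth bijection gives smooth inverse. -/
theorem exists_dfm_of_bijective {E F : Type} [NormedAddCommGroup E] [NormedSpace ℝ E]
    [CompleteSpace E] [NormedAddCommGroup F] [NormedSpace ℝ F] (f : E → F)
    (hf : ContDiff ℝ ∞ f) (hb : Function.Bijective f)
    (hL : ∀ a, ∃ L : E ≃L[ℝ] F, HasFDerivAt f (L : E →L[ℝ] F) a) :
    ∃ d : Dfm E F, ∀ x, d x = f x := by
  have hn : (∞ : WithTop ℕ∞) ≠ 0 := by simp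
  have hopen : IsOpenMap f := by
    apply IsOpenMap.of_nhds_le
    intro a
    obtain ⟨L, h⟩ := hL a
    exact ((hf.contDiffAt.hasStrictFDerivAt' h hn).map_nhds_eq_of_equiv).ge
  let e := Equiv.ofBijective f hb
  have hce : Continuous e.symm := by
    refine ⟨fun U hU => ?_⟩
    rw [← Equiv.image_eq_preimage_symm]
    exact hopen U hU
  refine ⟨⟨e, hf, ?_⟩, fun x => rfl⟩
  rw [contDiff_iff_contDiffAt]
  intro y
  obtain ⟨a, rfl⟩ := hb.2 y
  obtain ⟨L, h⟩ := hL a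
  exact ContDiffAt.of_inverse hf.contDiffAt hce.continuousAt (e.symm_apply_apply a)
    (Filter.Eventually.of_forall fun y => e.apply_symm_apply y) L h

section ParamIntegral
open MeasureTheory
variable {E F : Type} [NormedAddCommGroup E] [NormedSpace ℝ E]
    [NormedAddCommGroup F] [NormedSpace ℝ F]

theorem contDiff_integral_zero_one (g : E × ℝ → F) (hg : ContDiff ℝ ∞ g) :
    ContDiff ℝ ∞ fun p : E => ∫ t in (0 : ℝ)..1, g (p, t) := by
  let b : ContDiffBump (0 : ℝ) := ⟨1, 2, by norm_num, by norm_num⟩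
  have key := contDiffOn_convolution_right_with_param_comp (𝕜 := ℝ) (n := ⊤) (μ := volume)
    (ContinuousLinearMap.lsmul ℝ ℝ : ℝ →L[ℝ] F →L[ℝ] F) (s := (univ : Set E))
    (v := fun _ : E => (0 : ℝ)) contDiffOn_const
    (f := indicator (Ioc (0 : ℝ) 1) fun _ => 1)
    (g := fun p x => b x • g (p, -x)) (k := Metric.closedBall 0 2) isOpen_univ
    (isCompact_closedBall _ _) ?_ ?_ ?_
  · rw [contDiffOn_univ] at key
    convert! key using 2 with p
    rw [convolution_def, intervalIntegral.integral_of_le zero_le_one, ← integral_indicator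
      measurableSet_Ioc]
    congr 1
    ext t
    by_cases ht : t ∈ Ioc (0 : ℝ) 1
    · have : b (-t) = 1 := b.one_of_mem_closedBall (by
        simp only [Metric.mem_closedBall, dist_zero_right, norm_neg, Real.norm_eq_abs]
        rw [abs_of_pos ht.1]; exact ht.2)
      simp [ht, this]
    · simp [ht]
  · intro p x _ hx
    have : b x = 0 := b.zero_of_le_dist (by
      simp only [Metric.mem_closedBall, not_le] at hx; exact hx.le)
    simp [this]
  · exact ((integrable_indicator_iff measurableSet_Ioc).2 (by simp)).locallyIntegrable
  · apply ContDiff.contDiffOn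
    exact (b.contDiff.comp contDiff_snd).smul (hg.comp (contDiff_fst.prodMk contDiff_snd.neg))

theorem contDiff_primitive (g : E × ℝ → F) (hg : ContDiff ℝ ∞ g) :
    ContDiff ℝ ∞ fun p : E × ℝ => ∫ t in (0 : ℝ)..p.2, g (p.1, t) := by
  have h := contDiff_integral_zero_one (E := E × ℝ) (fun q => g (q.1.1, q.1.2 * q.2))
    (hg.comp ((contDiff_fst.fst).prodMk (contDiff_fst.snd.mul contDiff_snd)))
  have h2 := (contDiff_snd (E := E) (F := ℝ) (n := ∞) (𝕜 := ℝ)).smul h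
  convert! h2 using 2 with p
  have := intervalIntegral.smul_integral_comp_mul_left (a := 0) (b := 1) (fun t => g (p.1, t)) p.2
  simp only [mul_zero, mul_one] at this
  simp [this]

end ParamIntegral

section
variable {E : Type} [NormedAddCommGroup E] [NormedSpace ℝ E]

theorem hasDerivAt_slice {F : Type} [NormedAddCommGroup F] [NormedSpace ℝ F] {c : E × ℝ → F}
    (hc : ContDiff ℝ ∞ c) (e : E) (s : ℝ) :
    HasDerivAt (fun s => c (e, s)) (fderiv ℝ c (e, s) (0, 1)) s := by
  have h1 := (hc.differentiable (by simp) (e, s)).hasFDerivAt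
  have h2 : HasDerivAt (fun s : ℝ => (e, s)) ((0 : E), (1 : ℝ)) s :=
    (hasDerivAt_const s e).prodMk (hasDerivAt_id s)
  exact h1.comp_hasDerivAt s h2

/-- A smooth map which is increasing and onto in the last variable gives a diffeomorphism. -/
theorem exists_dfm_of_mono [CompleteSpace E] (c : E × ℝ → ℝ) (hc : ContDiff ℝ ∞ c)
    (hpos : ∀ p, 0 < fderiv ℝ c p (0, 1))
    (honto : ∀ e y, ∃ s, c (e, s) = y) :
    ∃ d : Dfm (E × ℝ) (E × ℝ), ∀ p, d p = (p.1, c p) := by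
  apply exists_dfm_of_bijective
  · exact contDiff_fst.prodMk hc
  · constructor
    · rintro ⟨e, s⟩ ⟨e', s'⟩ h
      simp only [Prod.mk.injEq] at h
      obtain ⟨rfl, h⟩ := h
      have hm : StrictMono fun s => c (e, s) := by
        apply strictMono_of_deriv_pos
        intro s
        rw [(hasDerivAt_slice hc e s).deriv]
        exact hpos _
      rw [hm.injective h]
    · rintro ⟨e, y⟩
      obtain ⟨s, hs⟩ := honto e y
      exact ⟨(e, s), by simp [hs]⟩
  · intro p
    have hd := (hc.differentiable (by simp) p).hasFDerivAt
    set L := fderiv ℝ c p with hL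
    have h0 : L (0, 1) ≠ 0 := (hpos p).ne'
    have key : ∀ (x : E) (t : ℝ), L (x, t) = L (x, 0) + t * L (0, 1) := by
      intro x t
      have : ((x, t) : E × ℝ) = (x, 0) + t • (0, 1) := by simp
      rw [this, map_add, map_smul, smul_eq_mul]
    refine ⟨ContinuousLinearEquiv.equivOfInverse ((ContinuousLinearMap.fst ℝ E ℝ).prod L)
      ((ContinuousLinearMap.fst ℝ E ℝ).prod ((L (0, 1))⁻¹ • (ContinuousLinearMap.snd ℝ E ℝ -
        L.comp ((ContinuousLinearMap.inl ℝ E ℝ).comp (ContinuousLinearMap.fst ℝ E ℝ))))) ?_ ?_, ?_⟩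
    · rintro ⟨x, t⟩
      simp [key x t]
      field_simp
    · rintro ⟨x, t⟩
      have := key x ((L (0, 1))⁻¹ * (t - L (x, 0)))
      have h3 : (L (0, 1))⁻¹ * (t - L (x, 0)) * L (0, 1) = t - L (x, 0) := by field_simp
      rw [h3] at this
      simp [this]
    · exact hasFDerivAt_fst.prodMk hd

theorem strictMono_slice {c : E × ℝ → ℝ} (hc : ContDiff ℝ ∞ c)
    (hpos : ∀ p, 0 < fderiv ℝ c p (0, 1)) (e : E) : StrictMono fun s => c (e, s) :=
  strictMono_of_deriv_pos fun s => by
    rw [(hasDerivAt_slice hc e s).deriv]; exact hpos _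

/-- Extend the germ of a monotone function to a global diffeomorphism. -/
theorem exists_dfm_extending [FiniteDimensional ℝ E] (c : E × ℝ → ℝ) (hc : ContDiff ℝ ∞ c)
    {O Z : Set (E × ℝ)} (hO : IsOpen O) (hZ : IsClosed Z) (hZO : Z ⊆ O)
    (hstar : ∀ e s, (e, s) ∈ Z → ∀ θ ∈ Icc (0 : ℝ) 1, (e, θ * s) ∈ Z)
    (hpos : ∀ e, ∃ δ > 0, ∀ s, (e, s) ∈ O → δ ≤ fderiv ℝ c (e, s) (0, 1)) :
    ∃ d : Dfm (E × ℝ) (E × ℝ), (∀ p, (d p).1 = p.1) ∧ (∀ e, d (e, 0) = (e, c (e, 0))) ∧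
      (∀ e, StrictMono fun s => (d (e, s)).2) ∧ ∃ U, IsOpen U ∧ Z ⊆ U ∧ ∀ p ∈ U, d p = (p.1, c p) := by
  obtain ⟨χ, hχ, ⟨V, hV, hZV, hV1⟩, hsupp, hχ01⟩ := exists_smooth_one_nhds_of_subset hZ hO hZO
  have hcs : ContDiff ℝ ∞ fun p => fderiv ℝ c p (0, 1) :=
    (hc.fderiv_right (m := ∞) (by simp)).clm_apply contDiff_const
  set g : E × ℝ → ℝ := fun p => χ p * fderiv ℝ c p (0, 1) + (1 - χ p) with hg
  have hgs : ContDiff ℝ ∞ g := (hχ.mul hcs).add (contDiff_const.sub hχ)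
  set c' : E × ℝ → ℝ := fun p => c (p.1, 0) + ∫ t in (0 : ℝ)..p.2, g (p.1, t) with hc'
  have hc's : ContDiff ℝ ∞ c' :=
    (hc.comp (contDiff_fst.prodMk contDiff_const)).add (contDiff_primitive g hgs)
  have hgc : ∀ e : E, Continuous fun t : ℝ => g (e, t) := fun e =>
    hgs.continuous.comp (by fun_prop)
  have hder : ∀ e s, HasDerivAt (fun s => c' (e, s)) (g (e, s)) s := by
    intro e s
    have := intervalIntegral.integral_hasDerivAt_right
      ((hgc e).intervalIntegrable 0 s) ((hgc e).stronglyMeasurableAtFilter _ _) (hgc e).continuousAt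
    simpa [hc'] using this
  have hlow : ∀ e, ∃ δ > 0, ∀ s, δ ≤ g (e, s) := by
    intro e
    obtain ⟨δ, hδ, h⟩ := hpos e
    refine ⟨min δ 1, by positivity, fun s => ?_⟩
    obtain ⟨h0, h1⟩ := hχ01 (e, s)
    have hm1 : min δ 1 ≤ 1 := min_le_right _ _
    by_cases hs : (e, s) ∈ O
    · have := h s hs
      have hm : min δ 1 ≤ fderiv ℝ c (e, s) (0, 1) := (min_le_left _ _).trans this
      simp only [hg]
      nlinarith
    · have : χ (e, s) = 0 := by
        by_contra hne
        exact hs (hsupp (subset_closure hne))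
      simp [hg, this]
  have hfd : ∀ p, fderiv ℝ c' p (0, 1) = g p := fun p =>
    (hasDerivAt_slice hc's p.1 p.2).unique (hder p.1 p.2)
  have hpos' : ∀ p, 0 < fderiv ℝ c' p (0, 1) := fun p => by
    rw [hfd]
    obtain ⟨δ, hδ, h⟩ := hlow p.1
    exact hδ.trans_le (h p.2)
  obtain ⟨d, hd⟩ := exists_dfm_of_mono c' hc's hpos' (fun e y => by
    obtain ⟨δ, hδ, h⟩ := hlow e
    have hcont : Continuous fun s => c' (e, s) := hc's.continuous.comp (by fun_prop)
    have hmono : Monotone fun s => c' (e, s) - δ * s := by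
      refine monotone_of_deriv_nonneg ?_ ?_
      · intro s
        exact ((hder e s).sub ((hasDerivAt_id s).const_mul δ)).differentiableAt
      · intro s
        have := ((hder e s).sub ((hasDerivAt_id s).const_mul δ)).deriv
        simp only [id, mul_one] at this
        erw [this]
        linarith [h s]
    have hle : ∀ s, 0 ≤ s → c' (e, 0) + δ * s ≤ c' (e, s) := by
      intro s hs
      have := hmono hs
      simp only [mul_zero, sub_zero] at this
      linarith
    have hge : ∀ s, s ≤ 0 → c' (e, s) ≤ c' (e, 0) + δ * s := by
      intro s hs
      have := hmono hs
      simp only [mul_zero, sub_zero] at this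
      linarith
    set M := (|y - c' (e, 0)|) / δ with hM
    have hM0 : 0 ≤ M := by positivity
    have hδM : δ * M = |y - c' (e, 0)| := by rw [hM]; field_simp
    have h1 := hle M hM0
    have h2 := hge (-M) (by linarith)
    obtain ⟨s, -, hs⟩ := intermediate_value_Icc (by linarith : -M ≤ M) hcont.continuousOn
      (⟨by
        have := neg_abs_le (y - c' (e, 0))
        nlinarith, by
        have := le_abs_self (y - c' (e, 0))
        nlinarith⟩ : y ∈ Icc (c' (e, -M)) (c' (e, M)))
    exact ⟨s, hs⟩)
  refine ⟨d, fun p => by rw [hd], fun e => by rw [hd]; simp [hc'],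
    fun e => by simpa only [hd] using strictMono_slice hc's hpos' e,
    {p | ∀ θ ∈ Icc (0 : ℝ) 1, (p.1, θ * p.2) ∈ V}, ?_, ?_, ?_⟩
  · rw [isOpen_iff_mem_nhds]
    intro p hp
    refine isCompact_Icc.eventually_forall_of_forall_eventually (P := fun (p : E × ℝ) (θ : ℝ) => (p.1, θ * p.2) ∈ V)
      fun θ hθ => ?_
    have hcont : Continuous fun z : (E × ℝ) × ℝ => (z.1.1, z.2 * z.1.2) := by fun_prop
    exact hcont.continuousAt.eventually_mem (hV.mem_nhds (hp θ hθ))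
  · intro p hp θ hθ
    exact hZV (hstar p.1 p.2 hp θ hθ)
  · rintro ⟨e, s⟩ hp
    rw [hd]
    simp only [hc', Prod.mk.injEq, true_and]
    have hInt : ∫ t in (0 : ℝ)..s, g (e, t) = c (e, s) - c (e, 0) := by
      apply intervalIntegral.integral_eq_sub_of_hasDerivAt
      · intro t ht
        have hmem : (e, t) ∈ V := by
          by_cases hs : s = 0
          · subst hs
            simp only [uIcc_self, mem_singleton_iff] at ht
            subst ht
            simpa using hp 0 (by simp)
          · have := hp (t / s) ?_
            · simpa [div_mul_cancel₀ t hs] using this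
            · rw [mem_uIcc] at ht
              rcases ht with ⟨h1, h2⟩ | ⟨h1, h2⟩
              · exact ⟨div_nonneg h1 (h1.trans h2), div_le_one_of_le₀ h2 (h1.trans h2)⟩
              · exact ⟨div_nonneg_of_nonpos h2 (h1.trans h2), by
                  rw [div_le_one_of_neg (lt_of_le_of_ne (h1.trans h2) hs)]; exact h1⟩
        have : g (e, t) = fderiv ℝ c (e, t) (0, 1) := by simp [hg, hV1 _ hmem]
        rw [this]
        exact hasDerivAt_slice hc e t
      · exact (hgc e).intervalIntegrable _ _
    rw [hInt]; ring

end

/-- The closed upper half space. -/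
def HS (E : Type) : Set (E × ℝ) := {p | 0 ≤ p.2}

theorem HS_eq {E : Type} : HS E = univ ×ˢ Ici (0 : ℝ) := by ext p; simp [HS]

section Extension
variable {E F : Type} [NormedAddCommGroup E] [NormedSpace ℝ E]
    [NormedAddCommGroup F] [NormedSpace ℝ F]

theorem uniqueDiffOn_HS : UniqueDiffOn ℝ (HS E) := by
  rw [HS_eq]; exact uniqueDiffOn_univ.prod (uniqueDiffOn_Ici 0)

theorem HS_subset_closure_interior : HS E ⊆ closure (interior (HS E)) := by
  rw [HS_eq, interior_prod_eq, closure_prod_eq]; simp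

/-- Vertical derivative within the half space. -/
noncomputable def vd (u : E × ℝ → F) (p : E × ℝ) : F := fderivWithin ℝ u (HS E) p (0, 1)

theorem ContDiffOn.vd {u : E × ℝ → F} (hu : ContDiffOn ℝ ∞ u (HS E)) :
    ContDiffOn ℝ ∞ (vd u) (HS E) :=
  (hu.fderivWithin uniqueDiffOn_HS (by simp)).clm_apply contDiffOn_const

theorem ContDiffOn.vd_iterate {u : E × ℝ → F} (hu : ContDiffOn ℝ ∞ u (HS E)) (n : ℕ) :
    ContDiffOn ℝ ∞ (_root_.vd^[n] u) (HS E) := by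
  induction n with
  | zero => exact hu
  | succ n ih => rw [Function.iterate_succ_apply']; exact ih.vd

theorem vd_congr {u v : E × ℝ → F} (h : EqOn u v (HS E)) : EqOn (vd u) (vd v) (HS E) := by
  intro p hp
  simp only [vd, fderivWithin_congr h (h hp)]

theorem vd_iterate_sub {u v : E × ℝ → F} (hu : ContDiffOn ℝ ∞ u (HS E))
    (hv : ContDiffOn ℝ ∞ v (HS E)) (n : ℕ) :
    EqOn (vd^[n] (u - v)) (vd^[n] u - vd^[n] v) (HS E) := by
  induction n with
  | zero => intro p _; rfl
  | succ n ih =>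
    intro p hp
    simp only [Function.iterate_succ_apply', Pi.sub_apply]
    rw [vd_congr ih hp]
    simp only [vd]
    rw [fderivWithin_sub (uniqueDiffOn_HS p hp) ((hu.vd_iterate n).differentiableOn (by simp) p hp)
      ((hv.vd_iterate n).differentiableOn (by simp) p hp)]
    simp

theorem vd_iterate_eq {u : E × ℝ → F} (hu : ContDiff ℝ ∞ u) (n : ℕ) :
    EqOn (vd^[n] u) (fun p => iteratedFDeriv ℝ n u p fun _ => (0, 1)) (HS E) := by
  induction n with
  | zero => intro p _; simp
  | succ n ih =>
    intro p hp
    simp only [Function.iterate_succ_apply']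
    rw [vd_congr ih hp]
    have hd : DifferentiableAt ℝ (iteratedFDeriv ℝ n u) p :=
      (hu.differentiable_iteratedFDeriv (by exact_mod_cast WithTop.coe_lt_top n)) p
    have hd' : HasFDerivAt (fun p => iteratedFDeriv ℝ n u p fun _ => ((0 : E), (1 : ℝ)))
      ((fderiv ℝ (iteratedFDeriv ℝ n u) p).flipMultilinear fun _ => ((0 : E), (1 : ℝ))) p := by
      exact hd.hasFDerivAt.continuousMultilinear_apply_const _
    simp only [vd]
    rw [hd'.hasFDerivWithinAt.fderivWithin (uniqueDiffOn_HS p hp)]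
    rw [iteratedFDeriv_succ_apply_left]
    rfl

theorem vd_fderivWithin {u : E × ℝ → F} (hu : ContDiffOn ℝ ∞ u (HS E)) :
    EqOn (vd (fderivWithin ℝ u (HS E))) (fderivWithin ℝ (vd u) (HS E)) (HS E) := by
  intro p hp
  have hs := (hu p hp).isSymmSndFDerivWithinAt (by
    simp only [minSmoothness_of_isRCLikeNormedField]
    exact WithTop.coe_le_coe.2 (le_top : (2 : ℕ∞) ≤ ⊤)) uniqueDiffOn_HS
    (HS_subset_closure_interior hp) hp
  have hd : DifferentiableWithinAt ℝ (fderivWithin ℝ u (HS E)) (HS E) p :=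
    (hu.fderivWithin uniqueDiffOn_HS (m := ∞) (by simp)).differentiableOn (by simp) p hp
  have h1 : HasFDerivWithinAt (vd u) ((fderivWithin ℝ (fderivWithin ℝ u (HS E)) (HS E) p).flip
      (0, 1)) (HS E) p := by
    have := hd.hasFDerivWithinAt.clm_apply (hasFDerivWithinAt_const ((0 : E), (1 : ℝ)) p (HS E))
    simp only [ContinuousLinearMap.comp_zero, zero_add] at this
    exact this
  rw [h1.fderivWithin (uniqueDiffOn_HS p hp)]
  refine ContinuousLinearMap.ext fun v => ?_
  simp only [vd]
  exact hs _ _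

theorem vd_iterate_fderivWithin {u : E × ℝ → F} (hu : ContDiffOn ℝ ∞ u (HS E)) (n : ℕ) :
    EqOn (vd^[n] (fderivWithin ℝ u (HS E))) (fderivWithin ℝ (vd^[n] u) (HS E)) (HS E) := by
  induction n with
  | zero => intro p _; rfl
  | succ n ih =>
    intro p hp
    simp only [Function.iterate_succ_apply']
    rw [vd_congr ih hp, vd_fderivWithin (hu.vd_iterate n) hp]

theorem fderivWithin_eq_zero_of_vd {v : E × ℝ → F} (hv : ContDiffOn ℝ ∞ v (HS E))
    (h0 : ∀ q, v (q, 0) = 0) (h1 : ∀ q, vd v (q, 0) = 0) (q : E) :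
    fderivWithin ℝ v (HS E) (q, 0) = 0 := by
  have hmem : ((q, 0) : E × ℝ) ∈ HS E := le_refl (0 : ℝ)
  have hd := (hv.differentiableOn (by simp) _ hmem).hasFDerivWithinAt
  have hc : HasFDerivAt (fun q' : E => v (q', 0))
      ((fderivWithin ℝ v (HS E) (q, 0)).comp (ContinuousLinearMap.inl ℝ E ℝ)) q := by
    have hi : HasFDerivAt (fun q' : E => ((q', 0) : E × ℝ)) (ContinuousLinearMap.inl ℝ E ℝ) q :=
      hasFDerivAt_prodMk_left q 0
    rw [← hasFDerivWithinAt_univ] at hi ⊢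
    exact hd.comp q hi (fun q' _ => le_refl (0 : ℝ))
  have hz : (fun q' : E => v (q', 0)) = fun _ => 0 := funext h0
  rw [hz] at hc
  have h2 := hc.unique (hasFDerivAt_const 0 q)
  refine ContinuousLinearMap.ext fun ⟨a, t⟩ => ?_
  have : ((a, t) : E × ℝ) = (a, 0) + t • (0, 1) := by simp
  rw [this, map_add, map_smul]
  have h3 : fderivWithin ℝ v (HS E) (q, 0) (a, 0) = 0 := by
    have := DFunLike.congr_fun h2 a
    simpa using this
  have h4 : fderivWithin ℝ v (HS E) (q, 0) (0, 1) = 0 := h1 q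
  rw [h3, h4]; simp

open Classical in
theorem contDiff_indicator_of_flat (n : ℕ) {F : Type} [NormedAddCommGroup F] [NormedSpace ℝ F]
    {u : E × ℝ → F} (hu : ContDiffOn ℝ ∞ u (HS E))
    (hflat : ∀ n q, (vd^[n] u) (q, 0) = 0) :
    ContDiff ℝ n (indicator (HS E) u) := by
  induction n generalizing F with
  | zero =>
    simp only [Nat.cast_zero, contDiff_zero, ← piecewise_eq_indicator]
    refine continuous_piecewise ?_ ?_ continuousOn_const
    · rintro ⟨q, z⟩ hp
      have : z = 0 := by
        have : frontier (HS E) = univ ×ˢ {(0 : ℝ)} := by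
          rw [HS_eq, frontier_univ_prod_eq, frontier_Ici]
        rw [this] at hp
        simpa using hp
      subst this
      exact hflat 0 q
    · have : closure (HS E) = HS E := by rw [HS_eq, closure_prod_eq]; simp
      rw [this]
      exact hu.continuousOn
  | succ n ih =>
    have hmem : ∀ q : E, ((q, 0) : E × ℝ) ∈ HS E := fun q => le_refl (0 : ℝ)
    have hDu : ContDiffOn ℝ ∞ (fderivWithin ℝ u (HS E)) (HS E) :=
      hu.fderivWithin uniqueDiffOn_HS (by simp)
    have hflat' : ∀ n q, (vd^[n] (fderivWithin ℝ u (HS E))) (q, 0) = 0 := by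
      intro n q
      rw [vd_iterate_fderivWithin hu n (hmem q)]
      refine fderivWithin_eq_zero_of_vd (hu.vd_iterate n) (hflat n) (fun q => ?_) q
      have := hflat (n + 1) q
      rwa [Function.iterate_succ_apply'] at this
    have hder : ∀ p, HasFDerivAt (indicator (HS E) u)
        (indicator (HS E) (fderivWithin ℝ u (HS E)) p) p := by
      rintro ⟨q, z⟩
      rcases lt_trichotomy z 0 with hz | rfl | hz
      · have hn : ((q, z) : E × ℝ) ∉ HS E := not_le.2 hz
        rw [indicator_of_notMem hn]
        refine (hasFDerivAt_const (0 : F) _).congr_of_eventuallyEq ?_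
        have : IsOpen {p : E × ℝ | p.2 < 0} := isOpen_lt continuous_snd continuous_const
        filter_upwards [this.mem_nhds hz] with p hp
        exact indicator_of_notMem (fun h : p ∈ HS E => absurd hp (not_lt.2 h)) _
      · rw [indicator_of_mem (hmem q)]
        have h0 : fderivWithin ℝ u (HS E) (q, 0) = 0 := hflat' 0 q
        have h1 : HasFDerivWithinAt (indicator (HS E) u) (0 : E × ℝ →L[ℝ] F) (HS E) (q, 0) := by
          have := (hu.differentiableOn (by simp) _ (hmem q)).hasFDerivWithinAt
          rw [h0] at this
          exact this.congr (fun p hp => indicator_of_mem hp _) (indicator_of_mem (hmem q) _)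
        have h2 : HasFDerivWithinAt (indicator (HS E) u) (0 : E × ℝ →L[ℝ] F) (HS E)ᶜ (q, 0) := by
          refine (hasFDerivWithinAt_const (0 : F) _ _).congr
            (fun p hp => indicator_of_notMem hp _) ?_
          rw [indicator_of_mem (hmem q)]
          exact hflat 0 q
        rw [h0, ← hasFDerivWithinAt_univ, ← union_compl_self (HS E)]
        exact h1.union h2
      · have hn : ((q, z) : E × ℝ) ∈ HS E := hz.le
        rw [indicator_of_mem hn]
        have hnh : HS E ∈ nhds ((q, z) : E × ℝ) := by
          have : IsOpen {p : E × ℝ | 0 < p.2} := isOpen_lt continuous_const continuous_snd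
          filter_upwards [this.mem_nhds hz] with p hp using le_of_lt hp
        have h1 := (hu.differentiableOn (by simp) _ hn).hasFDerivWithinAt.hasFDerivAt hnh
        refine h1.congr_of_eventuallyEq ?_
        filter_upwards [hnh] with p hp
        exact indicator_of_mem hp _
    push_cast
    rw [contDiff_succ_iff_fderiv]
    refine ⟨fun p => (hder p).differentiableAt, by simp, ?_⟩
    have : fderiv ℝ (indicator (HS E) u) = indicator (HS E) (fderivWithin ℝ u (HS E)) :=
      funext fun p => (hder p).fderiv
    rw [this]
    exact ih hDu hflat'

theorem contDiff_indicator_of_flat' {u : E × ℝ → F} (hu : ContDiffOn ℝ ∞ u (HS E))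
    (hflat : ∀ n q, (vd^[n] u) (q, 0) = 0) :
    ContDiff ℝ ∞ (indicator (HS E) u) :=
  contDiff_infty.2 fun n => contDiff_indicator_of_flat n hu hflat

end Extension

section Borel
variable {E F : Type} [NormedAddCommGroup E] [NormedSpace ℝ E]
    [NormedAddCommGroup F] [NormedSpace ℝ F]

theorem iteratedDeriv_slice {u : E × ℝ → F} (hu : ContDiff ℝ ∞ u) (q : E) (n : ℕ) (z : ℝ) :
    iteratedDeriv n (fun z => u (q, z)) z = iteratedFDeriv ℝ n u (q, z) fun _ => (0, 1) := by
  induction n generalizing z with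
  | zero => simp
  | succ n ih =>
    rw [iteratedDeriv_succ, funext ih]
    have hd : DifferentiableAt ℝ (iteratedFDeriv ℝ n u) (q, z) :=
      (hu.differentiable_iteratedFDeriv (by exact_mod_cast WithTop.coe_lt_top n)) _
    have h2 : HasDerivAt (fun s : ℝ => (q, s)) ((0 : E), (1 : ℝ)) z :=
      (hasDerivAt_const z q).prodMk (hasDerivAt_id z)
    have hd' := (hd.hasFDerivAt.continuousMultilinear_apply_const
      (fun _ => ((0 : E), (1 : ℝ)))).comp_hasDerivAt z h2
    refine hd'.deriv.trans ?_
    rw [iteratedFDeriv_succ_apply_left]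
    rfl

/-- Borel's lemma with parameters. -/
theorem exists_smooth_of_jets [FiniteDimensional ℝ E] [CompleteSpace F] (a : ℕ → E → F)
    (ha : ∀ n, ContDiff ℝ ∞ (a n)) (hac : ∀ n, HasCompactSupport (a n)) :
    ∃ b : E × ℝ → F, ContDiff ℝ ∞ b ∧
      ∀ n q, (iteratedFDeriv ℝ n b (q, 0) fun _ => ((0 : E), (1 : ℝ))) = a n q := by
  let χ : ContDiffBump (0 : ℝ) := ⟨1, 2, by norm_num, by norm_num⟩
  set h : ℕ → E × ℝ → F := fun n p => (χ p.2 * (p.2 ^ n / n.factorial)) • a n p.1 with hh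
  have hhs : ∀ n, ContDiff ℝ ∞ (h n) := fun n =>
    ((χ.contDiff.comp contDiff_snd).mul ((contDiff_snd.pow n).div_const _)).smul
      ((ha n).comp contDiff_fst)
  have hhc : ∀ n, HasCompactSupport (h n) := by
    intro n
    refine HasCompactSupport.intro (K := tsupport (a n) ×ˢ Metric.closedBall 0 2)
      ((hac n).prod (isCompact_closedBall _ _)) ?_
    rintro ⟨q, z⟩ hp
    rw [mem_prod, not_and_or] at hp
    rcases hp with hp | hp
    · simp [hh, image_eq_zero_of_notMem_tsupport hp]
    · have : χ z = 0 := χ.zero_of_le_dist (by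
        simp only [Metric.mem_closedBall, not_le] at hp; exact hp.le)
      simp [hh, this]
  have hbound : ∀ n k : ℕ, ∃ C, ∀ p, ‖iteratedFDeriv ℝ k (h n) p‖ ≤ C := fun n k =>
    ((hhs n).continuous_iteratedFDeriv (by exact_mod_cast le_top)).bounded_above_of_compact_support
      ((hhc n).iteratedFDeriv k)
  choose C hC using hbound
  have hC0 : ∀ n k, 0 ≤ C n k := fun n k => (norm_nonneg _).trans (hC n k 0)
  set lam : ℕ → ℝ := fun n => 1 + 2 ^ n * ∑ k ∈ Finset.range n, C n k with hlam
  have hlam1 : ∀ n, 1 ≤ lam n := fun n => by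
    have : 0 ≤ ∑ k ∈ Finset.range n, C n k := Finset.sum_nonneg fun k _ => hC0 n k
    simp only [hlam]; nlinarith [mul_nonneg (pow_nonneg (zero_le_two (α := ℝ)) n) this]
  have hlam0 : ∀ n, 0 < lam n := fun n => zero_lt_one.trans_le (hlam1 n)
  let L : ℕ → (E × ℝ →L[ℝ] E × ℝ) := fun n =>
    (ContinuousLinearMap.fst ℝ E ℝ).prod (lam n • ContinuousLinearMap.snd ℝ E ℝ)
  have hLn : ∀ n, ‖L n‖ ≤ lam n := fun n => by
    refine ContinuousLinearMap.opNorm_le_bound _ (hlam0 n).le fun p => ?_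
    simp only [L, ContinuousLinearMap.prod_apply, Prod.norm_def, ContinuousLinearMap.coe_fst',
      _root_.smul_apply, ContinuousLinearMap.coe_snd', smul_eq_mul, norm_mul]
    apply max_le
    · have h1 : ‖p.1‖ ≤ max ‖p.1‖ ‖p.2‖ := le_max_left _ _
      have h2 : 0 ≤ max ‖p.1‖ ‖p.2‖ := (norm_nonneg _).trans h1
      nlinarith [hlam1 n]
    · rw [Real.norm_of_nonneg (hlam0 n).le]
      exact mul_le_mul_of_nonneg_left (le_max_right ‖p.1‖ ‖p.2‖) (hlam0 n).le
  set term : ℕ → E × ℝ → F := fun n p => ((lam n)⁻¹ ^ n) • h n (L n p) with hterm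
  have hts : ∀ n, ContDiff ℝ ∞ (term n) := fun n => ((hhs n).comp (L n).contDiff).const_smul _
  have htb : ∀ n k p, ‖iteratedFDeriv ℝ k (term n) p‖ ≤ (lam n)⁻¹ ^ n * (C n k * lam n ^ k) := by
    intro n k p
    have : term n = ((lam n)⁻¹ ^ n) • (h n ∘ L n) := rfl
    rw [this, iteratedFDeriv_const_smul_apply (((hhs n).comp (L n).contDiff).contDiffAt.of_le
      (by exact_mod_cast le_top)), norm_smul, norm_pow,
      norm_inv, Real.norm_of_nonneg (hlam0 n).le,
      (L n).iteratedFDeriv_comp_right (hhs n) p (by exact_mod_cast le_top)]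
    gcongr
    · exact pow_nonneg (inv_nonneg.2 (hlam0 n).le) n
    refine (ContinuousMultilinearMap.norm_compContinuousLinearMap_le _ _).trans ?_
    gcongr
    · exact hC0 n k
    · exact hC n k _
    · simp only [Finset.prod_const, Finset.card_univ, Fintype.card_fin]
      gcongr
      exact hLn n
  have htb' : ∀ n k, k < n → (lam n)⁻¹ ^ n * (C n k * lam n ^ k) ≤ (1 / 2) ^ n := by
    intro n k hk
    have h1 : (lam n)⁻¹ ^ n * lam n ^ k ≤ (lam n)⁻¹ := by
      obtain ⟨m, rfl⟩ := Nat.exists_eq_add_of_lt hk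
      have : (lam (k + m + 1))⁻¹ ^ (k + m + 1) * lam (k + m + 1) ^ k
          = (lam (k + m + 1))⁻¹ ^ (m + 1) := by
        have := (hlam0 (k + m + 1)).ne'
        rw [show k + m + 1 = (m + 1) + k by ring, pow_add, mul_assoc, ← mul_pow,
          inv_mul_cancel₀ (hlam0 _).ne', one_pow, mul_one]
      rw [this]
      exact pow_le_of_le_one (inv_nonneg.2 (hlam0 _).le) (inv_le_one_of_one_le₀ (hlam1 _)) (by simp)
    have h2 : C n k ≤ ∑ k ∈ Finset.range n, C n k :=
      Finset.single_le_sum (f := fun k => C n k) (fun k _ => hC0 n k) (Finset.mem_range.2 hk)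
    have h3 : 2 ^ n * C n k ≤ lam n := by
      simp only [hlam]; nlinarith [mul_le_mul_of_nonneg_left h2 (pow_nonneg (zero_le_two (α := ℝ)) n)]
    calc (lam n)⁻¹ ^ n * (C n k * lam n ^ k) = C n k * ((lam n)⁻¹ ^ n * lam n ^ k) := by ring
      _ ≤ C n k * (lam n)⁻¹ := by gcongr; exact hC0 n k
      _ ≤ (1 / 2) ^ n := by
        rw [← div_eq_mul_inv, div_le_iff₀ (hlam0 n), one_div, inv_pow, ← div_eq_inv_mul,
          le_div_iff₀ (by positivity)]
        linarith
  have hsum : ∀ k : ℕ, Summable fun n => (lam n)⁻¹ ^ n * (C n k * lam n ^ k) := by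
    intro k
    rw [← summable_nat_add_iff (k + 1)]
    refine Summable.of_nonneg_of_le (fun n => ?_) (fun n => htb' (n + (k + 1)) k (by omega)) ?_
    · have := hC0 (n + (k + 1)) k
      have := hlam0 (n + (k + 1))
      positivity
    · rw [summable_nat_add_iff (k + 1) (f := fun n => ((1 : ℝ) / 2) ^ n)]
      exact summable_geometric_two
  refine ⟨fun p => ∑' n, term n p, ?_, ?_⟩
  · exact contDiff_tsum (N := ⊤) hts (fun k _ => hsum k) (fun k n p _ => htb n k p)
  · intro n q
    rw [iteratedFDeriv_tsum_apply (N := ⊤) hts (fun k _ => hsum k) (fun k n p _ => htb n k p)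
      (by exact_mod_cast le_top)]
    have hsm : Summable fun m => iteratedFDeriv ℝ n (term m) (q, 0) :=
      Summable.of_norm_bounded (hsum n) fun m => htb m n _
    rw [ContinuousMultilinearMap.tsum_eval hsm]
    have hval : ∀ m, (iteratedFDeriv ℝ n (term m) (q, 0) fun _ => ((0 : E), (1 : ℝ))) =
        if m = n then a n q else 0 := by
      intro m
      rw [← iteratedDeriv_slice (hts m)]
      have hev : (fun z => term m (q, z)) =ᶠ[nhds 0]
          fun z => (z ^ m) • ((m.factorial : ℝ)⁻¹ • a m q) := by
        have hop : ∀ᶠ z : ℝ in nhds 0, lam m * z ∈ Metric.ball (0 : ℝ) 1 := by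
          have : Continuous fun z => lam m * z := by fun_prop
          apply this.continuousAt.eventually_mem
          simp [Metric.ball_mem_nhds]
        filter_upwards [hop] with z hz
        have h1 : χ (lam m * z) = 1 := χ.one_of_mem_closedBall (Metric.ball_subset_closedBall hz)
        have := (hlam0 m).ne'
        simp only [hterm, hh, L, ContinuousLinearMap.prod_apply, ContinuousLinearMap.coe_fst',
          _root_.smul_apply, ContinuousLinearMap.coe_snd', smul_eq_mul, h1, smul_smul]
        congr 1
        rw [mul_pow, one_mul, mul_div_assoc', ← mul_assoc, ← mul_pow, inv_mul_cancel₀ this, one_pow,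
          one_mul, div_eq_mul_inv]
      have hev' := Filter.EventuallyEq.iteratedDeriv_eq n hev
      rw [hev']
      have hd : iteratedDeriv n (fun z : ℝ => z ^ m • ((m.factorial : ℝ)⁻¹ • a m q)) 0
          = (iteratedDeriv n (fun z : ℝ => z ^ m) 0) • ((m.factorial : ℝ)⁻¹ • a m q) :=
        iteratedDeriv_smul_const (contDiff_id.pow m).contDiffAt _
      rw [hd, iteratedDeriv_fun_pow_zero]
      by_cases hmn : m = n
      · subst hmn
        simp [smul_smul, Nat.factorial_ne_zero]
      · simp [hmn, Ne.symm hmn]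
    simp only [hval]
    exact tsum_ite_eq n _

/-- A compactly supported smooth function on the half space extends smoothly. -/
theorem exists_extension_of_support [FiniteDimensional ℝ E] [CompleteSpace F] (f : E × ℝ → F)
    (hf : ContDiffOn ℝ ∞ f (HS E)) {K : Set E} (hK : IsCompact K)
    (hsupp : ∀ p ∈ HS E, p.1 ∉ K → f p = 0) :
    ∃ g : E × ℝ → F, ContDiff ℝ ∞ g ∧ EqOn g f (HS E) := by
  have hmem : ∀ q : E, ((q, 0) : E × ℝ) ∈ HS E := fun q => le_refl (0 : ℝ)
  have hzero : ∀ n, ∀ p ∈ HS E, p.1 ∉ K → (vd^[n] f) p = 0 := by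
    intro n
    induction n with
    | zero => exact hsupp
    | succ n ih =>
      intro p hp hpK
      rw [Function.iterate_succ_apply']
      simp only [vd]
      have hev : (vd^[n] f) =ᶠ[nhdsWithin p (HS E)] fun _ => 0 := by
        have hop : IsOpen {p : E × ℝ | p.1 ∉ K} := hK.isClosed.isOpen_compl.preimage continuous_fst
        filter_upwards [self_mem_nhdsWithin, mem_nhdsWithin_of_mem_nhds (hop.mem_nhds hpK)] with
          p' h1 h2 using ih p' h1 h2
      rw [hev.fderivWithin_eq (ih p hp hpK), fderivWithin_const_apply]
      rfl
  obtain ⟨b, hb, hbj⟩ := exists_smooth_of_jets (fun n q => (vd^[n] f) (q, 0))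
    (fun n => by
      rw [← contDiffOn_univ]
      exact (hf.vd_iterate n).comp (contDiff_id.prodMk contDiff_const).contDiffOn
        fun q _ => hmem q)
    (fun n => HasCompactSupport.intro hK fun q hq => hzero n _ (hmem q) hq)
  have hu : ContDiffOn ℝ ∞ (f - b) (HS E) := hf.sub hb.contDiffOn
  have h2 := contDiff_indicator_of_flat' hu fun n q => by
    rw [vd_iterate_sub hf hb.contDiffOn n (hmem q), Pi.sub_apply, vd_iterate_eq hb n (hmem q)]
    simp only [hbj, sub_self]
  refine ⟨fun p => b p + indicator (HS E) (f - b) p, hb.add h2, fun p hp => ?_⟩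
  simp [indicator_of_mem hp]

/-- A smooth function on the closed half space extends smoothly to the whole space. -/
theorem exists_extension [FiniteDimensional ℝ E] [CompleteSpace F] (f : E × ℝ → F)
    (hf : ContDiffOn ℝ ∞ f (HS E)) :
    ∃ g : E × ℝ → F, ContDiff ℝ ∞ g ∧ EqOn g f (HS E) := by
  obtain ⟨g, hg, h⟩ := exists_smooth_mem_convex (fun p : E × ℝ => {y : F | p ∈ HS E → y = f p})
    (fun p x hx y hy a b _ _ hab hp => by
      rw [hx hp, hy hp, ← add_smul, hab, one_smul])
    (fun p => by
      obtain ⟨χ, hχ, ⟨V, hV, hpV, hV1⟩, hsupp, -⟩ := exists_smooth_one_nhds_of_subset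
        (isClosed_singleton (x := p.1)) (Metric.isOpen_ball (x := p.1) (ε := 1)) (by simp)
      obtain ⟨g, hg, h⟩ := exists_extension_of_support (fun p => χ p.1 • f p)
        ((hχ.comp contDiff_fst).contDiffOn.smul hf) (isCompact_closedBall p.1 1) (by
          intro p' _ hp'
          have : χ p'.1 = 0 := by
            by_contra hne
            exact hp' (Metric.ball_subset_closedBall (hsupp (subset_closure hne)))
          simp [this])
      refine ⟨Prod.fst ⁻¹' V, (hV.preimage continuous_fst).mem_nhds (hpV rfl), g, hg.contDiffOn,
        fun y hy hyS => ?_⟩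
      rw [h hyS]
      simp only [hV1 _ hy, one_smul])
  exact ⟨g, hg, fun p hp => h p hp⟩

end Borel

/-- `G` parametrizes a tubular neighbourhood of a closed hypersurface. -/
structure Tube {E W : Type} [NormedAddCommGroup E] [NormedSpace ℝ E]
    [NormedAddCommGroup W] [NormedSpace ℝ W] (G : E × ℝ → W) : Prop where
  smooth : ContDiff ℝ ∞ G
  inj : Function.Injective G
  deriv : ∀ p, ∃ L : (E × ℝ) ≃L[ℝ] W, HasFDerivAt G (L : E × ℝ →L[ℝ] W) p
  closed : ∀ C, IsClosed (G '' {p | |p.2| ≤ C})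

section
variable {E W : Type} [NormedAddCommGroup E] [NormedSpace ℝ E]
    [NormedAddCommGroup W] [NormedSpace ℝ W]

theorem isOpenMap_of_deriv [CompleteSpace E] {G : E → W} (hG : ContDiff ℝ ∞ G)
    (hd : ∀ p, ∃ L : E ≃L[ℝ] W, HasFDerivAt G (L : E →L[ℝ] W) p) : IsOpenMap G := by
  apply IsOpenMap.of_nhds_le
  intro a
  obtain ⟨L, h⟩ := hd a
  exact ((hG.contDiffAt.hasStrictFDerivAt' h (by simp)).map_nhds_eq_of_equiv).ge

theorem contDiffAt_invFun [CompleteSpace E] {G : E → W} (hG : ContDiff ℝ ∞ G)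
    (hi : Function.Injective G)
    (hd : ∀ p, ∃ L : E ≃L[ℝ] W, HasFDerivAt G (L : E →L[ℝ] W) p) (p : E) :
    ContDiffAt ℝ ∞ (Function.invFun G) (G p) := by
  have hop := isOpenMap_of_deriv hG hd
  have hl := Function.leftInverse_invFun hi
  obtain ⟨L, h⟩ := hd p
  refine ContDiffAt.of_inverse hG.contDiffAt ?_ (hl p) ?_ L h
  · rw [ContinuousAt, hl p]
    intro U hU
    have : G '' U ∈ nhds (G p) := hop.image_mem_nhds hU
    rw [Filter.mem_map]
    filter_upwards [this]
    rintro _ ⟨x, hx, rfl⟩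
    simpa [mem_preimage, hl x] using hx
  · filter_upwards [hop.isOpen_range.mem_nhds (mem_range_self p)]
    rintro _ ⟨x, rfl⟩
    rw [hl x]

theorem Tube.isOpenMap [CompleteSpace E] {G : E × ℝ → W} (h : Tube G) : IsOpenMap G :=
  isOpenMap_of_deriv h.smooth h.deriv

theorem Tube.extend_contDiff [CompleteSpace E] {G : E × ℝ → W} (h : Tube G)
    {Θ : E × ℝ → E × ℝ} (hΘ : ContDiff ℝ ∞ Θ) {C : ℝ} (hC : ∀ p, C ≤ |p.2| → Θ p = p) :
    ContDiff ℝ ∞ (Function.extend G (G ∘ Θ) id) := by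
  rw [contDiff_iff_contDiffAt]
  intro w
  by_cases hw : w ∈ G '' {p | |p.2| ≤ C}
  · obtain ⟨p, -, rfl⟩ := hw
    have h1 := contDiffAt_invFun h.smooth h.inj h.deriv p
    have h2 : ContDiffAt ℝ ∞ (fun w => G (Θ (Function.invFun G w))) (G p) :=
      ((h.smooth.comp hΘ).contDiffAt).comp _ h1
    refine h2.congr_of_eventuallyEq ?_
    filter_upwards [h.isOpenMap.isOpen_range.mem_nhds (mem_range_self p)]
    rintro _ ⟨x, rfl⟩
    rw [h.inj.extend_apply, Function.leftInverse_invFun h.inj x]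
    rfl
  · refine contDiffAt_id.congr_of_eventuallyEq ?_
    filter_upwards [(h.closed C).isOpen_compl.mem_nhds hw] with w' hw'
    by_cases hr : ∃ p, G p = w'
    · obtain ⟨p, rfl⟩ := hr
      rw [h.inj.extend_apply, Function.comp_apply, hC p]
      · rfl
      · by_contra hlt
        exact hw' ⟨p, le_of_lt (not_le.1 hlt), rfl⟩
    · rw [Function.extend_apply' _ _ _ hr]

/-- A diffeomorphism of the tube, supported in a smaller tube, extends by the identity. -/
theorem Tube.exists_dfm [CompleteSpace E] {G : E × ℝ → W} (h : Tube G)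
    (Θ : Dfm (E × ℝ) (E × ℝ)) {C : ℝ} (hC : ∀ p, C ≤ |p.2| → Θ p = p) :
    ∃ D : Dfm W W, (∀ p, D (G p) = G (Θ p)) ∧
      ∀ w, (∀ p, |p.2| < C → G p ≠ w) → D w = w := by
  have hC' : ∀ p, C ≤ |p.2| → Θ.symm p = p := fun p hp => by
    conv_lhs => rw [← hC p hp]
    simp
  have key : ∀ Ψ Ψ' : E × ℝ → E × ℝ, (∀ p, Ψ' (Ψ p) = p) → ∀ w,
      Function.extend G (G ∘ Ψ') id (Function.extend G (G ∘ Ψ) id w) = w := by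
    intro Ψ Ψ' hΨ w
    by_cases hr : ∃ p, G p = w
    · obtain ⟨p, rfl⟩ := hr
      rw [h.inj.extend_apply, Function.comp_apply, h.inj.extend_apply, Function.comp_apply, hΨ]
    · rw [Function.extend_apply' _ _ _ hr, id, Function.extend_apply' _ _ _ hr, id]
  refine ⟨⟨⟨Function.extend G (G ∘ Θ) id, Function.extend G (G ∘ Θ.symm) id,
    key Θ Θ.symm (by simp), key Θ.symm Θ (by simp)⟩, h.extend_contDiff Θ.contDiff hC,
    h.extend_contDiff Θ.symm.contDiff hC'⟩, fun p => h.inj.extend_apply _ _ _, fun w hw => ?_⟩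
  change Function.extend G (G ∘ Θ) id w = w
  by_cases hr : ∃ p, G p = w
  · obtain ⟨p, rfl⟩ := hr
    rw [h.inj.extend_apply, Function.comp_apply, hC p]
    by_contra hlt
    exact hw p (not_le.1 hlt) rfl
  · rw [Function.extend_apply' _ _ _ hr, id]

end

section
variable {E W : Type} [NormedAddCommGroup E] [NormedSpace ℝ E] [FiniteDimensional ℝ E]
    [NormedAddCommGroup W] [NormedSpace ℝ W]

/-- The squeezing of the line onto `(-1, 1)`. -/
noncomputable def sqz (z : ℝ) : ℝ := z / Real.sqrt (1 + z ^ 2)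

theorem sqz_smooth : ContDiff ℝ ∞ sqz := by
  unfold sqz
  apply contDiff_id.div
  · exact (contDiff_const.add (contDiff_id.pow 2)).sqrt fun z => by positivity
  · intro z; positivity

theorem sqz_lt (z : ℝ) : |sqz z| < 1 := by
  have h : 0 < Real.sqrt (1 + z ^ 2) := by positivity
  rw [sqz, abs_div, abs_of_pos h, div_lt_one h, ← Real.sqrt_sq_eq_abs]
  exact Real.sqrt_lt_sqrt (sq_nonneg z) (by linarith)

theorem sqz_hasDerivAt (z : ℝ) : HasDerivAt sqz ((Real.sqrt (1 + z ^ 2))⁻¹ ^ 3) z := by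
  have h0 : 0 < 1 + z ^ 2 := by positivity
  have h : 0 < Real.sqrt (1 + z ^ 2) := by positivity
  have h1 : HasDerivAt (fun z : ℝ => 1 + z ^ 2) (2 * z) z := by
    simpa using (hasDerivAt_pow 2 z).const_add 1
  have h2 := (hasDerivAt_id z).div (h1.sqrt h0.ne') h.ne'
  convert! h2 using 1
  have h3 : Real.sqrt (1 + z ^ 2) ^ 2 = 1 + z ^ 2 := Real.sq_sqrt h0.le
  simp only [id]
  field_simp
  nlinarith

theorem sqz_deriv_pos (z : ℝ) : 0 < deriv sqz z := by
  rw [(sqz_hasDerivAt z).deriv]; positivity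

theorem sqz_strictMono : StrictMono sqz := strictMono_of_deriv_pos sqz_deriv_pos

@[simp] theorem sqz_zero : sqz 0 = 0 := by simp [sqz]

end

theorem exists_cle_of_injective {V W : Type} [NormedAddCommGroup V] [NormedSpace ℝ V]
    [NormedAddCommGroup W] [NormedSpace ℝ W] [FiniteDimensional ℝ V] [FiniteDimensional ℝ W]
    (hd : Module.finrank ℝ V = Module.finrank ℝ W) (L : V →L[ℝ] W)
    (hL : Function.Injective L) : ∃ e : V ≃L[ℝ] W, (e : V →L[ℝ] W) = L := by
  refine ⟨(LinearEquiv.ofInjectiveOfFinrankEq L.toLinearMap hL hd).toContinuousLinearEquiv, ?_⟩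
  ext v
  rfl

section
variable {E W : Type} [NormedAddCommGroup E] [NormedSpace ℝ E] [FiniteDimensional ℝ E]
    [NormedAddCommGroup W] [NormedSpace ℝ W]

theorem tube_local (f n : E → W) (hf : ContDiff ℝ ∞ f) (hfe : Topology.IsClosedEmbedding f)
    (hn : ContDiff ℝ ∞ n) (hn1 : ∀ q, ‖n q‖ ≤ 1)
    (hL : ∀ q, ∃ L : (E × ℝ) ≃L[ℝ] W, ∀ a t, L (a, t) = fderiv ℝ f q a + t • n q) (q₀ : E) :
    ∃ δ > 0, ∀ᶠ q in nhds q₀,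
      (∀ z, |z| < δ → ∃ L : (E × ℝ) ≃L[ℝ] W,
        HasFDerivAt (fun p : E × ℝ => f p.1 + p.2 • n p.1) (L : E × ℝ →L[ℝ] W) (q, z)) ∧
      ∀ q' z z', |z| < δ → |z'| < δ → f q + z • n q = f q' + z' • n q' → q = q' ∧ z = z' := by
  set F : E × ℝ → W := fun p => f p.1 + p.2 • n p.1 with hF
  have hFs : ContDiff ℝ ∞ F :=
    (hf.comp contDiff_fst).add (contDiff_snd.smul (hn.comp contDiff_fst))
  obtain ⟨L, hLe⟩ := hL q₀
  have hLd : HasFDerivAt F (L : E × ℝ →L[ℝ] W) (q₀, 0) := by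
    have h1 : HasFDerivAt (fun p : E × ℝ => f p.1) ((fderiv ℝ f q₀).comp (.fst ℝ E ℝ)) (q₀, 0) :=
      ((hf.differentiable (by simp)).differentiableAt.hasFDerivAt (x := q₀)).comp (q₀, (0 : ℝ)) hasFDerivAt_fst
    have h2 : HasFDerivAt (fun p : E × ℝ => n p.1) ((fderiv ℝ n q₀).comp (.fst ℝ E ℝ)) (q₀, 0) :=
      ((hn.differentiable (by simp)).differentiableAt.hasFDerivAt (x := q₀)).comp (q₀, (0 : ℝ)) hasFDerivAt_fst
    have h3 : HasFDerivAt (fun p : E × ℝ => p.2) (.snd ℝ E ℝ) (q₀, 0) := hasFDerivAt_snd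
    have h4 := h1.add (h3.smul h2)
    convert! h4 using 1
    ext p
    · simp [hLe]
    · simp [hLe]
  have hstrict := hFs.contDiffAt.hasStrictFDerivAt' hLd (by simp)
  set Ψ := hstrict.toOpenPartialHomeomorph F with hΨ
  have hsrc : Ψ.source ∈ nhds (q₀, (0 : ℝ)) :=
    Ψ.open_source.mem_nhds hstrict.mem_toOpenPartialHomeomorph_source
  have hder : ∀ᶠ p in nhds (q₀, (0 : ℝ)), ∃ L : (E × ℝ) ≃L[ℝ] W,
      HasFDerivAt F (L : E × ℝ →L[ℝ] W) p := by
    have h1 : ContinuousAt (fderiv ℝ F) (q₀, 0) := (hFs.continuous_fderiv (by simp)).continuousAt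
    rw [ContinuousAt, hLd.fderiv] at h1
    filter_upwards [h1 (ContinuousLinearEquiv.nhds L)] with p hp
    obtain ⟨M, hM⟩ := hp
    refine ⟨M, ?_⟩
    rw [hM]
    exact (hFs.differentiable (by simp)).differentiableAt.hasFDerivAt
  obtain ⟨r, hr, hball⟩ := Metric.mem_nhds_iff.1 (Filter.inter_mem hsrc hder)
  have hemb : ∃ s > 0, ∀ q, dist (f q) (f q₀) < s → dist q q₀ < r := by
    have h1 : Metric.ball q₀ r ∈ nhds q₀ := Metric.ball_mem_nhds _ hr
    rw [hfe.isInducing.nhds_eq_comap, Filter.mem_comap] at h1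
    obtain ⟨U, hU, hUr⟩ := h1
    obtain ⟨s, hs, hsU⟩ := Metric.mem_nhds_iff.1 hU
    exact ⟨s, hs, fun q hq => hUr (hsU hq)⟩
  obtain ⟨s, hs, hsr⟩ := hemb
  have hdist : ∀ q z, dist q q₀ < r → |z| < r → (q, z) ∈ Metric.ball (q₀, (0 : ℝ)) r := by
    intro q z h1 h2
    rw [Metric.mem_ball, Prod.dist_eq]
    exact max_lt h1 (by simpa [Real.dist_eq] using h2)
  refine ⟨min r (s / 3), by positivity, ?_⟩
  filter_upwards [Metric.ball_mem_nhds q₀ hr,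
    hf.continuous.continuousAt.preimage_mem_nhds (Metric.ball_mem_nhds (f q₀) (by positivity : 0 < s / 3))] with q hq hfq
  refine ⟨fun z hz => (hball (hdist q z hq (lt_min_iff.1 hz).1)).2, fun q' z z' hz hz' he => ?_⟩
  have hq' : dist q' q₀ < r := by
    apply hsr
    have h1 : f q' = f q + z • n q - z' • n q' := by rw [he]; simp
    rw [dist_eq_norm, h1]
    have h2 : f q + z • n q - z' • n q' - f q₀ = (f q - f q₀) + z • n q - z' • n q' := by abel
    rw [h2]
    have h3 : ‖f q - f q₀‖ < s / 3 := by simpa [dist_eq_norm] using hfq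
    have h4 : ‖z • n q‖ ≤ s / 3 := by
      rw [norm_smul, Real.norm_eq_abs]
      have := (lt_min_iff.1 hz).2
      nlinarith [hn1 q, abs_nonneg z, norm_nonneg (n q)]
    have h5 : ‖z' • n q'‖ ≤ s / 3 := by
      rw [norm_smul, Real.norm_eq_abs]
      have := (lt_min_iff.1 hz').2
      nlinarith [hn1 q', abs_nonneg z', norm_nonneg (n q')]
    have h6 := norm_sub_le (f q - f q₀ + z • n q) (z' • n q')
    have h7 := norm_add_le (f q - f q₀) (z • n q)
    linarith
  have hi := Ψ.injOn (hball (hdist q z hq (lt_min_iff.1 hz).1)).1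
    (hball (hdist q' z' hq' (lt_min_iff.1 hz').1)).1 he
  exact Prod.mk.inj hi

theorem exists_tube_of_norm_le_one (f n : E → W) (hf : ContDiff ℝ ∞ f)
    (hfe : Topology.IsClosedEmbedding f)
    (hfp : ∀ R, IsCompact (f ⁻¹' Metric.closedBall 0 R))
    (hn : ContDiff ℝ ∞ n) (hn1 : ∀ q, ‖n q‖ ≤ 1)
    (hL : ∀ q, ∃ L : (E × ℝ) ≃L[ℝ] W, ∀ a t, L (a, t) = fderiv ℝ f q a + t • n q)
    (η : ℝ) (hη : 0 < η) :
    ∃ ε : E → ℝ, ContDiff ℝ ∞ ε ∧ (∀ q, 0 < ε q ∧ ε q ≤ η) ∧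
      Tube fun p : E × ℝ => f p.1 + (ε p.1 * sqz p.2) • n p.1 := by
  set F : E × ℝ → W := fun p => f p.1 + p.2 • n p.1 with hF
  have hFs : ContDiff ℝ ∞ F :=
    (hf.comp contDiff_fst).add (contDiff_snd.smul (hn.comp contDiff_fst))
  set P : E → ℝ → Prop := fun q e =>
    (∀ z, |z| < e → ∃ L : (E × ℝ) ≃L[ℝ] W, HasFDerivAt F (L : E × ℝ →L[ℝ] W) (q, z)) ∧
      ∀ q' z z', |z| < e → |z'| < e → f q + z • n q = f q' + z' • n q' → q = q' ∧ z = z' with hP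
  have hmono : ∀ q a b, a ≤ b → P q b → P q a := fun q a b hab h =>
    ⟨fun z hz => h.1 z (hz.trans_le hab),
      fun q' z z' h1 h2 => h.2 q' z z' (h1.trans_le hab) (h2.trans_le hab)⟩
  obtain ⟨ε, hεs, hε⟩ := exists_smooth_mem_convex_of_const (F := ℝ)
    (fun q : E => {e : ℝ | 0 < e ∧ e ≤ min 1 η ∧ P q e}) (fun q => by
      intro a ha b hb c d hc hd hcd
      have h1 : c • a + d • b ≤ max a b := by
        simp only [smul_eq_mul]
        have := le_max_left a b
        have := le_max_right a b
        calc c * a + d * b ≤ c * max a b + d * max a b := by gcongr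
          _ = max a b := by rw [← add_mul, hcd, one_mul]
      refine ⟨(convex_Ioi (0 : ℝ)) ha.1 hb.1 hc hd hcd, h1.trans (max_le ha.2.1 hb.2.1), ?_⟩
      rcases max_choice a b with h | h
      · exact hmono _ _ _ (h1.trans h.le) ha.2.2
      · exact hmono _ _ _ (h1.trans h.le) hb.2.2) (fun q₀ => by
      obtain ⟨δ, hδ, h⟩ := tube_local f n hf hfe hn hn1 hL q₀
      refine ⟨min δ (min 1 η), ?_⟩
      filter_upwards [h] with q hq
      exact ⟨by positivity, min_le_right _ _, hmono _ _ _ (min_le_left _ _) hq⟩)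
  have habs : ∀ p : E × ℝ, |ε p.1 * sqz p.2| < ε p.1 := by
    intro p
    have h0 := (hε p.1).1
    rw [abs_mul, abs_of_pos h0]
    nlinarith [sqz_lt p.2]
  have hGs : ContDiff ℝ ∞ fun p : E × ℝ => f p.1 + (ε p.1 * sqz p.2) • n p.1 :=
    (hf.comp contDiff_fst).add (((hεs.comp contDiff_fst).mul
      (sqz_smooth.comp contDiff_snd)).smul (hn.comp contDiff_fst))
  refine ⟨ε, hεs, fun q => ⟨(hε q).1, (hε q).2.1.trans (min_le_right _ _)⟩, hGs, ?_, ?_, ?_⟩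
  · have key : ∀ p p' : E × ℝ, ε p'.1 ≤ ε p.1 →
        f p.1 + (ε p.1 * sqz p.2) • n p.1 = f p'.1 + (ε p'.1 * sqz p'.2) • n p'.1 → p = p' := by
      intro p p' hle he
      obtain ⟨h1, h2⟩ := (hε p.1).2.2.2 p'.1 _ _ (habs p) ((habs p').trans_le hle) he
      rw [h1] at h2
      exact Prod.ext h1 (sqz_strictMono.injective (mul_left_cancel₀ (hε p'.1).1.ne' h2))
    intro p p' he
    rcases le_total (ε p'.1) (ε p.1) with h | h
    · exact key p p' h he
    · exact (key p' p h he.symm).symm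
  · intro p
    obtain ⟨L, hLp⟩ := (hε p.1).2.2.1 _ (habs p)
    set T : E × ℝ → E × ℝ := fun p => (p.1, ε p.1 * sqz p.2) with hT
    have hd1 : HasFDerivAt (fun p : E × ℝ => ε p.1) ((fderiv ℝ ε p.1).comp (.fst ℝ E ℝ)) p :=
      ((hεs.differentiable (by simp)).differentiableAt.hasFDerivAt).comp p hasFDerivAt_fst
    have hd2 : HasFDerivAt (fun p : E × ℝ => sqz p.2) ((fderiv ℝ sqz p.2).comp (.snd ℝ E ℝ)) p :=
      ((sqz_smooth.differentiable (by simp)).differentiableAt.hasFDerivAt).comp p hasFDerivAt_snd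
    obtain ⟨D, hTd, hDi⟩ : ∃ D : E × ℝ →L[ℝ] E × ℝ, HasFDerivAt T D p ∧ Function.Injective D :=
        ⟨_, hasFDerivAt_fst.prodMk (hd1.mul hd2), by
      rw [injective_iff_map_eq_zero]
      rintro ⟨a, b⟩ hab
      simp only [ContinuousLinearMap.prod_apply, ContinuousLinearMap.coe_fst', Prod.mk_eq_zero] at hab
      obtain ⟨rfl, h2⟩ := hab
      simp [(hε p.1).1.ne', fderiv_eq_smul_deriv, (sqz_deriv_pos p.2).ne'] at h2
      exact Prod.ext rfl h2⟩
    obtain ⟨M, hM⟩ := exists_cle_of_injective rfl D hDi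
    rw [← hM] at hTd
    have h := HasFDerivAt.comp (f := T) p hLp hTd
    exact ⟨M.trans L, h⟩
  · intro C
    apply IsSeqClosed.isClosed
    intro x w hx hw
    obtain ⟨R, hR⟩ := (Metric.isBounded_range_of_tendsto x hw).subset_closedBall 0
    choose p hp hpx using hx
    set K : Set (E × ℝ) := (f ⁻¹' Metric.closedBall 0 (R + 1)) ×ˢ Icc (-C) C
    have hK : IsCompact K := (hfp _).prod isCompact_Icc
    have hcl := (hK.image hGs.continuous).isClosed
    have hmem : ∀ k, p k ∈ K := by
      intro k
      refine ⟨?_, abs_le.1 (hp k)⟩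
      have h1 : ‖x k‖ ≤ R := by simpa using hR (mem_range_self k)
      have h2 : f (p k).1 = x k - (ε (p k).1 * sqz (p k).2) • n (p k).1 := by
        rw [← hpx k]; simp
      have h3 : ‖(ε (p k).1 * sqz (p k).2) • n (p k).1‖ ≤ 1 := by
        rw [norm_smul, Real.norm_eq_abs]
        have := habs (p k)
        have := (hε (p k).1).2.1.trans (min_le_left _ _)
        have := hn1 (p k).1
        nlinarith [abs_nonneg (ε (p k).1 * sqz (p k).2)]
      have := norm_sub_le (x k) ((ε (p k).1 * sqz (p k).2) • n (p k).1)
      simp only [mem_preimage, mem_closedBall_zero_iff]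
      rw [h2]; linarith
    have := hcl.mem_of_tendsto hw (Filter.Eventually.of_forall fun k =>
      (⟨p k, hmem k, hpx k⟩ : x k ∈ _ '' K))
    obtain ⟨q, hq, hqw⟩ := this
    exact ⟨q, abs_le.2 hq.2, hqw⟩

/-- Existence of tubular neighbourhoods for a closed embedding with normal field `n`. -/
theorem exists_tube (f n : E → W) (hf : ContDiff ℝ ∞ f) (hfe : Topology.IsClosedEmbedding f)
    (hfp : ∀ R, IsCompact (f ⁻¹' Metric.closedBall 0 R))
    (hn : ContDiff ℝ ∞ n)
    (hL : ∀ q, ∃ L : (E × ℝ) ≃L[ℝ] W, ∀ a t, L (a, t) = fderiv ℝ f q a + t • n q)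
    (η : ℝ) (hη : 0 < η) :
    ∃ ε : E → ℝ, ContDiff ℝ ∞ ε ∧ (∀ q, 0 < ε q ∧ ε q ≤ η ∧ ε q * ‖n q‖ ≤ η) ∧
      Tube fun p : E × ℝ => f p.1 + (ε p.1 * sqz p.2) • n p.1 := by
  obtain ⟨a, ha, haq⟩ := exists_smooth_mem_convex_of_const (F := ℝ)
    (fun q : E => {e : ℝ | 0 < e ∧ e ≤ 1 ∧ e * ‖n q‖ ≤ 1}) (fun q => by
      have h1 : {e : ℝ | 0 < e ∧ e ≤ 1 ∧ e * ‖n q‖ ≤ 1} =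
        Ioi 0 ∩ (Iic 1 ∩ (fun e => e * ‖n q‖) ⁻¹' Iic 1) := rfl
      rw [h1]
      exact (convex_Ioi 0).inter ((convex_Iic 1).inter
        ((convex_Iic 1).is_linear_preimage (IsLinearMap.mk (by intros; ring) (by intros; simp; ring)))))
    (fun q₀ => by
      refine ⟨(‖n q₀‖ + 1)⁻¹, ?_⟩
      have h1 : ∀ᶠ q in nhds q₀, ‖n q‖ < ‖n q₀‖ + 1 :=
        hn.continuous.norm.continuousAt.eventually_lt continuousAt_const (by simp)
      have h0 := norm_nonneg (n q₀)
      filter_upwards [h1] with q hq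
      refine ⟨by positivity, inv_le_one_of_one_le₀ (by linarith), ?_⟩
      rw [inv_mul_le_one₀ (by positivity)]; exact hq.le)
  obtain ⟨ε, hε, hεq, hT⟩ := exists_tube_of_norm_le_one f (fun q => a q • n q) hf hfe hfp
    (ha.smul hn) (fun q => by
      rw [norm_smul, Real.norm_eq_abs, abs_of_pos (haq q).1]; exact (haq q).2.2) (fun q => by
      obtain ⟨L, hLq⟩ := hL q
      have h0 := (haq q).1.ne'
      refine ⟨((ContinuousLinearEquiv.refl ℝ E).prodCongr
        (ContinuousLinearEquiv.smulLeft (Units.mk0 (a q) h0))).trans L, fun x t => ?_⟩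
      have : L (x, a q * t) = _ := hLq x (a q * t)
      simp only [smul_smul]
      rw [mul_comm t, ← this]
      rfl) η hη
  refine ⟨fun q => ε q * a q, hε.mul ha, fun q => ?_, ?_⟩
  · obtain ⟨h1, h2, h3⟩ := haq q
    obtain ⟨h4, h5⟩ := hεq q
    refine ⟨by positivity, by nlinarith, ?_⟩
    rw [mul_assoc]
    nlinarith [norm_nonneg (n q)]
  · have h : (fun p : E × ℝ => f p.1 + (ε p.1 * a p.1 * sqz p.2) • n p.1) =
        fun p => f p.1 + (ε p.1 * sqz p.2) • a p.1 • n p.1 := by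
      funext p
      rw [smul_smul]; congr 2; ring
    exact h ▸ hT
end

/-- `g` and `h` are mutually inverse diffeomorphisms between the sets `S` and `T`. -/
structure IsSD {E F : Type} [NormedAddCommGroup E] [NormedSpace ℝ E]
    [NormedAddCommGroup F] [NormedSpace ℝ F] (g : E → F) (h : F → E) (S : Set E) (T : Set F) :
    Prop where
  smooth : ContDiffOn ℝ ∞ g S
  smooth' : ContDiffOn ℝ ∞ h T
  maps : MapsTo g S T
  maps' : MapsTo h T S
  left : ∀ x ∈ S, h (g x) = x
  right : ∀ y ∈ T, g (h y) = y

section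
variable {E F G : Type} [NormedAddCommGroup E] [NormedSpace ℝ E]
    [NormedAddCommGroup F] [NormedSpace ℝ F] [NormedAddCommGroup G] [NormedSpace ℝ G]

/-- The sets `S` and `T` are diffeomorphic. -/
def SD (S : Set E) (T : Set F) : Prop := ∃ g h, IsSD g h S T

variable {S : Set E} {T : Set F} {R : Set G}

theorem IsSD.symm {g : E → F} {h : F → E} (H : IsSD g h S T) : IsSD h g T S :=
  ⟨H.smooth', H.smooth, H.maps', H.maps, H.right, H.left⟩

theorem IsSD.trans {g : E → F} {h : F → E} {g' : F → G} {h' : G → F} (H : IsSD g h S T)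
    (H' : IsSD g' h' T R) : IsSD (g' ∘ g) (h ∘ h') S R where
  smooth := H'.smooth.comp H.smooth H.maps
  smooth' := H.smooth'.comp H'.smooth' H'.maps'
  maps := H'.maps.comp H.maps
  maps' := H.maps'.comp H'.maps'
  left x hx := by simp [H'.left _ (H.maps hx), H.left x hx]
  right x hx := by simp [H.right _ (H'.maps' hx), H'.right x hx]

theorem SD.symm (h : SD S T) : SD T S := by
  obtain ⟨g, h, H⟩ := h
  exact ⟨h, g, H.symm⟩

theorem SD.trans (h : SD S T) (h' : SD T R) : SD S R := by
  obtain ⟨g, h, H⟩ := h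
  obtain ⟨g', h', H'⟩ := h'
  exact ⟨_, _, H.trans H'⟩

theorem Dfm.isSD (d : Dfm E F) (h : ∀ x, x ∈ S ↔ d x ∈ T) : IsSD d d.symm S T where
  smooth := d.contDiff.contDiffOn
  smooth' := d.symm.contDiff.contDiffOn
  maps x hx := (h x).1 hx
  maps' x hx := (h _).2 (by simpa using hx)
  left := by simp
  right := by simp

theorem Dfm.sd (d : Dfm E F) (h : ∀ x, x ∈ S ↔ d x ∈ T) : SD S T := ⟨_, _, d.isSD h⟩

theorem IsSD.mem_nhds [FiniteDimensional ℝ E] [FiniteDimensional ℝ F]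
    (hd : Module.finrank ℝ E = Module.finrank ℝ F) {g : E → F} {h : F → E}
    (H : IsSD g h S T) {x : E} (hx : S ∈ nhds x) : T ∈ nhds (g x) := by
  have hxS := mem_of_mem_nhds hx
  have hg := H.smooth.contDiffAt hx
  have hgd := (hg.differentiableAt (by simp)).hasFDerivAt
  have hhd := ((H.smooth'.differentiableOn (by simp)) (g x) (H.maps hxS)).hasFDerivWithinAt
  have hc := hhd.comp x hgd.hasFDerivWithinAt H.maps
  have hid := HasFDerivWithinAt.congr (f₁ := id) hc (fun y hy => (H.left y hy).symm)
    (H.left x hxS).symm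
  have hu := (hid.hasFDerivAt hx).unique (hasFDerivAt_id x)
  obtain ⟨e, he⟩ := exists_cle_of_injective hd (fderiv ℝ g x) (by
    intro a b hab
    have := congrArg (fun L => L a) hu
    have h2 := congrArg (fun L => L b) hu
    simp only [ContinuousLinearMap.comp_apply, ContinuousLinearMap.id_apply] at this h2
    rw [← this, ← h2, hab])
  rw [← he] at hgd
  rw [← (hg.hasStrictFDerivAt' hgd (by simp)).map_nhds_eq_of_equiv]
  rw [Filter.mem_map]
  filter_upwards [hx] with y hy using H.maps hy

end

theorem Tube.finiteDimensional {E W : Type} [NormedAddCommGroup E] [NormedSpace ℝ E]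
    [NormedAddCommGroup W] [NormedSpace ℝ W] [FiniteDimensional ℝ E] {G : E × ℝ → W}
    (h : Tube G) : FiniteDimensional ℝ W := by
  obtain ⟨L, -⟩ := h.deriv 0
  exact L.toLinearEquiv.finiteDimensional

theorem Tube.finrank_eq {E W : Type} [NormedAddCommGroup E] [NormedSpace ℝ E]
    [NormedAddCommGroup W] [NormedSpace ℝ W] {G : E × ℝ → W}
    (h : Tube G) : Module.finrank ℝ (E × ℝ) = Module.finrank ℝ W := by
  obtain ⟨L, -⟩ := h.deriv 0
  exact L.toLinearEquiv.finrank_eq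

abbrev E2 : Type := ℝ × ℝ
abbrev E3 : Type := E2 × ℝ

/-- Extend the germ of a function, monotone in one coordinate, to a diffeomorphism. -/
theorem exists_dfm_coord {V X : Type} [NormedAddCommGroup V] [NormedSpace ℝ V]
    [NormedAddCommGroup X] [NormedSpace ℝ X] [FiniteDimensional ℝ X] (κ : V ≃L[ℝ] (X × ℝ))
    (c : V → ℝ) (hc : ContDiff ℝ ∞ c) {Z : Set V} (hZ : IsClosed Z)
    (hstar : ∀ v ∈ Z, ∀ θ ∈ Icc (0 : ℝ) 1, κ.symm ((κ v).1, θ * (κ v).2) ∈ Z)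
    (a : X → ℝ) (ha : Continuous a) (ha0 : ∀ x, 0 < a x)
    (hac : ∀ v ∈ Z, a (κ v).1 ≤ fderiv ℝ c v (κ.symm (0, 1))) :
    ∃ d : Dfm V V, (∀ v, (κ (d v)).1 = (κ v).1) ∧
      (∀ e, (κ (d (κ.symm (e, 0)))).2 = c (κ.symm (e, 0))) ∧
      (∀ e, StrictMono fun s => (κ (d (κ.symm (e, s)))).2) ∧
      ∃ U, IsOpen U ∧ Z ⊆ U ∧ ∀ v ∈ U, κ (d v) = ((κ v).1, c v) := by
  have hfd : ∀ p, fderiv ℝ (fun p => c (κ.symm p)) p (0, 1) =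
      fderiv ℝ c (κ.symm p) (κ.symm (0, 1)) := fun p => by
    have := ((hc.differentiable (by simp)) (κ.symm p)).hasFDerivAt.comp p κ.symm.hasFDerivAt
    erw [this.fderiv]; rfl
  have hc' : ContDiff ℝ ∞ fun p => c (κ.symm p) := hc.comp κ.symm.contDiff
  have hcd : Continuous fun p => fderiv ℝ (fun p => c (κ.symm p)) p (0, 1) :=
    (hc'.continuous_fderiv (by simp)).clm_apply continuous_const
  obtain ⟨d, h1, h2, h3, U, hU, hZU, h4⟩ := exists_dfm_extending _ hc'
    (O := {p | a p.1 / 2 < fderiv ℝ (fun p => c (κ.symm p)) p (0, 1)}) (Z := κ.symm ⁻¹' Z)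
    (isOpen_lt ((ha.comp continuous_fst).div_const 2) hcd)
    (hZ.preimage κ.symm.continuous) (by
      intro p hp
      have := hac _ hp
      have := ha0 p.1
      simp only [mem_ofPred_eq, hfd]
      simp at *
      linarith) (by
      intro e s hs θ hθ
      have := hstar _ hs θ hθ
      simpa using this) (fun e => ⟨a e / 2, by linarith [ha0 e], fun s hs => le_of_lt hs⟩)
  refine ⟨((Dfm.ofCLE κ).trans d).trans (Dfm.ofCLE κ.symm), fun v => by simp [h1],
    fun e => by simp [h2], fun e => by simpa using h3 e, κ ⁻¹' U, hU.preimage κ.continuous,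
    fun v hv => hZU (by simpa using hv), fun v hv => by simpa using h4 _ hv⟩

/-- Swapping the second and third coordinates. -/
noncomputable def κ23 : E3 ≃L[ℝ] E3 := LinearEquiv.toContinuousLinearEquiv
  { toFun := fun p => ((p.1.1, p.2), p.1.2)
    invFun := fun p => ((p.1.1, p.2), p.1.2)
    map_add' := fun _ _ => rfl
    map_smul' := fun _ _ => rfl
    left_inv := fun _ => rfl
    right_inv := fun _ => rfl }

/-- Swapping the first and third coordinates. -/
noncomputable def κ13 : E3 ≃L[ℝ] E3 := LinearEquiv.toContinuousLinearEquiv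
  { toFun := fun p => ((p.2, p.1.2), p.1.1)
    invFun := fun p => ((p.2, p.1.2), p.1.1)
    map_add' := fun _ _ => rfl
    map_smul' := fun _ _ => rfl
    left_inv := fun _ => rfl
    right_inv := fun _ => rfl }

@[simp] theorem κ23_apply (p : E3) : κ23 p = ((p.1.1, p.2), p.1.2) := rfl
@[simp] theorem κ23_symm_apply (p : E3) : κ23.symm p = ((p.1.1, p.2), p.1.2) := rfl
@[simp] theorem κ13_apply (p : E3) : κ13 p = ((p.2, p.1.2), p.1.1) := rfl
@[simp] theorem κ13_symm_apply (p : E3) : κ13.symm p = ((p.2, p.1.2), p.1.1) := rfl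

/-- Extend the germ along the plane of a coordinate change, fixing the plane, to a
diffeomorphism. -/
theorem exists_dfm_of_coord_germ (κ : E3 ≃L[ℝ] E3)
    (hκ : ∀ p, p.2 = 0 → ∀ θ : ℝ, (κ.symm ((κ p).1, θ * (κ p).2)).2 = 0)
    (c : E3 → ℝ) (hc : ContDiff ℝ ∞ c) (h0 : ∀ q, c (q, 0) = (κ (q, 0)).2)
    (a : E2 → ℝ) (ha : Continuous a) (ha0 : ∀ x, 0 < a x)
    (hac : ∀ q, a (κ (q, 0)).1 ≤ fderiv ℝ c (q, 0) (κ.symm (0, 1))) :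
    ∃ T : Dfm (E3) (E3), (∀ v, (κ (T v)).1 = (κ v).1) ∧ (∀ q, T (q, 0) = (q, 0)) ∧
      (∀ q, T.symm (q, 0) = (q, 0)) ∧ (∀ e, StrictMono fun s => (κ (T (κ.symm (e, s)))).2) ∧
      ∃ U, IsOpen U ∧ (∀ q, (q, 0) ∈ U) ∧ ∀ v ∈ U, κ (T v) = ((κ v).1, c v) := by
  obtain ⟨T, h1, h2, h3, U, hU, hPU, h4⟩ := exists_dfm_coord κ c hc (Z := {p | p.2 = 0})
    (isClosed_eq continuous_snd continuous_const) (fun v hv θ _ => hκ v hv θ) a ha ha0 (by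
      rintro ⟨q, z⟩ hz
      obtain rfl : z = 0 := hz
      exact hac q)
  have h5 : ∀ q, T (q, 0) = (q, 0) := fun q => by
    apply κ.injective
    rw [h4 _ (hPU rfl), h0]
  refine ⟨T, h1, h5, fun q => ?_, h3, U, hU, fun q => hPU rfl, h4⟩
  conv_lhs => rw [← h5 q]
  simp

/-- Extend a germ of a diffeomorphism along the plane, fixing the plane, to a diffeomorphism. -/
theorem exists_dfm_of_germ (ψ : E3 → E3) (hψ : ContDiff ℝ ∞ ψ)
    (h0 : ∀ q, ψ (q, 0) = (q, 0)) (hd : ∀ q, 0 < (fderiv ℝ ψ (q, 0) (0, 1)).2) :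
    ∃ Ξ : Dfm (E3) (E3), (∀ p, 0 ≤ (Ξ p).2 ↔ 0 ≤ p.2) ∧
      ∃ U, IsOpen U ∧ (∀ q, (q, 0) ∈ U) ∧ ∀ p ∈ U, Ξ p = ψ p := by
  have hfd : ∀ p v, fderiv ℝ (fun p => (ψ p).2) p v = (fderiv ℝ ψ p v).2 := fun p v => by
    have := ((hψ.differentiable (by simp)) p).hasFDerivAt.snd
    rw [this.fderiv]; rfl
  have hc : ContDiff ℝ ∞ fun p => (ψ p).2 := contDiff_snd.comp hψ
  have hcd : Continuous fun p => fderiv ℝ (fun p => (ψ p).2) p (0, 1) :=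
    (hc.continuous_fderiv (by simp)).clm_apply continuous_const
  obtain ⟨T₁, h1f, h10, h1s, h1m, U₁, hU₁, hPU₁, h1U⟩ := exists_dfm_of_coord_germ
    (ContinuousLinearEquiv.refl ℝ _) (by rintro ⟨q, z⟩ rfl θ; simp) _ hc (by simp [h0])
    (fun q => fderiv ℝ (fun p => (ψ p).2) (q, 0) (0, 1))
    (hcd.comp (by fun_prop : Continuous fun q : E2 => (q, (0 : ℝ))))
    (fun q => by rw [hfd]; exact hd q) (fun q => le_rfl)
  simp only [ContinuousLinearEquiv.refl_apply, ContinuousLinearEquiv.refl_symm] at h1f h1m h1U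
  have hdx : ∀ (φ : E3 → E3) (pr : E3 →L[ℝ] ℝ) (v : E2), ContDiff ℝ ∞ φ →
      (∀ q, φ (q, 0) = (q, 0)) → ∀ q, fderiv ℝ (fun p => pr (φ p)) (q, 0) (v, 0) = pr (v, 0) := by
    intro φ pr v hφ hφ0 q
    have e1 := (pr.hasFDerivAt.comp (q, (0 : ℝ)) ((hφ.differentiable (by simp)) (q, 0)).hasFDerivAt)
    have e2 : HasFDerivAt (fun q : E2 => (q, (0 : ℝ))) (.inl ℝ E2 ℝ) q :=
      (ContinuousLinearMap.inl ℝ E2 ℝ).hasFDerivAt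
    have e3 := e1.comp q e2
    have e4 : (pr ∘ φ) ∘ (fun q : E2 => (q, (0 : ℝ))) = pr ∘ ContinuousLinearMap.inl ℝ E2 ℝ := by
      funext q; simp [hφ0]
    rw [e4] at e3
    have e5 := e3.unique (pr.comp (ContinuousLinearMap.inl ℝ E2 ℝ)).hasFDerivAt
    have e6 := congrArg (fun L => L v) e5
    change _ = pr (v, 0) at e6
    rw [← e6]
    erw [e1.fderiv]
    rfl
  have hψ1 : ContDiff ℝ ∞ fun p => ψ (T₁.symm p) := hψ.comp T₁.symm.contDiff
  obtain ⟨T₂, h2f, h20, h2s, -, U₂, hU₂, hPU₂, h2U⟩ := exists_dfm_of_coord_germ κ13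
    (by rintro ⟨q, z⟩ rfl θ; simp) (fun p => (ψ (T₁.symm p)).1.1)
    (contDiff_fst.comp (contDiff_fst.comp hψ1)) (by simp [h0, h1s])
    (fun q => 1) continuous_const (fun q => one_pos)
    (fun q => (hdx _ ((ContinuousLinearMap.fst ℝ ℝ ℝ).comp (.fst ℝ E2 ℝ)) (1, 0) hψ1
      (by simp [h0, h1s]) q).ge)
  have hψ2 : ContDiff ℝ ∞ fun p => ψ (T₁.symm (T₂.symm p)) := hψ1.comp T₂.symm.contDiff
  obtain ⟨T₃, h3f, h30, h3s, -, U₃, hU₃, hPU₃, h3U⟩ := exists_dfm_of_coord_germ κ23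
    (by rintro ⟨q, z⟩ rfl θ; simp) (fun p => (ψ (T₁.symm (T₂.symm p))).1.2)
    (contDiff_snd.comp (contDiff_fst.comp hψ2)) (by simp [h0, h1s, h2s])
    (fun q => 1) continuous_const (fun q => one_pos)
    (fun q => (hdx _ ((ContinuousLinearMap.snd ℝ ℝ ℝ).comp (.fst ℝ E2 ℝ)) (0, 1) hψ2
      (by simp [h0, h1s, h2s]) q).ge)
  simp only [κ23_apply, κ13_apply, Prod.mk.injEq] at *
  refine ⟨(T₁.trans T₂).trans T₃, fun p => ?_,
    U₁ ∩ T₁ ⁻¹' (U₂ ∩ T₂ ⁻¹' U₃), hU₁.inter ((hU₂.inter (hU₃.preimage T₂.continuous)).preimage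
      T₁.continuous), fun q => ⟨hPU₁ q, ?_, ?_⟩, ?_⟩
  · simp only [Dfm.trans_apply]
    rw [(h3f _).2, (h2f _).1]
    have := (h1m p.1).le_iff_le (a := 0) (b := p.2)
    simpa [h10] using this
  · rw [h10]; exact hPU₂ q
  · rw [mem_preimage, h10, h20]; exact hPU₃ q
  · rintro p ⟨hp1, hp2, hp3⟩
    have e1 := h1U p hp1
    have e2 := h2U _ hp2
    have e3 := h3U _ hp3
    simp only [Dfm.symm_apply_apply] at e2 e3
    simp only [Dfm.trans_apply]
    refine Prod.ext (Prod.ext ?_ e3.2) ?_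
    · rw [e3.1.1, e2.2]
    · rw [e3.1.2, e2.1.1, e1]

theorem IsSD.comp_dfm {E F G : Type} [NormedAddCommGroup E] [NormedSpace ℝ E]
    [NormedAddCommGroup F] [NormedSpace ℝ F] [NormedAddCommGroup G] [NormedSpace ℝ G]
    {S : Set E} {T : Set F} {R : Set G} {g : E → F} {h : F → E} (H : IsSD g h S T) (d : Dfm F G)
    (hd : ∀ x, x ∈ T ↔ d x ∈ R) : IsSD (fun x => d (g x)) (fun y => h (d.symm y)) S R :=
  H.trans (d.isSD hd)

section
variable {W : Type} [NormedAddCommGroup W] [NormedSpace ℝ W]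

theorem IsSD.boundary {G : E3 → W} (hG : Tube G) {A : Set W} (hAG : ∀ p, G p ∈ A ↔ 0 ≤ p.2)
    (hA : ∀ w ∈ A, (∀ q, G (q, 0) ≠ w) → A ∈ nhds w) {g : W → E3} {h : E3 → W}
    (H : IsSD g h A (HS E2)) {w : W} (hw : w ∈ A) : (g w).2 = 0 ↔ ∃ q, G (q, 0) = w := by
  have := hG.finiteDimensional
  constructor
  · intro h0
    by_contra hne
    push Not at hne
    have h1 := H.mem_nhds hG.finrank_eq.symm (hA w hw hne)
    have h2 : Filter.Tendsto (fun t : ℝ => ((g w).1, -t)) (nhdsWithin 0 (Ioi 0)) (nhds (g w)) := by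
      have : Continuous fun t : ℝ => ((g w).1, -t) := by fun_prop
      have := (this.tendsto 0).mono_left (nhdsWithin_le_nhds (s := Ioi 0))
      have e : ((g w).1, -(0 : ℝ)) = g w := Prod.ext rfl (by simp [h0])
      rwa [e] at this
    obtain ⟨t, h3, h4⟩ := ((h2.eventually h1).and self_mem_nhdsWithin).exists
    have h5 : (0 : ℝ) ≤ -t := h3
    have h6 : 0 < t := h4
    linarith
  · rintro ⟨q, rfl⟩
    by_contra hne
    have h0 : 0 < (g (G (q, 0))).2 := lt_of_le_of_ne (H.maps hw) (Ne.symm hne)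
    have h1 : HS E2 ∈ nhds (g (G (q, 0))) :=
      Filter.mem_of_superset ((isOpen_lt continuous_const continuous_snd).mem_nhds h0)
        fun p (hp : 0 < p.2) => le_of_lt hp
    have h2 := H.symm.mem_nhds hG.finrank_eq h1
    rw [H.left _ hw] at h2
    have h3 : Filter.Tendsto (fun t : ℝ => G (q, -t)) (nhdsWithin 0 (Ioi 0)) (nhds (G (q, 0))) := by
      have : Continuous fun t : ℝ => G (q, -t) := hG.smooth.continuous.comp (by fun_prop)
      have := (this.tendsto 0).mono_left (nhdsWithin_le_nhds (s := Ioi 0))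
      simpa using this
    obtain ⟨t, h4, h5⟩ := ((h3.eventually h2).and self_mem_nhdsWithin).exists
    have h6 := (hAG _).1 h4
    have h7 : 0 < t := h5
    simp only at h6
    linarith

/-- A diffeomorphism of a side onto the half space can be made standard on the boundary. -/
theorem IsSD.exists_boundary_id {G : E3 → W} (hG : Tube G) {A : Set W}
    (hAG : ∀ p, G p ∈ A ↔ 0 ≤ p.2)
    (hA : ∀ w ∈ A, (∀ q, G (q, 0) ≠ w) → A ∈ nhds w) {g : W → E3} {h : E3 → W}
    (H : IsSD g h A (HS E2)) :
    ∃ g' h', IsSD g' h' A (HS E2) ∧ ∀ q, g' (G (q, 0)) = (q, 0) := by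
  have hinv := Function.leftInverse_invFun hG.inj
  have hG0 : ∀ q, G (q, 0) ∈ A := fun q => (hAG _).2 le_rfl
  have hb := fun {w} hw => H.boundary hG hAG hA (w := w) hw
  have hg0 : ∀ q, g (G (q, 0)) = ((g (G (q, 0))).1, 0) := fun q =>
    Prod.ext rfl ((hb (hG0 q)).2 ⟨q, rfl⟩)
  have hh0 : ∀ q, ∃ q', G (q', 0) = h (q, 0) := fun q => by
    have hm : h (q, 0) ∈ A := H.maps' (show (0 : ℝ) ≤ 0 from le_rfl)
    refine (hb hm).1 ?_
    rw [H.right _ (show (0 : ℝ) ≤ 0 from le_rfl)]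
  have hs1 : ContDiff ℝ ∞ fun q => G (q, 0) := hG.smooth.comp (contDiff_id.prodMk contDiff_const)
  have hs2 : ContDiff ℝ ∞ fun q => (g (G (q, 0))).1 :=
    contDiff_fst.comp (contDiffOn_univ.1 (H.smooth.comp hs1.contDiffOn fun q _ => hG0 q))
  have hs3 : ContDiff ℝ ∞ fun q : E2 => h (q, 0) :=
    contDiffOn_univ.1 (H.smooth'.comp (contDiff_id.prodMk contDiff_const).contDiffOn
      fun q _ => (show (0 : ℝ) ≤ 0 from le_rfl))
  have hs4 : ContDiff ℝ ∞ fun q => (Function.invFun G (h (q, 0))).1 := by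
    refine contDiff_fst.comp (contDiff_iff_contDiffAt.2 fun q => ?_)
    obtain ⟨q', hq'⟩ := hh0 q
    have := contDiffAt_invFun hG.smooth hG.inj hG.deriv (q', 0)
    rw [hq'] at this
    exact this.comp q hs3.contDiffAt
  let α : Dfm E2 E2 := ⟨⟨fun q => (g (G (q, 0))).1, fun q => (Function.invFun G (h (q, 0))).1,
    fun q => by
      change (Function.invFun G (h ((g (G (q, 0))).1, 0))).1 = q
      rw [← hg0, H.left _ (hG0 q), hinv], fun q => by
      change (g (G ((Function.invFun G (h (q, 0))).1, 0))).1 = q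
      obtain ⟨q', hq'⟩ := hh0 q
      rw [← hq', hinv, hq', H.right _ (show (0 : ℝ) ≤ 0 from le_rfl)]⟩, hs2, hs4⟩
  let d : Dfm E3 E3 := ⟨⟨fun p => (α.symm p.1, p.2), fun p => (α p.1, p.2), fun p => by simp,
    fun p => by simp⟩, (α.symm.contDiff.comp contDiff_fst).prodMk contDiff_snd,
    (α.contDiff.comp contDiff_fst).prodMk contDiff_snd⟩
  refine ⟨_, _, H.comp_dfm d (fun p => Iff.rfl), fun q => ?_⟩
  change (α.symm (g (G (q, 0))).1, (g (G (q, 0))).2) = (q, 0)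
  rw [show (g (G (q, 0))).1 = α q from rfl, hg0]
  simp

/-- A diffeomorphism of a side onto the half space can be made standard near the boundary. -/
theorem IsSD.exists_collar_id {G : E3 → W} (hG : Tube G) {A : Set W}
    (hAG : ∀ p, G p ∈ A ↔ 0 ≤ p.2)
    (hA : ∀ w ∈ A, (∀ q, G (q, 0) ≠ w) → A ∈ nhds w) {g : W → E3} {h : E3 → W}
    (H : IsSD g h A (HS E2)) :
    ∃ g' h', IsSD g' h' A (HS E2) ∧ ∃ U, IsOpen U ∧ (∀ q, (q, 0) ∈ U) ∧
      ∀ p ∈ U, 0 ≤ p.2 → g' (G p) = p := by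
  obtain ⟨g, h, H, hb⟩ := H.exists_boundary_id hG hAG hA
  have hψ : ContDiffOn ℝ ∞ (fun p => g (G p)) (HS E2) :=
    H.smooth.comp hG.smooth.contDiffOn fun p hp => (hAG p).2 hp
  obtain ⟨ψ, hψs, hψe⟩ := exists_extension _ hψ
  replace hψe : ∀ p ∈ HS E2, ψ p = g (G p) := hψe
  have h0m : ∀ q : E2, (q, (0 : ℝ)) ∈ HS E2 := fun q => (show (0 : ℝ) ≤ 0 from le_rfl)
  have h0 : ∀ q, ψ (q, 0) = (q, 0) := fun q => by rw [hψe _ (h0m q), hb]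
  have hinj : ∀ q, Function.Injective (fderiv ℝ ψ (q, 0)) := by
    intro q
    have hGh : h (q, 0) = G (q, 0) := by
      conv_lhs => rw [← hb q]
      exact H.left _ ((hAG _).2 le_rfl)
    have h1 := contDiffAt_invFun hG.smooth hG.inj hG.deriv (q, 0)
    have h2 := ((H.smooth'.differentiableOn (by simp)) _ (h0m q)).hasFDerivWithinAt
    have h3 := (h1.differentiableAt (by simp)).hasFDerivAt
    rw [← hGh] at h3
    have h4 := h3.comp_hasFDerivWithinAt _ h2
    have h5 : HasFDerivWithinAt ψ (fderiv ℝ ψ (q, 0)) (HS E2) (q, 0) :=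
      ((hψs.differentiable (by simp)) _).hasFDerivAt.hasFDerivWithinAt
    have hmap : MapsTo ψ (HS E2) (HS E2) := fun p hp => by
      rw [hψe _ hp]; exact H.maps ((hAG p).2 hp)
    have h6 : HasFDerivWithinAt ((Function.invFun G ∘ h) ∘ ψ) _ (HS E2) (q, 0) :=
      HasFDerivWithinAt.comp (t := HS E2) _ (by rw [h0]; exact h4) h5 hmap
    have h7 : ∀ p ∈ HS E2, id p = ((Function.invFun G ∘ h) ∘ ψ) p := fun p hp => by
      have := H.left (G p) ((hAG p).2 hp)
      simp only [Function.comp_apply, hψe p hp, this, id]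
      exact (Function.leftInverse_invFun hG.inj p).symm
    have h8 := HasFDerivWithinAt.congr h6 h7 (h7 _ (h0m q))
    have h9 := (uniqueDiffOn_HS _ (h0m q)).eq h8 (hasFDerivWithinAt_id _ _)
    intro a b hab
    have e1 := congrArg (fun L => L a) h9
    have e2 := congrArg (fun L => L b) h9
    simp only [ContinuousLinearMap.comp_apply, ContinuousLinearMap.id_apply] at e1 e2
    rw [← e1, ← e2, hab]
  have hd : ∀ q, 0 < (fderiv ℝ ψ (q, 0) (0, 1)).2 := by
    intro q
    have h1 : HasDerivAt (fun z => (ψ (q, z)).2) (fderiv ℝ ψ (q, 0) (0, 1)).2 0 := by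
      have := (hasDerivAt_slice (contDiff_snd.comp hψs) q 0)
      have e := ((hψs.differentiable (by simp)) (q, 0)).hasFDerivAt.snd
      have e' : fderiv ℝ (Prod.snd ∘ ψ) (q, 0) = _ := e.fderiv
      rw [e'] at this
      exact this
    have h2 : 0 ≤ (fderiv ℝ ψ (q, 0) (0, 1)).2 := by
      have := (hasDerivAt_iff_tendsto_slope.1 h1).mono_left
        (nhdsWithin_mono (0 : ℝ) (fun t ht => ne_of_gt ht : Ioi (0 : ℝ) ⊆ {0}ᶜ))
      refine ge_of_tendsto this ?_
      filter_upwards [self_mem_nhdsWithin] with t ht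
      have ht' : 0 < t := ht
      have : 0 ≤ (ψ (q, t)).2 := by
        rw [hψe _ (show (q, t) ∈ HS E2 from ht'.le)]
        exact H.maps ((hAG _).2 ht'.le)
      simp only [slope, h0]
      simp only [sub_zero, vsub_eq_sub, smul_eq_mul]
      positivity
    refine lt_of_le_of_ne h2 fun hz => ?_
    have h3 : fderiv ℝ ψ (q, 0) ((fderiv ℝ ψ (q, 0) (0, 1)).1, 0) =
        fderiv ℝ ψ (q, 0) (0, 1) := by
      have e1 := ((hψs.differentiable (by simp)) (q, 0)).hasFDerivAt.comp q
        (ContinuousLinearMap.inl ℝ E2 ℝ).hasFDerivAt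
      have e2 : ψ ∘ (fun q : E2 => ContinuousLinearMap.inl ℝ E2 ℝ q) =
        ContinuousLinearMap.inl ℝ E2 ℝ := by funext q; simp [h0]
      rw [e2] at e1
      have e3 := congrArg (fun L => L (fderiv ℝ ψ (q, 0) (0, 1)).1)
        (e1.unique (ContinuousLinearMap.inl ℝ E2 ℝ).hasFDerivAt)
      simp only [ContinuousLinearMap.comp_apply, ContinuousLinearMap.inl_apply] at e3
      rw [e3]
      exact Prod.ext rfl hz
    have := congrArg Prod.snd (hinj q h3)
    simp at this
  obtain ⟨Ξ, hΞ, U, hU, hPU, hΞU⟩ := exists_dfm_of_germ ψ hψs h0 hd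
  refine ⟨_, _, H.comp_dfm Ξ.symm (R := HS E2) (fun p => ?_), U, hU, hPU, fun p hp hp0 => ?_⟩
  · have := hΞ (Ξ.symm p)
    simpa [HS] using this
  · rw [← hψe p hp0, ← hΞU p hp]
    simp

theorem Tube.comp_refl {G : E3 → W} (hG : Tube G) : Tube fun p : E3 => G (p.1, -p.2) where
  smooth := hG.smooth.comp (contDiff_fst.prodMk contDiff_snd.neg)
  inj p p' h := by
    have := hG.inj h
    simp only [Prod.mk.injEq, neg_inj] at this
    exact Prod.ext this.1 this.2
  deriv p := by
    obtain ⟨L, hL⟩ := hG.deriv (p.1, -p.2)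
    refine ⟨((ContinuousLinearEquiv.refl ℝ E2).prodCongr (ContinuousLinearEquiv.neg ℝ)).trans L, ?_⟩
    exact HasFDerivAt.comp (f := fun p : E3 => (p.1, -p.2)) p hL
      (hasFDerivAt_fst.prodMk hasFDerivAt_snd.neg)
  closed C := by
    convert hG.closed C using 1
    ext w
    constructor
    · rintro ⟨p, hp, rfl⟩
      exact ⟨(p.1, -p.2), by simpa using hp, rfl⟩
    · rintro ⟨p, hp, rfl⟩
      exact ⟨(p.1, -p.2), by simpa using hp, by simp⟩

/-- If both sides are half spaces, the hypersurface is standard. -/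
theorem exists_dfm_of_sides {G : E3 → W} (hG : Tube G) {A B : Set W} (hAc : IsClosed A)
    (hBc : IsClosed B) (hAB : A ∪ B = univ) (hI : A ∩ B = range fun q => G (q, 0))
    (hA : ∀ p, 0 ≤ p.2 → G p ∈ A) (hB : ∀ p, p.2 ≤ 0 → G p ∈ B)
    (sA : SD A (HS E2)) (sB : SD B (HS E2)) :
    ∃ Φ : Dfm W E3, ∀ w, (Φ w).2 = 0 ↔ w ∈ range fun q => G (q, 0) := by
  classical
  have hAG : ∀ p, G p ∈ A ↔ 0 ≤ p.2 := fun p => ⟨fun h => by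
    by_contra hlt
    have h1 : G p ∈ A ∩ B := ⟨h, hB p (not_le.1 hlt).le⟩
    rw [hI] at h1
    obtain ⟨q, hq⟩ := h1
    have := hG.inj hq
    rw [← this] at hlt
    exact hlt le_rfl, hA p⟩
  have hBG : ∀ p : E3, G (p.1, -p.2) ∈ B ↔ 0 ≤ p.2 := fun p => ⟨fun h => by
    by_contra hlt
    have h1 : G (p.1, -p.2) ∈ A ∩ B := ⟨hA _ (by simp only; linarith), h⟩
    rw [hI] at h1
    obtain ⟨q, hq⟩ := h1
    have := congrArg Prod.snd (hG.inj hq)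
    simp only at this
    linarith, fun h => hB _ (by simp only; linarith)⟩
  have hAo : ∀ w ∈ A, (∀ q, G (q, 0) ≠ w) → A ∈ nhds w := by
    intro w hw hq
    have hwB : w ∉ B := fun h => by
      have : w ∈ A ∩ B := ⟨hw, h⟩
      rw [hI] at this
      obtain ⟨q, h⟩ := this
      exact hq q h
    filter_upwards [hBc.isOpen_compl.mem_nhds hwB] with x hx
    have : x ∈ A ∪ B := by rw [hAB]; trivial
    exact this.resolve_right hx
  have hBo : ∀ w ∈ B, (∀ q, G (q, -0) ≠ w) → B ∈ nhds w := by
    intro w hw hq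
    have hwB : w ∉ A := fun h => by
      have : w ∈ A ∩ B := ⟨h, hw⟩
      rw [hI] at this
      obtain ⟨q, h⟩ := this
      exact hq q (by simpa using h)
    filter_upwards [hAc.isOpen_compl.mem_nhds hwB] with x hx
    have : x ∈ A ∪ B := by rw [hAB]; trivial
    exact this.resolve_left hx
  obtain ⟨g₀, h₀, H₀⟩ := sA
  obtain ⟨g₁, h₁, H₁⟩ := sB
  obtain ⟨g, h, H, U, hU, hPU, hgU⟩ := H₀.exists_collar_id hG hAG hAo
  obtain ⟨g', h', H', U', hU', hPU', hgU'⟩ := H₁.exists_collar_id hG.comp_refl hBG hBo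
  let r : E3 → E3 := fun p => (p.1, -p.2)
  have hr : ContDiff ℝ ∞ r := contDiff_fst.prodMk contDiff_snd.neg
  have hrr : ∀ p, r (r p) = p := fun p => by simp [r]
  set V : Set E3 := U ∩ r ⁻¹' U' with hV
  have hVo : IsOpen V := hU.inter (hU'.preimage hr.continuous)
  have hPV : ∀ q, (q, 0) ∈ V := fun q => ⟨hPU q, by simpa [r] using hPU' q⟩
  let Φ : W → E3 := fun w => if w ∈ A then g w else r (g' w)
  let Ψ : E3 → W := fun p => if 0 ≤ p.2 then h p else h' (r p)
  have hΦV : ∀ p ∈ V, Φ (G p) = p := by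
    intro p hp
    by_cases h0 : 0 ≤ p.2
    · simp only [Φ, if_pos ((hAG p).2 h0)]
      exact hgU p hp.1 h0
    · simp only [Φ, if_neg (mt (hAG p).1 h0)]
      have := hgU' (r p) hp.2 (by simp only [r]; linarith)
      simp only [r, neg_neg] at this
      rw [this]; simp [r]
  have hinA : ∀ w, w ∉ A → w ∈ B := fun w hw => by
    have : w ∈ A ∪ B := by rw [hAB]; trivial
    exact this.resolve_left hw
  have hΨΦ : ∀ w, Ψ (Φ w) = w := by
    intro w
    by_cases hw : w ∈ A
    · have : 0 ≤ (g w).2 := H.maps hw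
      simp only [Φ, if_pos hw, Ψ, if_pos this, H.left w hw]
    · have h1 : 0 ≤ (g' w).2 := H'.maps (hinA w hw)
      have h2 : (g' w).2 ≠ 0 := fun h0 => by
        obtain ⟨q, hq⟩ := (H'.boundary hG.comp_refl hBG hBo (hinA w hw)).1 h0
        exact hw (hq ▸ (hAG _).2 (by simp))
      have h3 : ¬ 0 ≤ (r (g' w)).2 := by
        simp only [r, not_le]
        have := lt_of_le_of_ne h1 h2.symm
        linarith
      simp only [Φ, if_neg hw, Ψ, if_neg h3, hrr]
      exact H'.left w (hinA w hw)
  have hΦΨ : ∀ p, Φ (Ψ p) = p := by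
    intro p
    by_cases hp : 0 ≤ p.2
    · have : h p ∈ A := H.maps' hp
      simp only [Φ, Ψ, if_pos hp, if_pos this]
      exact H.right p hp
    · have h1 : r p ∈ HS E2 := by simp only [HS, r, mem_ofPred_eq]; linarith
      have h2 : h' (r p) ∈ B := H'.maps' h1
      have h3 : h' (r p) ∉ A := fun hA' => by
        have : h' (r p) ∈ A ∩ B := ⟨hA', h2⟩
        rw [hI] at this
        obtain ⟨q, hq⟩ := this
        have h4 := (H'.boundary hG.comp_refl hBG hBo h2).2 ⟨q, by simpa using hq⟩
        rw [H'.right _ h1] at h4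
        simp only [r, neg_eq_zero] at h4
        exact hp h4.ge
      simp only [Φ, Ψ, if_neg hp, if_neg h3, H'.right _ h1, hrr]
  have hH : ∀ w, w ∈ A → w ∈ B → ∃ q, G (q, 0) = w := fun w h1 h2 => by
    have : w ∈ A ∩ B := ⟨h1, h2⟩
    rwa [hI] at this
  have hGV : ∀ q, G '' V ∈ nhds (G (q, 0)) := fun q =>
    hG.isOpenMap.image_mem_nhds (hVo.mem_nhds (hPV q))
  have hΦs : ContDiff ℝ ∞ Φ := by
    rw [contDiff_iff_contDiffAt]
    intro w
    by_cases hq : ∃ q, G (q, 0) = w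
    · obtain ⟨q, rfl⟩ := hq
      refine (contDiffAt_invFun hG.smooth hG.inj hG.deriv (q, 0)).congr_of_eventuallyEq ?_
      filter_upwards [hGV q]
      rintro _ ⟨p, hp, rfl⟩
      rw [hΦV p hp, Function.leftInverse_invFun hG.inj]
    · by_cases hw : w ∈ A
      · have hn := hAo w hw (by push Not at hq; exact hq)
        refine (H.smooth.contDiffAt hn).congr_of_eventuallyEq ?_
        filter_upwards [hn] with x hx
        simp [Φ, hx]
      · have hn := hBo w (hinA w hw) (by push Not at hq; simpa using hq)
        refine (hr.contDiffAt.comp w (H'.smooth.contDiffAt hn)).congr_of_eventuallyEq ?_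
        filter_upwards [hAc.isOpen_compl.mem_nhds hw] with x hx
        have hx' : x ∉ A := hx
        simp [Φ, hx']
  have hΨs : ContDiff ℝ ∞ Ψ := by
    rw [contDiff_iff_contDiffAt]
    rintro ⟨q, z⟩
    rcases lt_trichotomy z 0 with hz | rfl | hz
    · have hn : ∀ᶠ p : E3 in nhds (q, z), p.2 < 0 :=
        (isOpen_lt continuous_snd continuous_const).mem_nhds hz
      have hn' : HS E2 ∈ nhds (r (q, z)) :=
        Filter.mem_of_superset ((isOpen_lt continuous_const continuous_snd).mem_nhds
          (show 0 < (r (q, z)).2 by simpa [r] using hz)) fun p (hp : 0 < p.2) => le_of_lt hp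
      refine ((H'.smooth'.contDiffAt hn').comp (q, z) hr.contDiffAt).congr_of_eventuallyEq ?_
      filter_upwards [hn] with p hp
      simp [Ψ, not_le.2 hp]
    · refine hG.smooth.contDiffAt.congr_of_eventuallyEq ?_
      filter_upwards [hVo.mem_nhds (hPV q)] with p hp
      conv_lhs => rw [← hΦV p hp]
      exact hΨΦ _
    · have hn' : HS E2 ∈ nhds (q, z) :=
        Filter.mem_of_superset ((isOpen_lt continuous_const continuous_snd).mem_nhds hz)
          fun p (hp : 0 < p.2) => le_of_lt hp
      refine (H.smooth'.contDiffAt hn').congr_of_eventuallyEq ?_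
      filter_upwards [hn'] with p hp
      have : 0 ≤ p.2 := hp
      simp [Ψ, this]
  refine ⟨⟨⟨Φ, Ψ, hΨΦ, hΦΨ⟩, hΦs, hΨs⟩, fun w => ⟨fun h0 => ?_, ?_⟩⟩
  · have h0 : (Φ w).2 = 0 := h0
    refine ⟨(Φ w).1, ?_⟩
    have := hΦV _ (hPV (Φ w).1)
    have e : ((Φ w).1, (0 : ℝ)) = Φ w := Prod.ext rfl h0.symm
    have := congrArg Ψ this
    rw [hΨΦ, e, hΨΦ] at this
    change G ((Φ w).1, 0) = w
    rw [e]; exact this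
  · rintro ⟨q, rfl⟩
    exact congrArg Prod.snd (hΦV _ (hPV q))
end

/-- A smooth proper embedding of the plane in space. -/
structure HP (f : E2 → E3) : Prop where
  smooth : ContDiff ℝ ∞ f
  emb : Topology.IsClosedEmbedding f
  imm : ∀ q, Function.Injective (fderiv ℝ f q)

theorem HP.dfm_comp {f : E2 → E3} (hf : HP f) (D : Dfm E3 E3) : HP fun q => D (f q) where
  smooth := D.contDiff.comp hf.smooth
  emb := D.toHomeo.isClosedEmbedding.comp hf.emb
  imm q := by
    have h := ((D.contDiff.differentiable (by simp)) (f q)).hasFDerivAt.comp q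
      ((hf.smooth.differentiable (by simp)) q).hasFDerivAt
    have h2 := ((D.symm.contDiff.differentiable (by simp)) (D (f q))).hasFDerivAt.comp (f q)
      ((D.contDiff.differentiable (by simp)) (f q)).hasFDerivAt
    have h3 : D.symm ∘ D = id := funext fun x => by simp
    rw [h3] at h2
    have h4 := h2.unique (hasFDerivAt_id _)
    have h5 : fderiv ℝ (fun q => D (f q)) q = _ := h.fderiv
    rw [h5]
    refine Function.Injective.comp (g := fderiv ℝ D (f q)) (fun a b hab => ?_) (hf.imm q)
    have e1 := congrArg (fun L => L a) h4
    have e2 := congrArg (fun L => L b) h4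
    simp only [ContinuousLinearMap.comp_apply, ContinuousLinearMap.id_apply] at e1 e2
    rw [← e1, ← e2, hab]

theorem Dfm.fderiv_injective {E F : Type} [NormedAddCommGroup E] [NormedSpace ℝ E]
    [NormedAddCommGroup F] [NormedSpace ℝ F] (D : Dfm E F) (x : E) :
    Function.Injective (fderiv ℝ D x) := by
  have h2 := ((D.symm.contDiff.differentiable (by simp)) (D x)).hasFDerivAt.comp x
    ((D.contDiff.differentiable (by simp)) x).hasFDerivAt
  have h3 : D.symm ∘ D = id := funext fun x => by simp
  rw [h3] at h2
  have h4 := h2.unique (hasFDerivAt_id _)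
  intro a b hab
  have e1 := congrArg (fun L => L a) h4
  have e2 := congrArg (fun L => L b) h4
  simp only [ContinuousLinearMap.comp_apply, ContinuousLinearMap.id_apply] at e1 e2
  rw [← e1, ← e2, hab]

theorem HP.comp_dfm {f : E2 → E3} (hf : HP f) (D : Dfm E2 E2) : HP fun q => f (D q) where
  smooth := hf.smooth.comp D.contDiff
  emb := hf.emb.comp D.toHomeo.isClosedEmbedding
  imm q := by
    have h := ((hf.smooth.differentiable (by simp)) (D q)).hasFDerivAt.comp q
      ((D.contDiff.differentiable (by simp)) q).hasFDerivAt
    have h5 : fderiv ℝ (fun q => f (D q)) q = _ := h.fderiv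
    rw [h5]
    exact (hf.imm _).comp (D.fderiv_injective q)

/-- The cross product. -/
def crs (u v : E3) : E3 :=
  ((u.1.2 * v.2 - u.2 * v.1.2, u.2 * v.1.1 - u.1.1 * v.2), u.1.1 * v.1.2 - u.1.2 * v.1.1)

/-- The normal field of a parametrized surface. -/
noncomputable def nrm (f : E2 → E3) (q : E2) : E3 := crs (fderiv ℝ f q (1, 0)) (fderiv ℝ f q (0, 1))

theorem nrm_smooth {f : E2 → E3} (hf : ContDiff ℝ ∞ f) : ContDiff ℝ ∞ (nrm f) := by
  have h : ∀ v, ContDiff ℝ ∞ fun q => fderiv ℝ f q v := fun v =>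
    (hf.fderiv_right (m := ∞) (by simp)).clm_apply contDiff_const
  have h1 := h (1, 0)
  have h2 := h (0, 1)
  unfold nrm crs
  fun_prop

theorem nrm_congr {f g : E2 → E3} {q : E2} (h : f =ᶠ[nhds q] g) : nrm f q = nrm g q := by
  unfold nrm
  rw [h.fderiv_eq]

/-- The standard plane. -/
def incl (q : E2) : E3 := (q, 0)

theorem incl_smooth : ContDiff ℝ ∞ incl := contDiff_id.prodMk contDiff_const

theorem nrm_incl (q : E2) : nrm incl q = (0, 1) := by
  have h : HasFDerivAt incl (.inl ℝ E2 ℝ) q := (ContinuousLinearMap.inl ℝ E2 ℝ).hasFDerivAt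
  unfold nrm
  rw [h.fderiv]
  simp [crs]

theorem HP.exists_clequiv {f : E2 → E3} (hf : HP f) (q : E2) :
    ∃ L : (E2 × ℝ) ≃L[ℝ] E3, ∀ a t, L (a, t) = fderiv ℝ f q a + t • nrm f q := by
  obtain ⟨L, hL⟩ := exists_cle_of_injective (V := E2 × ℝ) (W := E3) rfl
    ((fderiv ℝ f q).coprod ((1 : ℝ →L[ℝ] ℝ).smulRight (nrm f q))) (by
    rw [injective_iff_map_eq_zero]
    rintro ⟨⟨a, b⟩, t⟩ h
    have hlin : ∀ a b : ℝ, fderiv ℝ f q (a, b) =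
        a • fderiv ℝ f q (1, 0) + b • fderiv ℝ f q (0, 1) := by
      intro a b
      rw [← map_smul, ← map_smul, ← map_add]
      simp
    have h0 : ∀ a b : ℝ, fderiv ℝ f q (a, b) = 0 → a = 0 ∧ b = 0 := fun a b hab =>
      Prod.mk_eq_zero.1 ((injective_iff_map_eq_zero _).1 (hf.imm q) _ hab)
    simp only [ContinuousLinearMap.coprod_apply, ContinuousLinearMap.smulRight_apply,
      one_apply_eq_self] at h
    rw [hlin] at h
    have h1 : ∀ c d : ℝ, c • fderiv ℝ f q (1, 0) + d • fderiv ℝ f q (0, 1) = 0 → c = 0 ∧ d = 0 :=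
      fun c d hcd => h0 c d (by rw [hlin, hcd])
    unfold nrm at h
    generalize fderiv ℝ f q (1, 0) = u at *
    generalize fderiv ℝ f q (0, 1) = v at *
    obtain ⟨⟨u1, u2⟩, u3⟩ := u
    obtain ⟨⟨v1, v2⟩, v3⟩ := v
    simp only [crs, Prod.smul_mk, smul_eq_mul, Prod.mk_add_mk, Prod.mk_eq_zero] at h h1
    obtain ⟨⟨e1, e2⟩, e3⟩ := h
    have hn : t * ((u2 * v3 - u3 * v2) ^ 2 + (u3 * v1 - u1 * v3) ^ 2 + (u1 * v2 - u2 * v1) ^ 2)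
        = 0 := by
      linear_combination (u2 * v3 - u3 * v2) * e1 + (u3 * v1 - u1 * v3) * e2 +
        (u1 * v2 - u2 * v1) * e3
    rcases mul_eq_zero.1 hn with rfl | hz
    · obtain ⟨rfl, rfl⟩ := h1 a b ⟨⟨by linarith, by linarith⟩, by linarith⟩
      rfl
    · exfalso
      have z1 : u2 * v3 - u3 * v2 = 0 := by nlinarith [sq_nonneg (u2 * v3 - u3 * v2), sq_nonneg (u3 * v1 - u1 * v3), sq_nonneg (u1 * v2 - u2 * v1)]
      have z2 : u3 * v1 - u1 * v3 = 0 := by nlinarith [sq_nonneg (u2 * v3 - u3 * v2), sq_nonneg (u3 * v1 - u1 * v3), sq_nonneg (u1 * v2 - u2 * v1)]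
      have z3 : u1 * v2 - u2 * v1 = 0 := by nlinarith [sq_nonneg (u2 * v3 - u3 * v2), sq_nonneg (u3 * v1 - u1 * v3), sq_nonneg (u1 * v2 - u2 * v1)]
      have := (h1 (-(u1 * v1 + u2 * v2 + u3 * v3)) (u1 ^ 2 + u2 ^ 2 + u3 ^ 2)
        ⟨⟨by linear_combination u3 * z2 - u2 * z3, by linear_combination u1 * z3 - u3 * z1⟩,
          by linear_combination u2 * z1 - u1 * z2⟩).2
      have y1 : u1 = 0 := by nlinarith [sq_nonneg u1, sq_nonneg u2, sq_nonneg u3]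
      have y2 : u2 = 0 := by nlinarith [sq_nonneg u1, sq_nonneg u2, sq_nonneg u3]
      have y3 : u3 = 0 := by nlinarith [sq_nonneg u1, sq_nonneg u2, sq_nonneg u3]
      have := (h1 1 0 ⟨⟨by simp [y1], by simp [y2]⟩, by simp [y3]⟩).1
      simp at this)
  refine ⟨L, fun a t => ?_⟩
  have := congrArg (fun M => M (a, t)) hL
  simpa using this

/-- The tube of radius `ε` around a surface. -/
noncomputable def tub (f : E2 → E3) (ε : E2 → ℝ) (p : E3) : E3 :=
  f p.1 + (ε p.1 * sqz p.2) • nrm f p.1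

theorem HP.exists_tub {f : E2 → E3} (hf : HP f) {η : ℝ} (hη : 0 < η) :
    ∃ ε : E2 → ℝ, ContDiff ℝ ∞ ε ∧ (∀ q, 0 < ε q ∧ ε q ≤ η ∧ ε q * ‖nrm f q‖ ≤ η) ∧
      Tube (tub f ε) :=
  exists_tube f (nrm f) hf.smooth hf.emb
    (fun _ => hf.emb.isCompact_preimage (isCompact_closedBall 0 _)) (nrm_smooth hf.smooth)
    hf.exists_clequiv η hη

@[simp] theorem tub_zero (f : E2 → E3) (ε : E2 → ℝ) (q : E2) : tub f ε (q, 0) = f q := by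
  simp [tub]

theorem tub_incl (ε : E2 → ℝ) (p : E3) : tub incl ε p = (p.1, ε p.1 * sqz p.2) := by
  simp [tub, nrm_incl, incl]

theorem tub_congr {f g : E2 → E3} {ε : E2 → ℝ} {p : E3} (h : f =ᶠ[nhds p.1] g) :
    tub f ε p = tub g ε p := by
  unfold tub
  rw [nrm_congr h, h.eq_of_nhds]

theorem tube_incl {ε : E2 → ℝ} (hε : ContDiff ℝ ∞ ε) (h0 : ∀ q, 0 < ε q) : Tube (tub incl ε) := by
  have he : tub incl ε = fun p => (p.1, ε p.1 * sqz p.2) := funext fun p => tub_incl ε p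
  rw [he]
  have hs : ContDiff ℝ ∞ fun p : E3 => (p.1, ε p.1 * sqz p.2) :=
    contDiff_fst.prodMk ((hε.comp contDiff_fst).mul (sqz_smooth.comp contDiff_snd))
  refine ⟨hs, ?_, ?_, ?_⟩
  · rintro ⟨q, z⟩ ⟨q', z'⟩ h
    simp only [Prod.mk.injEq] at h
    obtain ⟨rfl, h⟩ := h
    rw [sqz_strictMono.injective (mul_left_cancel₀ (h0 q).ne' h)]
  · intro p
    have hd1 : HasFDerivAt (fun p : E3 => ε p.1) ((fderiv ℝ ε p.1).comp (.fst ℝ E2 ℝ)) p :=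
      ((hε.differentiable (by simp)).differentiableAt.hasFDerivAt).comp p hasFDerivAt_fst
    have hd2 : HasFDerivAt (fun p : E3 => sqz p.2) ((fderiv ℝ sqz p.2).comp (.snd ℝ E2 ℝ)) p :=
      ((sqz_smooth.differentiable (by simp)).differentiableAt.hasFDerivAt).comp p hasFDerivAt_snd
    obtain ⟨D, hTd, hDi⟩ : ∃ D : E3 →L[ℝ] E3,
        HasFDerivAt (fun p : E3 => (p.1, ε p.1 * sqz p.2)) D p ∧ Function.Injective D :=
      ⟨_, hasFDerivAt_fst.prodMk (hd1.mul hd2), by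
        rw [injective_iff_map_eq_zero]
        rintro ⟨a, b⟩ hab
        simp only [ContinuousLinearMap.prod_apply, ContinuousLinearMap.coe_fst',
          Prod.mk_eq_zero] at hab
        obtain ⟨rfl, h2⟩ := hab
        simp [(h0 p.1).ne', fderiv_eq_smul_deriv, (sqz_deriv_pos p.2).ne'] at h2
        exact Prod.ext rfl h2⟩
    obtain ⟨M, hM⟩ := exists_cle_of_injective rfl D hDi
    exact ⟨M, hM ▸ hTd⟩
  · intro C
    by_cases hC : 0 ≤ C
    · have : (fun p : E3 => (p.1, ε p.1 * sqz p.2)) '' {p | |p.2| ≤ C} =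
          {p : E3 | |p.2| ≤ ε p.1 * sqz C} := by
        have hodd : ∀ z, sqz (-z) = -sqz z := fun z => by simp [sqz, neg_div]
        have habs : ∀ z, |sqz z| = sqz |z| := fun z => by
          rcases le_total 0 z with h | h
          · rw [abs_of_nonneg h, abs_of_nonneg]
            simpa using sqz_strictMono.monotone h
          · rw [abs_of_nonpos h, hodd, abs_of_nonpos]
            simpa using sqz_strictMono.monotone h
        ext ⟨q, t⟩
        constructor
        · rintro ⟨⟨q', z⟩, hz, he⟩
          simp only [Prod.mk.injEq] at he
          obtain ⟨rfl, rfl⟩ := he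
          simp only [mem_ofPred_eq] at hz ⊢
          rw [abs_mul, abs_of_pos (h0 q'), habs]
          exact mul_le_mul_of_nonneg_left (sqz_strictMono.monotone hz) (h0 q').le
        · intro h
          simp only [mem_ofPred_eq] at h
          have hq := h0 q
          have h1 : |t / ε q| ≤ sqz C := by
            rw [abs_div, abs_of_pos hq, div_le_iff₀ hq]; linarith
          rw [abs_le] at h1
          obtain ⟨z, hz, hzt⟩ := intermediate_value_Icc (by linarith : -C ≤ C)
            sqz_smooth.continuous.continuousOn (by rw [hodd]; exact h1)
          refine ⟨(q, z), abs_le.2 hz, ?_⟩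
          simp only [hzt]
          rw [mul_div_cancel₀ _ hq.ne']
      rw [this]
      exact isClosed_le continuous_snd.abs ((hε.continuous.comp continuous_fst).mul continuous_const)
    · have : {p : E3 | |p.2| ≤ C} = ∅ := by
        ext p
        simp only [mem_ofPred_eq, mem_empty_iff_false, iff_false]
        intro h; exact hC ((abs_nonneg _).trans h)
      simp [this]

/-- The fibrewise complex square `(x, w) ↦ (x, w²)`. -/
def sqm (p : E3) : E3 := ((p.1.1, p.1.2 ^ 2 - p.2 ^ 2), 2 * p.1.2 * p.2)

/-- The rotation `(x, w) ↦ (x, -w)`. -/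
def rot (p : E3) : E3 := ((p.1.1, -p.1.2), -p.2)

@[simp] theorem rot_rot (p : E3) : rot (rot p) = p := by simp [rot]

@[simp] theorem sqm_rot (p : E3) : sqm (rot p) = sqm p := by simp [rot, sqm]

theorem sqm_smooth : ContDiff ℝ ∞ sqm := by
  unfold sqm
  fun_prop

theorem rot_smooth : ContDiff ℝ ∞ rot := by
  unfold rot
  fun_prop

theorem eq_or_eq_rot_of_sqm {u w : E3} (h : sqm u = sqm w) : u = w ∨ u = rot w := by
  obtain ⟨⟨x, y⟩, z⟩ := u
  obtain ⟨⟨x', y'⟩, z'⟩ := w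
  simp only [sqm, Prod.mk.injEq, rot] at h ⊢
  obtain ⟨⟨rfl, h1⟩, h2⟩ := h
  have hs : (y ^ 2 + z ^ 2) ^ 2 = (y' ^ 2 + z' ^ 2) ^ 2 := by
    linear_combination (y ^ 2 - z ^ 2 + (y' ^ 2 - z' ^ 2)) * h1 + (2 * y * z + 2 * y' * z') * h2
  have hs' := (pow_left_inj₀ (by positivity) (by positivity) two_ne_zero).1 hs
  have hy : y ^ 2 = y' ^ 2 := by linarith
  have hz : z ^ 2 = z' ^ 2 := by linarith
  rcases sq_eq_sq_iff_eq_or_eq_neg.1 hy with rfl | rfl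
  · rcases sq_eq_sq_iff_eq_or_eq_neg.1 hz with rfl | rfl
    · simp
    · have : y * z' = 0 := by linarith
      rcases mul_eq_zero.1 this with rfl | rfl <;> simp
  · rcases sq_eq_sq_iff_eq_or_eq_neg.1 hz with rfl | rfl
    · have : y' * z = 0 := by linarith
      rcases mul_eq_zero.1 this with rfl | rfl <;> simp
    · simp

/-- The fibrewise square root with positive real part. -/
noncomputable def csq (p : E3) : E3 :=
  ((p.1.1, √((√(p.1.2 ^ 2 + p.2 ^ 2) + p.1.2) / 2)),
    p.2 / (2 * √((√(p.1.2 ^ 2 + p.2 ^ 2) + p.1.2) / 2)))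

theorem sqrt_add_pos {a b : ℝ} (h : ¬(b = 0 ∧ a ≤ 0)) : 0 < √(a ^ 2 + b ^ 2) + a := by
  by_cases hb : b = 0
  · subst hb
    have : 0 < a := by
      by_contra hh
      exact h ⟨rfl, not_lt.1 hh⟩
    positivity
  · have : |a| < √(a ^ 2 + b ^ 2) := by
      rw [← Real.sqrt_sq_eq_abs]
      exact Real.sqrt_lt_sqrt (sq_nonneg a) (by have := pow_pos (abs_pos.2 hb) 2; rw [sq_abs] at this; linarith)
    linarith [neg_abs_le a]

theorem csq_pos {p : E3} (h : ¬(p.2 = 0 ∧ p.1.2 ≤ 0)) : 0 < (csq p).1.2 :=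
  Real.sqrt_pos.2 (half_pos (sqrt_add_pos h))

theorem sqm_csq {p : E3} (h : ¬(p.2 = 0 ∧ p.1.2 ≤ 0)) : sqm (csq p) = p := by
  have h0 := sqrt_add_pos h
  have h1 : 0 < (csq p).1.2 := csq_pos h
  have h2 : (csq p).1.2 ^ 2 = (√(p.1.2 ^ 2 + p.2 ^ 2) + p.1.2) / 2 := Real.sq_sqrt (half_pos h0).le
  have h3 : (csq p).2 * (2 * (csq p).1.2) = p.2 := div_mul_cancel₀ _ (by positivity)
  have h4 : √(p.1.2 ^ 2 + p.2 ^ 2) ^ 2 = p.1.2 ^ 2 + p.2 ^ 2 := Real.sq_sqrt (by positivity)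
  have h5 : (csq p).1.1 = p.1.1 := rfl
  refine Prod.ext (Prod.ext h5 ?_) (by simp only [sqm]; linarith)
  simp only [sqm]
  set s := (csq p).1.2
  set t := (csq p).2
  set n := √(p.1.2 ^ 2 + p.2 ^ 2)
  have h6 : s ^ 2 * (s ^ 2 - t ^ 2 - p.1.2) = 0 := by
    have : 4 * (t ^ 2 * s ^ 2) = p.2 ^ 2 := by rw [← h3]; ring
    have h7 : 4 * (s ^ 2 * s ^ 2) = (n + p.1.2) ^ 2 := by rw [h2]; ring
    nlinarith
  rcases mul_eq_zero.1 h6 with h7 | h7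
  · exact absurd h7 (by positivity)
  · linarith

theorem csq_smooth {p : E3} (h : ¬(p.2 = 0 ∧ p.1.2 ≤ 0)) : ContDiffAt ℝ ∞ csq p := by
  have h0 := sqrt_add_pos h
  have hn : p.1.2 ^ 2 + p.2 ^ 2 ≠ 0 := fun h' => h
    ⟨by nlinarith [sq_nonneg p.1.2, sq_nonneg p.2], by nlinarith [sq_nonneg p.1.2, sq_nonneg p.2]⟩
  have h1 : 0 < (csq p).1.2 := csq_pos h
  have ha : ContDiffAt ℝ ∞ (fun p : E3 => √((√(p.1.2 ^ 2 + p.2 ^ 2) + p.1.2) / 2)) p := by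
    have hb : ContDiffAt ℝ ∞ (fun p : E3 => √(p.1.2 ^ 2 + p.2 ^ 2)) p :=
      ContDiffAt.sqrt (by fun_prop) hn
    have hc : ContDiffAt ℝ ∞ (fun p : E3 => (√(p.1.2 ^ 2 + p.2 ^ 2) + p.1.2) / 2) p := by
      fun_prop
    exact hc.sqrt (half_pos h0).ne'
  refine ContDiffAt.prodMk (.prodMk (by fun_prop) ha) (.div (by fun_prop) (contDiffAt_const.mul ha) ?_)
  have : √((√(p.1.2 ^ 2 + p.2 ^ 2) + p.1.2) / 2) ≠ 0 := h1.ne'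
  positivity

theorem csq_sqm {p : E3} (h : 0 < p.1.2) : csq (sqm p) = p := by
  have h0 : ¬((sqm p).2 = 0 ∧ (sqm p).1.2 ≤ 0) := by
    rintro ⟨h1, h2⟩
    simp only [sqm, mul_eq_zero] at h1 h2
    rcases h1 with (h1 | h1) | h1
    · norm_num at h1
    · linarith
    · rw [h1] at h2
      nlinarith
  rcases eq_or_eq_rot_of_sqm (sqm_csq h0) with h1 | h1
  · exact h1
  · have := csq_pos h0
    rw [h1] at this
    simp only [rot] at this
    linarith

@[simp] theorem csq_zero (x : ℝ) : csq ((x, 0), 0) = ((x, 0), 0) := by simp [csq]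

/-- The reflection `(x, v) ↦ (x, -v̄)`. -/
def negre (p : E3) : E3 := ((p.1.1, -p.1.2), p.2)

theorem negre_smooth : ContDiff ℝ ∞ negre := by
  unfold negre
  fun_prop

/-- The fibrewise square root with positive imaginary part. -/
noncomputable def rup (p : E3) : E3 := κ23 (csq (negre p))

theorem sqm_κ23 (p : E3) : sqm (κ23 p) = negre (sqm p) := by
  simp only [κ23_apply, sqm, negre, Prod.mk.injEq, true_and]
  constructor <;> ring

theorem rup_pos {p : E3} (h : ¬(p.2 = 0 ∧ 0 ≤ p.1.2)) : 0 < (rup p).2 :=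
  csq_pos (p := negre p) (by simpa [negre] using h)

theorem sqm_rup {p : E3} (h : ¬(p.2 = 0 ∧ 0 ≤ p.1.2)) : sqm (rup p) = p := by
  rw [rup, sqm_κ23, sqm_csq (p := negre p) (by simpa [negre] using h)]
  simp [negre]

theorem rup_smooth {p : E3} (h : ¬(p.2 = 0 ∧ 0 ≤ p.1.2)) : ContDiffAt ℝ ∞ rup p :=
  κ23.contDiff.contDiffAt.comp p
    ((csq_smooth (p := negre p) (by simpa [negre] using h)).comp p negre_smooth.contDiffAt)

theorem rup_sqm {p : E3} (h : 0 < p.2) : rup (sqm p) = p := by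
  have h1 := sqm_κ23 p
  rw [rup, ← h1, csq_sqm (p := κ23 p) (by simpa using h)]
  simp

theorem rup_eq_csq {p : E3} (h : 0 < p.2) : rup p = csq p := by
  have h1 : ¬(p.2 = 0 ∧ p.1.2 ≤ 0) := fun h' => h.ne' h'.1
  have h2 : 0 < (csq p).2 := div_pos h (mul_pos two_pos (csq_pos h1))
  rw [← rup_sqm h2, sqm_csq h1]

theorem rup_eq_rot_csq {p : E3} (h : p.2 < 0) : rup p = rot (csq p) := by
  have h1 : ¬(p.2 = 0 ∧ p.1.2 ≤ 0) := fun h' => h.ne h'.1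
  have h2 : (csq p).2 < 0 := div_neg_of_neg_of_pos h (mul_pos two_pos (csq_pos h1))
  rw [← rup_sqm (p := rot (csq p)) (by simpa [rot] using h2), sqm_rot, sqm_csq h1]

section
/-- A closed decomposition of space by two sets meeting along a half-plane-like set `S` over
positive second coordinate, standard elsewhere. -/
structure Cut (A B S : Set E3) : Prop where
  closedA : IsClosed A
  closedB : IsClosed B
  closedS : IsClosed S
  cover : ∀ p, p ∈ A ∨ p ∈ B
  inter : ∀ p : E3, 0 < p.1.2 → p ∈ A → p ∈ B → p ∈ S
  subA : S ⊆ A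
  subB : S ⊆ B
  stdA : ∀ p : E3, p.1.2 < 1 / 8 → (p ∈ A ↔ 0 ≤ p.2)
  stdB : ∀ p : E3, p.1.2 < 1 / 8 → (p ∈ B ↔ p.2 ≤ 0)
  stdS : ∀ p : E3, p.1.2 < 1 / 8 → (p ∈ S ↔ p.2 = 0 ∧ 0 ≤ p.1.2)

/-- The space cut open along a half-plane, modelled by the fibrewise square. -/
def cutOpen (A B : Set E3) : Set E3 :=
  {w | (0 < w.1.2 → sqm w ∈ A) ∧ (w.1.2 < 0 → sqm w ∈ B) ∧ (w.1.2 = 0 → 0 ≤ w.2)}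

/-- A map compatible with two such decompositions near the half-planes. -/
structure CutMap (g : E3 → E3) (A B S A' B' S' : Set E3) : Prop where
  smooth : ContDiff ℝ ∞ g
  mem : ∀ p, p ∈ S ↔ g p ∈ S'
  id_edge : ∀ x : ℝ, ∀ᶠ p in 𝓝 (((x, 0), 0) : E3), g p = p
  pos : ∀ p ∈ S, 0 < p.1.2 → 0 < (g p).1.2
  sideA : ∀ p ∈ S, 0 < p.1.2 → ∀ᶠ q in 𝓝 p, q ∈ A → g q ∈ A'
  sideB : ∀ p ∈ S, 0 < p.1.2 → ∀ᶠ q in 𝓝 p, q ∈ B → g q ∈ B'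

variable {A B S A' B' S' : Set E3} {g : E3 → E3}

theorem Cut.pos_of_mem (h : Cut A B S) {p : E3} (hp : p ∈ S) (h2 : p.2 ≠ 0 ∨ p.1.2 ≠ 0) :
    0 < p.1.2 := by
  by_contra h0
  have := (h.stdS p (by linarith)).1 hp
  rcases h2 with h2 | h2
  · exact h2 this.1
  · exact h2 (by linarith [this.2])

theorem Cut.sqm_mem (h : Cut A B S) {w : E3} (hw : sqm w ∈ S) (h0 : w.1.2 = 0) : w.2 = 0 := by
  by_contra h2
  have := h.pos_of_mem hw (.inr (by simpa [sqm, h0] using h2))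
  simp only [sqm, h0] at this
  nlinarith [sq_nonneg w.2]

theorem Cut.pos_sqm (h : Cut A B S) {w : E3} (hS : sqm w ∈ S) (hy : w.1.2 ≠ 0) :
    0 < (sqm w).1.2 := by
  have h1 := h.pos_of_mem hS
  by_contra h2
  by_cases h3 : (sqm w).1.2 = 0
  · have h4 := ((h.stdS _ (by rw [h3]; norm_num)).1 hS).1
    simp only [sqm] at h3 h4
    have h5 : w.2 = 0 := by
      rcases mul_eq_zero.1 h4 with h5 | h5
      · exact absurd h5 (mul_ne_zero two_ne_zero hy)
      · exact h5
    rw [h5] at h3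
    apply hy
    have : w.1.2 ^ 2 = 0 := by linarith
    exact pow_eq_zero_iff (two_ne_zero) |>.1 this
  · exact h2 (h1 (.inr h3))

theorem Cut.eq_of_sqm (h : Cut A B S) {u w : E3} (hu : u ∈ cutOpen A B) (hw : w ∈ cutOpen A B)
    (he : sqm u = sqm w) (hs : sqm w ∈ S → (0 < w.1.2 → 0 ≤ u.1.2) ∧ (w.1.2 < 0 → u.1.2 ≤ 0)) :
    u = w := by
  rcases eq_or_eq_rot_of_sqm he with h1 | rfl
  · exact h1
  obtain ⟨⟨x, y⟩, z⟩ := w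
  simp only [cutOpen, mem_ofPred_eq, sqm_rot] at hu hw hs he ⊢
  simp only [rot, Left.neg_pos_iff, Left.neg_neg_iff, neg_eq_zero, Left.nonneg_neg_iff] at hu hw hs ⊢
  have hy : y = 0 := by
    by_contra hy
    have hAB : sqm ((x, y), z) ∈ A ∧ sqm ((x, y), z) ∈ B := by
      rcases lt_or_gt_of_ne hy with h1 | h1
      · exact ⟨hu.1 h1, hw.2.1 h1⟩
      · exact ⟨hw.1 h1, hu.2.1 h1⟩
    have hS : sqm ((x, y), z) ∈ S := by
      by_cases ha : 0 < (sqm ((x, y), z)).1.2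
      · exact h.inter _ ha hAB.1 hAB.2
      · have h1 := (h.stdA _ (by linarith)).1 hAB.1
        have h2 := (h.stdB _ (by linarith)).1 hAB.2
        simp only [sqm] at h1 h2 ha
        have : y * z = 0 := by nlinarith
        rcases mul_eq_zero.1 this with h3 | h3
        · exact absurd h3 hy
        · subst h3
          exfalso
          have := pow_pos (abs_pos.2 hy) 2
          rw [sq_abs] at this
          apply ha
          simpa using this
    have := hs hS
    rcases lt_or_gt_of_ne hy with h1 | h1
    · linarith [this.2 h1]
    · linarith [this.1 h1]
  subst hy
  have h1 := hu.2.2 rfl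
  have h2 := hw.2.2 rfl
  have : z = 0 := by linarith
  simp [this]

open scoped Classical in
/-- The lift of a map through the fibrewise square. -/
noncomputable def cutLift (A' S' : Set E3) (g : E3 → E3) (w : E3) : E3 :=
  if g (sqm w) ∈ S' then (if 0 ≤ w.1.2 then csq (g (sqm w)) else rot (csq (g (sqm w))))
  else if (g (sqm w)).1.2 < 1 / 8 then rup (g (sqm w))
  else if g (sqm w) ∈ A' then csq (g (sqm w)) else rot (csq (g (sqm w)))

theorem Cut.csq_ok (h : Cut A B S) {p : E3} (hp : p ∈ S ∨ 1 / 8 ≤ p.1.2) : sqm (csq p) = p := by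
  by_cases h1 : p.2 = 0 ∧ p.1.2 ≤ 0
  · obtain ⟨⟨x, a⟩, b⟩ := p
    simp only at h1 hp
    obtain ⟨rfl, ha⟩ := h1
    rcases hp with hp | hp
    · have := (h.stdS _ (by simp only; linarith)).1 hp
      obtain rfl : a = 0 := le_antisymm ha this.2
      simp [sqm]
    · linarith
  · exact sqm_csq h1

theorem Cut.not_rup (h : Cut A B S) {p : E3} (hp : p ∉ S) (h8 : p.1.2 < 1 / 8) :
    ¬(p.2 = 0 ∧ 0 ≤ p.1.2) := fun h1 => hp ((h.stdS p h8).2 h1)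

theorem Cut.sqm_lift (h : Cut A' B' S') (w : E3) : sqm (cutLift A' S' g w) = g (sqm w) := by
  unfold cutLift
  split_ifs with h1 h2 h2 h3
  · exact h.csq_ok (.inl h1)
  · rw [sqm_rot]
    exact h.csq_ok (.inl h1)
  · exact sqm_rup (h.not_rup h1 h2)
  · exact h.csq_ok (.inr (not_lt.1 h2))
  · rw [sqm_rot]
    exact h.csq_ok (.inr (not_lt.1 h2))

theorem csq_nonneg (p : E3) : 0 ≤ (csq p).1.2 := Real.sqrt_nonneg _

theorem CutMap.sign (h : CutMap g A B S A' B' S') {w : E3} (hw : sqm w ∈ S) :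
    (0 ≤ w.1.2 → 0 ≤ (cutLift A' S' g w).1.2) ∧ (w.1.2 < 0 → (cutLift A' S' g w).1.2 ≤ 0) := by
  have := (h.mem _).1 hw
  constructor
  · intro h1
    simp only [cutLift, this, h1, if_true]
    exact csq_nonneg _
  · intro h1
    simp only [cutLift, this, not_le.2 h1, if_true, if_false, rot]
    linarith [csq_nonneg (g (sqm w))]

theorem Cut.lift_mem (hc' : Cut A' B' S') (w : E3) :
    cutLift A' S' g w ∈ cutOpen A' B' := by
  have hsq := hc'.sqm_lift (g := g) w
  have hlt : ∀ p : E3, 0 < p.1.2 → 0 < (csq p).1.2 := fun p hp =>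
    csq_pos fun h' => absurd h'.2 (not_le.2 hp)
  by_cases h1 : g (sqm w) ∈ S'
  · refine ⟨fun _ => hsq ▸ hc'.subA h1, fun _ => hsq ▸ hc'.subB h1, fun h0 => ?_⟩
    have := hc'.sqm_mem (hsq ▸ h1) h0
    exact this.ge
  · by_cases h2 : (g (sqm w)).1.2 < 1 / 8
    · have he : cutLift A' S' g w = rup (g (sqm w)) := by simp only [cutLift, h1, h2, if_true, if_false]
      have hp := rup_pos (hc'.not_rup h1 h2)
      rw [← he] at hp
      have e2 : (g (sqm w)).2 = 2 * (cutLift A' S' g w).1.2 * (cutLift A' S' g w).2 := by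
        rw [← hsq, sqm]
      refine ⟨fun h3 => ?_, fun h3 => ?_, fun _ => hp.le⟩
      · rw [hsq, hc'.stdA _ h2, e2]
        positivity
      · rw [hsq, hc'.stdB _ h2, e2]
        nlinarith
    · by_cases h3 : g (sqm w) ∈ A'
      · have he : cutLift A' S' g w = csq (g (sqm w)) := by
          simp only [cutLift, h1, h2, h3, if_true, if_false]
        have := hlt (g (sqm w)) (by linarith)
        rw [← he] at this
        exact ⟨fun _ => hsq ▸ h3, fun h' => absurd h' (by linarith), fun h' => absurd h' this.ne'⟩
      · have he : cutLift A' S' g w = rot (csq (g (sqm w))) := by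
          simp only [cutLift, h1, h2, h3, if_false]
        have := hlt (g (sqm w)) (by linarith)
        have h4 : (cutLift A' S' g w).1.2 < 0 := by
          rw [he]
          simpa [rot] using this
        exact ⟨fun h' => absurd h' (by linarith),
          fun _ => hsq ▸ (hc'.cover _).resolve_left h3, fun h' => absurd h' h4.ne⟩

theorem CutMap.left (hc : Cut A B S) (hc' : Cut A' B' S') (h : CutMap g A B S A' B' S')
    {g' : E3 → E3} (h' : CutMap g' A' B' S' A B S) (hg : ∀ p, g' (g p) = p) {w : E3}
    (hw : w ∈ cutOpen A B) : cutLift A S g' (cutLift A' S' g w) = w := by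
  refine hc.eq_of_sqm (hc.lift_mem _) hw ?_ fun hS => ?_
  · rw [hc.sqm_lift, hc'.sqm_lift, hg]
  · have h1 := h.sign hS
    have h2 : sqm (cutLift A' S' g w) ∈ S' := by
      rw [hc'.sqm_lift]
      exact (h.mem _).1 hS
    have h3 := h'.sign h2
    refine ⟨fun hp => h3.1 (h1.1 hp.le), fun hp => ?_⟩
    rcases (h1.2 hp).lt_or_eq with h4 | h4
    · exact h3.2 h4
    · have h5 := hc'.sqm_mem h2 h4
      have h6 := h.pos _ hS (hc.pos_sqm hS hp.ne)
      rw [← hc'.sqm_lift (g := g)] at h6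
      simp [sqm, h4, h5] at h6

theorem CutMap.smooth_lift (hc : Cut A B S) (hc' : Cut A' B' S') (h : CutMap g A B S A' B' S')
    {w : E3} (hw : w ∈ cutOpen A B) : ContDiffWithinAt ℝ ∞ (cutLift A' S' g) (cutOpen A B) w := by
  have hgs : ContDiffAt ℝ ∞ (fun w => g (sqm w)) w := (h.smooth.comp sqm_smooth).contDiffAt
  have hcont : ContinuousAt (fun w => g (sqm w)) w := hgs.continuousAt
  by_cases hS : sqm w ∈ S
  · by_cases hy : w.1.2 = 0
    · have hz := hc.sqm_mem hS hy
      have hwe : sqm w = ((w.1.1, 0), 0) := by simp [sqm, hy, hz]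
      have hid : ∀ᶠ u in 𝓝 w, g (sqm u) = sqm u := by
        have := h.id_edge w.1.1
        rw [← hwe] at this
        exact sqm_smooth.continuous.continuousAt.eventually this
      have h8 : ∀ᶠ u in 𝓝 w, (sqm u).1.2 < 1 / 8 :=
        (sqm_smooth.continuous.fst.snd.continuousAt).eventually
          (Iio_mem_nhds (show (sqm w).1.2 < 1 / 8 by rw [hwe]; norm_num))
      have hev : cutLift A' S' g =ᶠ[𝓝[cutOpen A B] w] id := by
        filter_upwards [nhdsWithin_le_nhds hid, nhdsWithin_le_nhds h8, self_mem_nhdsWithin]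
          with u h1 h2 hu
        simp only [id]
        have hsq := hc'.sqm_lift (g := g) u
        rw [h1] at hsq
        have hu' : u ∈ cutOpen A' B' :=
          ⟨fun hp => (hc'.stdA _ h2).2 ((hc.stdA _ h2).1 (hu.1 hp)),
            fun hp => (hc'.stdB _ h2).2 ((hc.stdB _ h2).1 (hu.2.1 hp)), hu.2.2⟩
        refine hc'.eq_of_sqm (hc'.lift_mem _) hu' hsq fun hp => ?_
        have := h.sign ((hc.stdS _ h2).2 ((hc'.stdS _ h2).1 hp))
        exact ⟨fun h => this.1 h.le, this.2⟩
      have : ContDiffWithinAt ℝ ∞ id (cutOpen A B) w := contDiff_id.contDiffAt.contDiffWithinAt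
      exact this.congr_of_eventuallyEq hev (hev.self_of_nhdsWithin hw)
    · have hS' := (h.mem _).1 hS
      have hpos : 0 < (sqm w).1.2 := hc.pos_sqm hS hy
      have hgpos : 0 < (g (sqm w)).1.2 := h.pos _ hS hpos
      have hcs : ContDiffAt ℝ ∞ (fun w => csq (g (sqm w))) w :=
        ContDiffAt.comp (g := csq) w (csq_smooth fun h' => absurd h'.2 (not_le.2 hgpos)) hgs
      have hgp : ∀ᶠ u in 𝓝 w, 0 < (g (sqm u)).1.2 :=
        hcont.fst.snd.eventually (Ioi_mem_nhds hgpos)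
      have hsA : ∀ᶠ u in 𝓝 w, sqm u ∈ A → g (sqm u) ∈ A' :=
        sqm_smooth.continuous.continuousAt.eventually (h.sideA _ hS hpos)
      have hsB : ∀ᶠ u in 𝓝 w, sqm u ∈ B → g (sqm u) ∈ B' :=
        sqm_smooth.continuous.continuousAt.eventually (h.sideB _ hS hpos)
      rcases lt_or_gt_of_ne hy with hneg | hyp
      · have hev : cutLift A' S' g =ᶠ[𝓝[cutOpen A B] w] fun w => rot (csq (g (sqm w))) := by
          have hn : ∀ᶠ u : E3 in 𝓝 w, u.1.2 < 0 :=
            continuousAt_fst.snd.eventually (Iio_mem_nhds hneg)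
          filter_upwards [nhdsWithin_le_nhds hgp, nhdsWithin_le_nhds hsB, nhdsWithin_le_nhds hn,
            self_mem_nhdsWithin] with u h1 h2 h3 hu
          have h4 := h2 (hu.2.1 h3)
          unfold cutLift
          split_ifs with h5 h6 h6 h7
          · linarith
          · rfl
          · have h8 := (hc'.stdB _ h6).1 h4
            have h9 : (g (sqm u)).2 ≠ 0 := fun h9 => hc'.not_rup h5 h6 ⟨h9, h1.le⟩
            exact rup_eq_rot_csq (lt_of_le_of_ne h8 h9)
          · exact absurd (hc'.inter _ h1 h7 h4) h5
          · rfl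
        exact (ContDiffAt.comp (g := rot) w rot_smooth.contDiffAt hcs).contDiffWithinAt.congr_of_eventuallyEq hev
          (hev.self_of_nhdsWithin hw)
      · have hev : cutLift A' S' g =ᶠ[𝓝[cutOpen A B] w] fun w => csq (g (sqm w)) := by
          have hn : ∀ᶠ u : E3 in 𝓝 w, 0 < u.1.2 :=
            continuousAt_fst.snd.eventually (Ioi_mem_nhds hyp)
          filter_upwards [nhdsWithin_le_nhds hgp, nhdsWithin_le_nhds hsA, nhdsWithin_le_nhds hn,
            self_mem_nhdsWithin] with u h1 h2 h3 hu
          have h4 := h2 (hu.1 h3)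
          unfold cutLift
          split_ifs with h5 h6 h6
          · rfl
          · linarith
          · have h8 := (hc'.stdA _ h6).1 h4
            have h9 : (g (sqm u)).2 ≠ 0 := fun h9 => hc'.not_rup h5 h6 ⟨h9, h1.le⟩
            exact rup_eq_csq (lt_of_le_of_ne h8 h9.symm)
          · rfl
        exact hcs.contDiffWithinAt.congr_of_eventuallyEq hev (hev.self_of_nhdsWithin hw)
  · have hS' : g (sqm w) ∉ S' := fun h' => hS ((h.mem _).2 h')
    have hSev : ∀ᶠ u in 𝓝 w, g (sqm u) ∉ S' :=
      hcont.eventually (hc'.closedS.isOpen_compl.mem_nhds hS')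
    suffices ContDiffAt ℝ ∞ (cutLift A' S' g) w from this.contDiffWithinAt
    by_cases h8 : (g (sqm w)).1.2 < 1 / 8
    · have hev : cutLift A' S' g =ᶠ[𝓝 w] fun w => rup (g (sqm w)) := by
        filter_upwards [hSev, hcont.fst.snd.eventually (Iio_mem_nhds h8)] with u h1 h2
        have h2 : (g (sqm u)).1.2 < 1 / 8 := h2
        simp only [cutLift, h1, h2, if_true, if_false]
      exact (ContDiffAt.comp (g := rup) w (rup_smooth (hc'.not_rup hS' h8)) hgs).congr_of_eventuallyEq hev
    · have hgp : ∀ᶠ u in 𝓝 w, 0 < (g (sqm u)).1.2 :=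
        hcont.fst.snd.eventually (Ioi_mem_nhds (show (0:ℝ) < (g (sqm w)).1.2 by linarith))
      have hcs : ContDiffAt ℝ ∞ (fun w => csq (g (sqm w))) w :=
        ContDiffAt.comp (g := csq) w
          (csq_smooth fun h' => absurd h'.2 (not_le.2 (by linarith))) hgs
      by_cases hA : g (sqm w) ∈ A'
      · have hB : g (sqm w) ∉ B' := fun h' => hS' (hc'.inter _ (by linarith) hA h')
        have hev : cutLift A' S' g =ᶠ[𝓝 w] fun w => csq (g (sqm w)) := by
          filter_upwards [hSev, hgp, hcont.eventually (hc'.closedB.isOpen_compl.mem_nhds hB)]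
            with u h1 h2 h3
          have h4 := (hc'.cover (g (sqm u))).resolve_right h3
          unfold cutLift
          split_ifs with h6
          · have h8 := (hc'.stdA _ h6).1 h4
            have h9 : (g (sqm u)).2 ≠ 0 := fun h9 => hc'.not_rup h1 h6 ⟨h9, h2.le⟩
            exact rup_eq_csq (lt_of_le_of_ne h8 h9.symm)
          · rfl
        exact hcs.congr_of_eventuallyEq hev
      · have hev : cutLift A' S' g =ᶠ[𝓝 w] fun w => rot (csq (g (sqm w))) := by
          filter_upwards [hSev, hgp, hcont.eventually (hc'.closedA.isOpen_compl.mem_nhds hA)]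
            with u h1 h2 h3
          have h3 : g (sqm u) ∉ A' := h3
          have h4 := (hc'.cover (g (sqm u))).resolve_left h3
          unfold cutLift
          split_ifs with h6
          · have h8 := (hc'.stdB _ h6).1 h4
            have h9 : (g (sqm u)).2 ≠ 0 := fun h9 => hc'.not_rup h1 h6 ⟨h9, h2.le⟩
            exact rup_eq_rot_csq (lt_of_le_of_ne h8 h9)
          · rfl
        exact (ContDiffAt.comp (g := rot) w rot_smooth.contDiffAt hcs).congr_of_eventuallyEq hev

theorem CutMap.isSD (hc : Cut A B S) (hc' : Cut A' B' S') (h : CutMap g A B S A' B' S')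
    {g' : E3 → E3} (h' : CutMap g' A' B' S' A B S) (hg : ∀ p, g' (g p) = p)
    (hg' : ∀ p, g (g' p) = p) :
    IsSD (cutLift A' S' g) (cutLift A S g') (cutOpen A B) (cutOpen A' B') where
  smooth _ hw := h.smooth_lift hc hc' hw
  smooth' _ hw := h'.smooth_lift hc' hc hw
  maps _ _ := hc'.lift_mem _
  maps' _ _ := hc.lift_mem _
  left _ hw := h.left hc hc' h' hg hw
  right _ hw := h'.left hc' hc h hg' hw

theorem CutMap.lift_eq (hc' : Cut A' B' S') (h : CutMap g A B S A' B' S') {w : E3}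
    (hw : w ∈ cutOpen A B) (hid : g (sqm w) = sqm w) (hA : sqm w ∈ A → sqm w ∈ A')
    (hB : sqm w ∈ B → sqm w ∈ B') : cutLift A' S' g w = w := by
  refine hc'.eq_of_sqm (hc'.lift_mem _) ⟨fun hp => hA (hw.1 hp), fun hp => hB (hw.2.1 hp), hw.2.2⟩
    (by rw [hc'.sqm_lift, hid]) fun hp => ?_
  have := h.sign ((h.mem _).2 (hid.symm ▸ hp))
  exact ⟨fun h => this.1 h.le, this.2⟩

theorem cutOpen_std : cutOpen {p | 0 ≤ p.2} {p | p.2 ≤ 0} = HS E2 := by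
  ext w
  simp only [cutOpen, HS, sqm, mem_ofPred_eq]
  constructor
  · rintro ⟨h1, h2, h3⟩
    rcases lt_trichotomy w.1.2 0 with h | h | h
    · nlinarith [h2 h]
    · exact h3 h
    · nlinarith [h1 h]
  · intro h
    exact ⟨fun h1 => by positivity, fun h1 => by nlinarith, fun _ => h⟩

end

section
/-- Two closed sets covering the target of a tube and meeting in its core contain the two sides
of the tube. -/
theorem side_of_tube {W : Type} [NormedAddCommGroup W] [NormedSpace ℝ W] {G : E3 → W} (hG : Tube G)
    {A B : Set W} (hA : IsClosed A) (hB : IsClosed B) (hAB : ∀ p, p ∈ A ∨ p ∈ B)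
    (hI : A ∩ B = range fun q => G (q, 0)) {p₀ : E3} (h₀ : 0 < p₀.2) (h₁ : G p₀ ∈ A) (p : E3)
    (hp : 0 ≤ p.2) : G p ∈ A := by
  rcases hp.eq_or_lt with h | h
  · have : G p ∈ A ∩ B := hI ▸ ⟨p.1, congrArg G (Prod.ext rfl h)⟩
    exact this.1
  by_contra hpA
  have hconv : Convex ℝ {p : E3 | 0 < p.2} :=
    convex_halfSpace_gt (LinearMap.snd ℝ E2 ℝ).isLinear 0
  have := isPreconnected_closed_iff.1 hconv.isPreconnected (G ⁻¹' A) (G ⁻¹' B)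
    (hA.preimage hG.smooth.continuous) (hB.preimage hG.smooth.continuous) (fun q _ => hAB _)
    ⟨p₀, h₀, h₁⟩ ⟨p, h, (hAB _).resolve_left hpA⟩
  obtain ⟨u, hu, hu'⟩ := this
  have : G u ∈ A ∩ B := hu'
  rw [hI] at this
  obtain ⟨q, hq⟩ := this
  have := hG.inj hq
  rw [← this] at hu
  exact lt_irrefl (0 : ℝ) hu

/-- A surface which is standard outside the slot of radius `r` around `c`, with its sides. -/
structure Slot (c r : ℝ) (f : E2 → E3) (A B : Set E3) : Prop where
  hp : HP f
  closedA : IsClosed A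
  closedB : IsClosed B
  cover : ∀ p, p ∈ A ∨ p ∈ B
  inter : A ∩ B = range f
  stdA : ∀ p : E3, ¬(|p.1.2 - c| ≤ r ∧ |p.2| ≤ r) → (p ∈ A ↔ 0 ≤ p.2)
  stdB : ∀ p : E3, ¬(|p.1.2 - c| ≤ r ∧ |p.2| ≤ r) → (p ∈ B ↔ p.2 ≤ 0)
  stdf : ∀ q : E2, ¬|q.2 - c| ≤ r → f q = incl q

/-- A slot at the position used for the fibrewise square. -/
abbrev VSlot (f : E2 → E3) (A B : Set E3) : Prop := Slot (1 / 4) (1 / 16) f A B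

theorem hp_incl : HP incl where
  smooth := incl_smooth
  emb := .of_continuous_injective_isClosedMap incl_smooth.continuous
    (fun _ _ h => congrArg Prod.fst h) (by
      have : IsClosedMap (fun q : E2 => (q, (0 : ℝ))) := fun S hS => by
        have : (fun q : E2 => (q, (0 : ℝ))) '' S = {p | p.1 ∈ S ∧ p.2 = 0} := by
          ext p
          constructor
          · rintro ⟨q, hq, rfl⟩
            exact ⟨hq, rfl⟩
          · rintro ⟨h1, h2⟩
            exact ⟨p.1, h1, Prod.ext rfl h2.symm⟩
        rw [this]
        exact (hS.preimage continuous_fst).inter (isClosed_eq continuous_snd continuous_const)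
      exact this)
  imm q := by
    have h : HasFDerivAt incl (.inl ℝ E2 ℝ) q := (ContinuousLinearMap.inl ℝ E2 ℝ).hasFDerivAt
    rw [h.fderiv]
    exact fun a b hab => congrArg Prod.fst hab

theorem vslot_incl : VSlot incl {p | 0 ≤ p.2} {p | p.2 ≤ 0} where
  hp := hp_incl
  closedA := isClosed_le continuous_const continuous_snd
  closedB := isClosed_le continuous_snd continuous_const
  cover p := le_total 0 p.2
  inter := by
    ext p
    constructor
    · rintro ⟨h1, h2⟩
      exact ⟨p.1, Prod.ext rfl (le_antisymm h1 h2)⟩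
    · rintro ⟨q, rfl⟩
      exact ⟨le_refl (0 : ℝ), le_refl (0 : ℝ)⟩
  stdA _ _ := Iff.rfl
  stdB _ _ := Iff.rfl
  stdf _ _ := rfl

variable {f : E2 → E3} {A B : Set E3}

theorem VSlot.mem_slot (h : VSlot f A B) {q : E2} (hq : |q.2 - 1 / 4| ≤ 1 / 16) :
    |(f q).1.2 - 1 / 4| ≤ 1 / 16 ∧ |(f q).2| ≤ 1 / 16 := by
  by_contra hn
  have hI : f q ∈ A ∩ B := h.inter ▸ mem_range_self q
  have h0 : (f q).2 = 0 := le_antisymm ((h.stdB _ hn).1 hI.2) ((h.stdA _ hn).1 hI.1)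
  have h1 : ¬|(f q).1.2 - 1 / 4| ≤ 1 / 16 := fun h1 => hn ⟨h1, by rw [h0]; norm_num⟩
  have h2 : f (f q).1 = f q := (h.stdf _ h1).trans (Prod.ext rfl h0.symm)
  rw [h.hp.emb.injective h2] at h1
  exact h1 hq

theorem VSlot.cut (h : VSlot f A B) : Cut A B (f '' {q | 0 ≤ q.2}) where
  closedA := h.closedA
  closedB := h.closedB
  closedS := h.hp.emb.isClosedMap _ (isClosed_le continuous_const continuous_snd)
  cover := h.cover
  inter p hp hA hB := by
    have : p ∈ range f := h.inter ▸ ⟨hA, hB⟩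
    obtain ⟨q, rfl⟩ := this
    refine ⟨q, ?_, rfl⟩
    by_contra hq
    simp only [mem_ofPred_eq, not_le] at hq
    rw [h.stdf q (fun h' => by linarith [(abs_le.1 h').1])] at hp
    exact lt_asymm hq hp
  subA := by
    rintro _ ⟨q, -, rfl⟩
    exact (h.inter ▸ mem_range_self q : f q ∈ A ∩ B).1
  subB := by
    rintro _ ⟨q, -, rfl⟩
    exact (h.inter ▸ mem_range_self q : f q ∈ A ∩ B).2
  stdA p hp := h.stdA p fun h' => by linarith [(abs_le.1 h'.1).1]
  stdB p hp := h.stdB p fun h' => by linarith [(abs_le.1 h'.1).1]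
  stdS p hp := by
    constructor
    · rintro ⟨q, hq, rfl⟩
      have : ¬|q.2 - 1 / 4| ≤ 1 / 16 := fun h' => by
        linarith [(abs_le.1 (h.mem_slot h').1).1]
      rw [h.stdf q this]
      exact ⟨rfl, hq⟩
    · rintro ⟨h1, h2⟩
      exact ⟨p.1, h2, (h.stdf _ fun h' => by linarith [(abs_le.1 h').1]).trans
        (Prod.ext rfl h1.symm)⟩

theorem VSlot.tub_eq (h : VSlot f A B) {ε : E2 → ℝ} {p : E3} (hp : ¬|p.1.2 - 1 / 4| ≤ 1 / 16) :
    tub f ε p = tub incl ε p := by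
  refine tub_congr ?_
  have : {q : E2 | ¬|q.2 - 1 / 4| ≤ 1 / 16} ∈ 𝓝 p.1 := by
    refine IsOpen.mem_nhds ?_ hp
    simp only [not_le]
    exact isOpen_lt continuous_const (by fun_prop)
  filter_upwards [this] with q hq using h.stdf q hq

/-- A compactly supported push in the second coordinate. -/
noncomputable def pushDfm (φ : ℝ → ℝ) (hφ : ContDiff ℝ ∞ φ) : Dfm E3 E3 where
  toFun p := ((p.1.1, p.1.2 + φ p.2), p.2)
  invFun p := ((p.1.1, p.1.2 - φ p.2), p.2)
  left_inv p := by simp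
  right_inv p := by simp
  smooth := by
    show ContDiff ℝ ∞ fun p : E3 => ((p.1.1, p.1.2 + φ p.2), p.2)
    fun_prop
  smooth_symm := by
    show ContDiff ℝ ∞ fun p : E3 => ((p.1.1, p.1.2 - φ p.2), p.2)
    fun_prop

theorem pushDfm_apply (φ : ℝ → ℝ) (hφ : ContDiff ℝ ∞ φ) (p : E3) :
    pushDfm φ hφ p = ((p.1.1, p.1.2 + φ p.2), p.2) := rfl

theorem VSlot.exists_dfm (h : VSlot f A B) : ∃ (g : Dfm E3 E3) (ε : E2 → ℝ), (∀ q, 0 < ε q) ∧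
    Tube (tub f ε) ∧ Tube (tub incl ε) ∧
    (∀ p : E3, -(1 / 16) < p.1.2 → |p.2| ≤ 1 / 4 → g (tub f ε p) = tub incl ε p) ∧
    ∀ v : E3, (3 / 4) ^ 2 ≤ v.1.2 ^ 2 + v.2 ^ 2 → g v = v := by
  obtain ⟨ε, hεs, hε, hT⟩ := h.hp.exists_tub (η := 1 / 16) (by norm_num)
  have hTP : Tube (tub incl ε) := tube_incl hεs fun q => (hε q).1
  obtain ⟨χ, hχs, ⟨U, hU, hUs, hU1⟩, hχt, hχI⟩ :=
    exists_smooth_one_nhds_of_subset (E := ℝ) (Z := Icc (-(1 / 4)) (1 / 4))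
      (O := Ioo (-(1 / 2)) (1 / 2)) isClosed_Icc isOpen_Ioo
      (Icc_subset_Ioo (by norm_num) (by norm_num))
  have hφ : ContDiff ℝ ∞ fun z => 3 / 8 * χ z := contDiff_const.mul hχs
  set Θ := pushDfm _ hφ with hΘ
  have hC : ∀ p : E3, 1 / 2 ≤ |p.2| → Θ p = p := fun p hp => by
    have : χ p.2 = 0 := image_eq_zero_of_notMem_tsupport fun h' => by
      have := hχt h'
      have := abs_lt.2 ⟨this.1, this.2⟩
      linarith
    rw [hΘ, pushDfm_apply, this]
    simp
  have hΘ1 : ∀ p : E3, |p.2| ≤ 1 / 4 → Θ p = ((p.1.1, p.1.2 + 3 / 8), p.2) := fun p hp => by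
    rw [hΘ, pushDfm_apply, show χ p.2 = 1 from hU1 _ (hUs (abs_le.1 hp))]
    simp
  obtain ⟨eH, hH1, hH2⟩ := hT.exists_dfm Θ hC
  obtain ⟨eP, hP1, hP2⟩ := hTP.exists_dfm Θ hC
  refine ⟨eH.trans eP.symm, ε, fun q => (hε q).1, hT, hTP, fun p hp hz => ?_, fun v hv => ?_⟩
  · rw [Dfm.trans_apply, hH1, hΘ1 p hz, h.tub_eq, ← hΘ1 p hz, ← hP1, Dfm.symm_apply_apply]
    intro h'
    have := (abs_le.1 h').2
    simp only at this
    linarith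
  have hb : ∀ p : E3, |ε p.1 * sqz p.2| ≤ 1 / 16 := fun p => by
    rw [abs_mul, abs_of_pos (hε _).1]
    calc ε p.1 * |sqz p.2| ≤ 1 / 16 * 1 :=
          mul_le_mul (hε _).2.1 (sqz_lt _).le (abs_nonneg _) (by norm_num)
      _ = _ := by norm_num
  have hfar : ∀ p : E3, tub incl ε p = v → 1 / 2 < |p.1.2| := fun p hp => by
    rw [tub_incl] at hp
    rw [← hp] at hv
    simp only at hv
    have h1 := sq_le_sq' (abs_le.1 (hb p)).1 (abs_le.1 (hb p)).2
    have h2 : (1 / 2 : ℝ) ^ 2 < p.1.2 ^ 2 := by linarith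
    rw [sq_lt_sq] at h2
    simpa using h2
  have hfar' : ∀ p : E3, tub incl ε p = v → ¬|p.1.2 - 1 / 4| ≤ 1 / 16 := fun p hp h' => by
    have := abs_le.1 h'
    exact absurd (hfar p hp) (not_lt.2 (abs_le.2 ⟨by linarith, by linarith⟩))
  have hoff : ∀ p : E3, tub f ε p = v → ¬|p.1.2 - 1 / 4| ≤ 1 / 16 := fun p hp h' => by
    obtain ⟨h1, h2⟩ := h.mem_slot h'
    have hn : ‖(ε p.1 * sqz p.2) • nrm f p.1‖ ≤ 1 / 16 := by
      rw [norm_smul, Real.norm_eq_abs, abs_mul, abs_of_pos (hε _).1]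
      calc ε p.1 * |sqz p.2| * ‖nrm f p.1‖ = |sqz p.2| * (ε p.1 * ‖nrm f p.1‖) := by ring
        _ ≤ 1 * (1 / 16) := mul_le_mul (sqz_lt _).le (hε _).2.2
            (mul_nonneg (hε _).1.le (norm_nonneg _)) one_pos.le
        _ = _ := by norm_num
    set u := (ε p.1 * sqz p.2) • nrm f p.1 with hu
    have hv' : f p.1 + u = v := hp
    have hu1 := abs_le.1 (((norm_snd_le u.1).trans (norm_fst_le u)).trans hn)
    have hu2 := abs_le.1 ((norm_snd_le u).trans hn)
    rw [← hv'] at hv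
    simp only [Prod.fst_add, Prod.snd_add] at hv
    have h1 := abs_le.1 h1
    have h2 := abs_le.1 h2
    have h3 := sq_le_sq' (a := (f p.1).1.2 + u.1.2) (b := 3 / 8) (by linarith) (by linarith)
    have h4 := sq_le_sq' (a := (f p.1).2 + u.2) (b := 1 / 8) (by linarith) (by linarith)
    norm_num at h3 h4 hv
    linarith
  suffices eH v = eP v by rw [Dfm.trans_apply, this, Dfm.symm_apply_apply]
  by_cases hex : ∃ p : E3, |p.2| < 1 / 2 ∧ tub f ε p = v
  · obtain ⟨p, -, hpv⟩ := hex
    have hpv' := hpv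
    rw [h.tub_eq (hoff p hpv)] at hpv'
    rw [← hpv, hH1, hpv, ← hpv', hP1]
    refine h.tub_eq ?_
    have h1 := hfar p hpv'
    have h2 := hχI p.2
    rw [hΘ, pushDfm_apply]
    intro h'
    have h' := abs_le.1 h'
    simp only at h'
    have := h2.1
    have := h2.2
    rcases lt_abs.1 h1 with h3 | h3 <;> linarith
  · have h1 : ∀ p : E3, |p.2| < 1 / 2 → tub f ε p ≠ v := fun p hp h' => hex ⟨p, hp, h'⟩
    rw [hH2 v h1, hP2 v fun p hp h' => h1 p hp ((h.tub_eq (hfar' p h')).trans h')]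

theorem VSlot.isSD (h : VSlot f A B) : ∃ g g' : E3 → E3, IsSD g g' (cutOpen A B) (HS E2) ∧
    ∀ w : E3, 3 / 4 ≤ w.1.2 ^ 2 + w.2 ^ 2 →
      (w ∈ cutOpen A B → g w = w) ∧ (w ∈ HS E2 → g' w = w) := by
  obtain ⟨g, ε, hε, hT, hTP, hK, hN⟩ := h.exists_dfm
  have hc := h.cut
  have hc' := vslot_incl.cut
  have hf : ∀ q : E2, 0 ≤ q.2 → g (f q) = incl q := fun q hq => by
    have := hK (q, 0) (by simp only; linarith) (by norm_num)
    simpa using this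
  have hf' : ∀ q : E2, 0 ≤ q.2 → g.symm (incl q) = f q := fun q hq => by
    rw [← hf q hq, Dfm.symm_apply_apply]
  have hsg : ∀ p : E3, 0 ≤ p.2 ↔ 0 ≤ (tub incl ε p).2 := fun p => by
    rw [tub_incl]
    simp only
    rw [mul_nonneg_iff_of_pos_left (hε _)]
    nth_rw 2 [← sqz_zero]
    exact sqz_strictMono.le_iff_le.symm
  have hsg' : ∀ p : E3, p.2 ≤ 0 ↔ (tub incl ε p).2 ≤ 0 := fun p => by
    rw [tub_incl]
    simp only
    rw [← not_lt, ← not_lt, mul_pos_iff_of_pos_left (hε _)]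
    nth_rw 2 [← sqz_zero]
    exact not_congr sqz_strictMono.lt_iff_lt.symm
  have hoff : ∀ p : E3, p.1 = 0 → ¬|p.1.2 - 1 / 4| ≤ 1 / 16 := fun p hp h' => by
    rw [hp] at h'
    norm_num at h'
  have hI : ∀ G : E3 → E3, (∀ q, G (q, 0) = f q) → A ∩ B = range fun q => G (q, 0) := fun G hG => by
    rw [h.inter]
    exact congrArg range (funext hG).symm
  have hA0 := side_of_tube hT h.closedA h.closedB h.cover (hI _ fun q => tub_zero f ε q)
    (p₀ := (0, 1)) one_pos (by
      rw [h.tub_eq (hoff _ rfl), h.stdA, ← hsg]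
      · exact zero_le_one
      · rw [tub_incl]
        exact fun h' => hoff (0, 1) rfl h'.1)
  have hB0 := side_of_tube hT.comp_refl h.closedB h.closedA (fun p => (h.cover p).symm)
    ((inter_comm B A).trans (hI (fun p => tub f ε (p.1, -p.2)) fun q => by simp)) (p₀ := (0, 1)) one_pos (by
      rw [h.tub_eq (hoff _ rfl), h.stdB, ← hsg']
      · simp
      · rw [tub_incl]
        exact fun h' => hoff (0, 1) rfl h'.1)
  have hB1 : ∀ p : E3, p.2 ≤ 0 → tub f ε p ∈ B := fun p hp => by
    have := hB0 (p.1, -p.2) (by simpa using hp)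
    simpa using this
  have hinj : ∀ p : E3, tub f ε p ∈ A → tub f ε p ∈ B → p.2 = 0 := fun p h1 h2 => by
    have : tub f ε p ∈ range f := h.inter ▸ ⟨h1, h2⟩
    obtain ⟨q, hq⟩ := this
    rw [← tub_zero f ε] at hq
    rw [← hT.inj hq]
  have hGA : ∀ p : E3, tub f ε p ∈ A ↔ 0 ≤ p.2 := fun p => by
    refine ⟨fun h1 => ?_, hA0 p⟩
    rcases le_total 0 p.2 with h2 | h2
    · exact h2
    · exact (hinj p h1 (hB1 p h2)).ge
  have hGB : ∀ p : E3, tub f ε p ∈ B ↔ p.2 ≤ 0 := fun p => by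
    refine ⟨fun h1 => ?_, hB1 p⟩
    rcases le_total 0 p.2 with h2 | h2
    · exact (hinj p (hA0 p h2) h1).le
    · exact h2
  set O : Set E3 := {p | -(1 / 16) < p.1.2 ∧ |p.2| < 1 / 4} with hO
  have hOo : IsOpen O := by
    have h1 : IsOpen {p : E3 | -(1 / 16) < p.1.2} := isOpen_lt continuous_const (by fun_prop)
    have h2 : IsOpen {p : E3 | |p.2| < 1 / 4} := isOpen_lt (by fun_prop) continuous_const
    exact h1.inter h2
  have hmemO : ∀ q : E2, 0 ≤ q.2 → (q, (0 : ℝ)) ∈ O := fun q hq =>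
    ⟨by simp only; linarith, by norm_num⟩
  have hKO : ∀ p ∈ O, g (tub f ε p) = tub incl ε p := fun p hp => hK p hp.1 hp.2.le
  have hKO' : ∀ p ∈ O, g.symm (tub incl ε p) = tub f ε p := fun p hp => by
    rw [← hKO p hp, Dfm.symm_apply_apply]
  have hnf : ∀ q : E2, 0 ≤ q.2 → tub f ε '' O ∈ 𝓝 (f q) := fun q hq =>
    (hT.isOpenMap _ hOo).mem_nhds ⟨(q, 0), hmemO q hq, tub_zero f ε q⟩
  have hnP : ∀ q : E2, 0 ≤ q.2 → tub incl ε '' O ∈ 𝓝 (incl q) := fun q hq =>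
    (hTP.isOpenMap _ hOo).mem_nhds ⟨(q, 0), hmemO q hq, tub_zero incl ε q⟩
  have hid : ∀ x : ℝ, ∀ᶠ p in 𝓝 (((x, 0), 0) : E3), g p = p := fun x => by
    have ho : IsOpen (O ∩ {p : E3 | p.1.2 < 1 / 16}) :=
      hOo.inter (isOpen_lt (by fun_prop) continuous_const)
    have : tub incl ε '' (O ∩ {p : E3 | p.1.2 < 1 / 16}) ∈ 𝓝 (((x, 0), 0) : E3) :=
      (hTP.isOpenMap _ ho).mem_nhds ⟨((x, 0), 0), ⟨hmemO (x, 0) le_rfl, by simp⟩,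
        tub_zero incl ε (x, 0)⟩
    filter_upwards [this] with p hp
    obtain ⟨p', ⟨hp1, hp2⟩, rfl⟩ := hp
    have hp2 : p'.1.2 < 1 / 16 := hp2
    have := hKO p' hp1
    rwa [h.tub_eq fun h' => by linarith [(abs_le.1 h').1]] at this
  have hcm : CutMap g A B (f '' {q | 0 ≤ q.2}) {p | 0 ≤ p.2} {p | p.2 ≤ 0}
      (incl '' {q | 0 ≤ q.2}) := by
    refine ⟨g.contDiff, fun p => ⟨?_, ?_⟩, hid, ?_, ?_, ?_⟩
    · rintro ⟨q, hq, rfl⟩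
      exact ⟨q, hq, (hf q hq).symm⟩
    · rintro ⟨q, hq, hqp⟩
      exact ⟨q, hq, g.injective ((hf q hq).trans hqp)⟩
    · rintro _ ⟨q, hq, rfl⟩ hp
      rw [hf q hq]
      refine lt_of_le_of_ne hq fun h0 => ?_
      have h0 : q.2 = 0 := h0.symm
      rw [h.stdf q (by rw [h0]; norm_num)] at hp
      exact hp.ne' h0
    · rintro _ ⟨q, hq, rfl⟩ -
      filter_upwards [hnf q hq] with p hp hpA
      obtain ⟨p', hp', rfl⟩ := hp
      rw [hKO p' hp']
      exact (hsg p').1 ((hGA p').1 hpA)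
    · rintro _ ⟨q, hq, rfl⟩ -
      filter_upwards [hnf q hq] with p hp hpA
      obtain ⟨p', hp', rfl⟩ := hp
      rw [hKO p' hp']
      exact (hsg' p').1 ((hGB p').1 hpA)
  have hcm' : CutMap g.symm {p | 0 ≤ p.2} {p | p.2 ≤ 0} (incl '' {q | 0 ≤ q.2}) A B
      (f '' {q | 0 ≤ q.2}) := by
    refine ⟨g.symm.contDiff, fun p => ?_, fun x => ?_, ?_, ?_, ?_⟩
    · rw [hcm.mem, Dfm.apply_symm_apply]
    · filter_upwards [hid x] with p hp
      conv_lhs => rw [← hp]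
      simp
    · rintro _ ⟨q, hq, rfl⟩ hp
      rw [hf' q hq]
      have hp : 0 < q.2 := hp
      by_cases h1 : |q.2 - 1 / 4| ≤ 1 / 16
      · linarith [(abs_le.1 (h.mem_slot h1).1).1]
      · rwa [h.stdf q h1]
    · rintro _ ⟨q, hq, rfl⟩ -
      filter_upwards [hnP q hq] with p hp hpA
      obtain ⟨p', hp', rfl⟩ := hp
      rw [hKO' p' hp', hGA]
      exact (hsg p').2 hpA
    · rintro _ ⟨q, hq, rfl⟩ -
      filter_upwards [hnP q hq] with p hp hpA
      obtain ⟨p', hp', rfl⟩ := hp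
      rw [hKO' p' hp', hGB]
      exact (hsg' p').2 hpA
  have hSD := hcm.isSD hc hc' hcm' (fun p => by simp) (fun p => by simp)
  rw [cutOpen_std] at hSD
  have hsq : ∀ w : E3, 3 / 4 ≤ w.1.2 ^ 2 + w.2 ^ 2 →
      (3 / 4) ^ 2 ≤ (sqm w).1.2 ^ 2 + (sqm w).2 ^ 2 := fun w hw => by
    have : (sqm w).1.2 ^ 2 + (sqm w).2 ^ 2 = (w.1.2 ^ 2 + w.2 ^ 2) ^ 2 := by
      simp only [sqm]
      ring
    rw [this]
    exact pow_le_pow_left₀ (by norm_num) hw 2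
  have hns : ∀ v : E3, (3 / 4) ^ 2 ≤ v.1.2 ^ 2 + v.2 ^ 2 →
      ¬(|v.1.2 - 1 / 4| ≤ 1 / 16 ∧ |v.2| ≤ 1 / 16) := fun v hv h' => by
    have h1 := abs_le.1 h'.1
    have h2 := abs_le.1 h'.2
    have h3 := sq_le_sq' (a := v.1.2) (b := 5 / 16) (by linarith) (by linarith)
    have h4 := sq_le_sq' (a := v.2) (b := 1 / 16) (by linarith) (by linarith)
    norm_num at h3 h4 hv
    linarith
  refine ⟨_, _, hSD, fun w hw => ⟨fun hwD => ?_, fun hwD => ?_⟩⟩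
  · exact hcm.lift_eq hc' hwD (hN _ (hsq w hw)) (h.stdA _ (hns _ (hsq w hw))).1
      (h.stdB _ (hns _ (hsq w hw))).1
  · refine hcm'.lift_eq hc (cutOpen_std ▸ hwD) ?_ (h.stdA _ (hns _ (hsq w hw))).2
      (h.stdB _ (hns _ (hsq w hw))).2
    conv_lhs => rw [← hN _ (hsq w hw)]
    simp

end

section
theorem exists_dfm_eq_sqm : ∃ D : Dfm E3 E3, (∀ p : E3, 0 ≤ (D p).2 ↔ 0 ≤ p.2) ∧
    (∀ p : E3, (D p).2 ≤ 0 ↔ p.2 ≤ 0) ∧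
    ∀ p : E3, |p.1.2 - 1 / 2| ≤ 1 / 32 → |p.2| ≤ 1 / 32 → D p = sqm p := by
  obtain ⟨d, hd1, -, -, U, -, hZU, hU⟩ := exists_dfm_coord κ23
    (fun p : E3 => (p.1.2 + 1 / 2) ^ 2 - p.2 ^ 2) (by fun_prop)
    (Z := {p | |p.1.2| ≤ 1 / 16}) (isClosed_le (by fun_prop) continuous_const)
    (by
      intro v hv θ hθ
      simp only [κ23_apply, κ23_symm_apply, mem_ofPred_eq, abs_mul, abs_of_nonneg hθ.1] at hv ⊢
      exact (mul_le_of_le_one_left (abs_nonneg _) hθ.2).trans hv)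
    (fun _ => 1 / 2) continuous_const (fun _ => by norm_num)
    (by
      intro v hv
      have h1 : HasFDerivAt (fun p : E3 => p.1.2) ((ContinuousLinearMap.snd ℝ ℝ ℝ).comp
        (ContinuousLinearMap.fst ℝ E2 ℝ)) v :=
        ((ContinuousLinearMap.snd ℝ ℝ ℝ).comp (ContinuousLinearMap.fst ℝ E2 ℝ)).hasFDerivAt
      have h2 : HasFDerivAt (fun p : E3 => p.2) (ContinuousLinearMap.snd ℝ E2 ℝ) v :=
        hasFDerivAt_snd
      have h3 : HasFDerivAt (fun p : E3 => (p.1.2 + 1 / 2) ^ 2 - p.2 ^ 2) _ v :=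
        ((h1.add_const (1 / 2)).pow 2).sub (h2.pow 2)
      rw [h3.fderiv]
      have := abs_le.1 (show |v.1.2| ≤ 1 / 16 from hv)
      simp
      linarith)
  obtain ⟨χ, hχs, ⟨U', -, hUs, hU1⟩, hχt, hχI⟩ :=
    exists_smooth_one_nhds_of_subset (E := ℝ) (Z := Ici (1 / 8)) (O := Ioi (1 / 16)) isClosed_Ici
      isOpen_Ioi (Ici_subset_Ioi.2 (by norm_num))
  set σ : ℝ → ℝ := fun a => χ a * a + (1 - χ a) with hσ
  have hσs : ContDiff ℝ ∞ σ := by fun_prop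
  have hσ1 : ∀ a, 1 / 8 ≤ a → σ a = a := fun a ha => by simp [hσ, hU1 a (hUs ha)]
  have hσ0 : ∀ a, 0 < σ a := fun a => by
    by_cases h : a ∈ tsupport χ
    · have h1 : 1 / 16 < a := hχt h
      have h2 := hχI a
      have h3 := h2.1
      have h4 := h2.2
      simp only [hσ]
      nlinarith
    · simp [hσ, image_eq_zero_of_notMem_tsupport h]
  have hσp : ∀ a s : ℝ, 0 < σ a + s ^ 2 := fun a s => by
    have := hσ0 a
    positivity
  set c : E3 → ℝ := fun p => 2 * p.2 * √(σ p.1.2 + p.2 ^ 2) with hc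
  have hcs : ContDiff ℝ ∞ c := by
    have h1 : ContDiff ℝ ∞ fun p : E3 => σ p.1.2 + p.2 ^ 2 := by fun_prop
    have h2 : ContDiff ℝ ∞ fun p : E3 => √(σ p.1.2 + p.2 ^ 2) := h1.sqrt fun p => (hσp _ _).ne'
    fun_prop
  obtain ⟨e, he⟩ := exists_dfm_of_mono c hcs
    (by
      rintro ⟨q, s⟩
      have h1 := hasDerivAt_slice hcs q s
      have h2 : HasDerivAt (fun s => c (q, s)) _ s :=
        ((hasDerivAt_id s).const_mul 2).mul
          (((hasDerivAt_pow 2 s).const_add (σ q.2)).sqrt (hσp _ _).ne')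
      rw [h1.unique h2]
      have := Real.sqrt_pos.2 (hσp q.2 s)
      have h3 : 2 * id s * (((2 : ℕ) : ℝ) * s ^ (2 - 1) / (2 * √(σ q.2 + s ^ 2))) =
          2 * s ^ 2 / √(σ q.2 + s ^ 2) := by
        simp
        field_simp
      rw [h3]
      positivity)
    (by
      intro q y
      have h0 := Real.sqrt_pos.2 (hσ0 q.2)
      have hle : ∀ s, √(σ q.2) ≤ √(σ q.2 + s ^ 2) := fun s =>
        Real.sqrt_le_sqrt (by nlinarith [sq_nonneg s])
      have := mem_range_of_exists_le_of_exists_ge (f := fun s => c (q, s)) (c := y)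
        (hcs.continuous.comp (by fun_prop))
        ⟨-(|y| / (2 * √(σ q.2))), by
          have h1 := hle (-(|y| / (2 * √(σ q.2))))
          have h2 : 0 ≤ |y| / (2 * √(σ q.2)) := by positivity
          have h3 : |y| / (2 * √(σ q.2)) * (2 * √(σ q.2)) = |y| := by field_simp
          simp only [hc]
          nlinarith [neg_abs_le y]⟩
        ⟨|y| / (2 * √(σ q.2)), by
          have h1 := hle (|y| / (2 * √(σ q.2)))
          have h2 : 0 ≤ |y| / (2 * √(σ q.2)) := by positivity
          have h3 : |y| / (2 * √(σ q.2)) * (2 * √(σ q.2)) = |y| := by field_simp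
          simp only [hc]
          nlinarith [le_abs_self y]⟩
      exact this)
  have hsh : ContDiff ℝ ∞ fun p : E3 => ((p.1.1, p.1.2 - 1 / 2), p.2) := by fun_prop
  have hsh' : ContDiff ℝ ∞ fun p : E3 => ((p.1.1, p.1.2 + 1 / 2), p.2) := by fun_prop
  let s : Dfm E3 E3 := ⟨⟨fun p => ((p.1.1, p.1.2 - 1 / 2), p.2),
    fun p => ((p.1.1, p.1.2 + 1 / 2), p.2), fun p => by simp, fun p => by simp⟩, hsh, hsh'⟩
  have hs : ∀ p, s p = ((p.1.1, p.1.2 - 1 / 2), p.2) := fun p => rfl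
  have hd2 : ∀ p : E3, (d p).2 = p.2 := fun p => by
    have := hd1 p
    simp only [κ23_apply, Prod.mk.injEq] at this
    exact this.2
  have hd3 : ∀ p : E3, (d p).1.1 = p.1.1 := fun p => by
    have := hd1 p
    simp only [κ23_apply, Prod.mk.injEq] at this
    exact this.1
  have hsnd : ∀ p : E3, ∃ t : ℝ, 0 < t ∧ (e (d (s p))).2 = t * p.2 := fun p => by
    refine ⟨2 * √(σ (d (s p)).1.2 + p.2 ^ 2), mul_pos two_pos (Real.sqrt_pos.2 (hσp _ _)), ?_⟩
    rw [he, hc]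
    simp only [hd2, hs]
    ring
  refine ⟨(s.trans d).trans e, fun p => ?_, fun p => ?_, fun p h1 h2 => ?_⟩
  · obtain ⟨t, ht, h⟩ := hsnd p
    simp only [Dfm.trans_apply, h]
    exact mul_nonneg_iff_of_pos_left ht
  · obtain ⟨t, ht, h⟩ := hsnd p
    simp only [Dfm.trans_apply, h]
    rw [← not_lt, ← not_lt, mul_pos_iff_of_pos_left ht]
  · have h3 : (d (s p)).1.2 = p.1.2 ^ 2 - p.2 ^ 2 := by
      have := hU (s p) (hZU (show |p.1.2 - 1 / 2| ≤ 1 / 16 by linarith))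
      have := congrArg Prod.snd this
      simpa [hs] using this
    have h1 := abs_le.1 h1
    have h2 := abs_le.1 h2
    have hy : 0 < p.1.2 := by linarith
    simp only [Dfm.trans_apply, he, hc, h3, hd2]
    rw [hσ1 _ (by nlinarith)]
    refine Prod.ext (Prod.ext (hd3 _) h3) ?_
    simp only [sqm, sub_add_cancel, hs, Real.sqrt_sq hy.le]
    ring

/-- The two-sided region: `A` to the right of the axis and the rotated `B` to the left. -/
def twoSided (A B : Set E3) : Set E3 :=
  {w | (0 < w.1.2 → w ∈ A) ∧ (w.1.2 < 0 → rot w ∈ B) ∧ (w.1.2 = 0 → 0 ≤ w.2)}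

variable {f : E2 → E3} {A B : Set E3}

/-- A diffeomorphism of space preserving the standard plane restricts to the plane. -/
noncomputable def Dfm.plane (D : Dfm E3 E3) (h : ∀ p : E3, p.2 = 0 ↔ (D p).2 = 0) : Dfm E2 E2 where
  toFun q := (D (q, 0)).1
  invFun q := (D.symm (q, 0)).1
  left_inv q := by
    have : ((D (q, 0)).1, (0 : ℝ)) = D (q, 0) := Prod.ext rfl ((h (q, 0)).1 rfl).symm
    simp [this]
  right_inv q := by
    have : ((D.symm (q, 0)).1, (0 : ℝ)) = D.symm (q, 0) :=
      Prod.ext rfl ((h (D.symm (q, 0))).2 (by simp)).symm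
    simp [this]
  smooth := by
    show ContDiff ℝ ∞ fun q : E2 => (D (q, 0)).1
    exact contDiff_fst.comp (D.contDiff.comp incl_smooth)
  smooth_symm := by
    show ContDiff ℝ ∞ fun q : E2 => (D.symm (q, 0)).1
    exact contDiff_fst.comp (D.symm.contDiff.comp incl_smooth)

theorem Dfm.incl_plane_symm (D : Dfm E3 E3) (h : ∀ p : E3, p.2 = 0 ↔ (D p).2 = 0) (q : E2) :
    incl ((D.plane h).symm q) = D.symm (q, 0) :=
  Prod.ext rfl ((h (D.symm (q, 0))).2 (by simp)).symm

theorem Slot.vslot (h : Slot (1 / 2) (1 / 32) f A B) :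
    ∃ f' A' B', VSlot f' A' B' ∧ ∀ w : E3, 0 < w.1.2 →
      (sqm w ∈ A' ↔ w ∈ A) ∧ (sqm w ∈ B' ↔ w ∈ B) := by
  obtain ⟨D, hD1, hD2, hD3⟩ := exists_dfm_eq_sqm
  have hP : ∀ p : E3, p.2 = 0 ↔ (D p).2 = 0 := fun p => by
    rw [le_antisymm_iff, le_antisymm_iff, hD1, hD2]
  have hoff : ∀ v : E3, ¬(|v.1.2 - 1 / 4| ≤ 1 / 16 ∧ |v.2| ≤ 1 / 16) →
      ¬(|(D.symm v).1.2 - 1 / 2| ≤ 1 / 32 ∧ |(D.symm v).2| ≤ 1 / 32) := fun v hv hu => hv (by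
    have := hD3 _ hu.1 hu.2
    rw [Dfm.apply_symm_apply] at this
    rw [this]
    generalize D.symm v = u at hu
    have h1 := abs_le.1 hu.1
    have h2 := abs_le.1 hu.2
    simp only [sqm]
    constructor <;> rw [abs_le] <;> constructor <;> nlinarith)
  refine ⟨fun q => D (f ((D.plane hP).symm q)), D.symm ⁻¹' A, D.symm ⁻¹' B,
    ⟨(h.hp.dfm_comp D).comp_dfm _, h.closedA.preimage D.symm.continuous,
      h.closedB.preimage D.symm.continuous, fun p => h.cover _, ?_, fun v hv => ?_, fun v hv => ?_,
      fun q hq => ?_⟩, fun w hw => ?_⟩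
  · ext v
    rw [← preimage_inter, h.inter]
    constructor
    · rintro ⟨q, hq⟩
      exact ⟨D.plane hP q, by simp [hq]⟩
    · rintro ⟨q, rfl⟩
      exact ⟨(D.plane hP).symm q, by simp⟩
  · rw [mem_preimage, h.stdA _ (hoff v hv), ← hD1, Dfm.apply_symm_apply]
  · rw [mem_preimage, h.stdB _ (hoff v hv), ← hD2, Dfm.apply_symm_apply]
  · have h1 := D.incl_plane_symm hP q
    have h2 := hoff (q, 0) fun h' => hq h'.1
    rw [← h1] at h2
    rw [h.stdf, h1, Dfm.apply_symm_apply]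
    · rfl
    · exact fun h' => h2 ⟨h', by norm_num [incl]⟩
  · by_cases hs : |w.1.2 - 1 / 2| ≤ 1 / 32 ∧ |w.2| ≤ 1 / 32
    · rw [← hD3 w hs.1 hs.2]
      simp
    · have h1 : ¬(|(D.symm (sqm w)).1.2 - 1 / 2| ≤ 1 / 32 ∧ |(D.symm (sqm w)).2| ≤ 1 / 32) := by
        intro h'
        have h2 := hD3 _ h'.1 h'.2
        rw [Dfm.apply_symm_apply] at h2
        have h3 := (abs_le.1 h'.1).1
        rcases eq_or_eq_rot_of_sqm h2 with h4 | h4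
        · rw [← h4] at h'
          exact hs h'
        · rw [h4] at hw
          simp only [rot] at hw
          linarith
      rw [mem_preimage, mem_preimage, h.stdA _ h1, h.stdB _ h1, h.stdA _ hs, h.stdB _ hs, ← hD1,
        ← hD2, Dfm.apply_symm_apply]
      simp only [sqm]
      have h5 : 0 < 2 * w.1.2 := by linarith
      refine ⟨mul_nonneg_iff_of_pos_left h5, ?_⟩
      rw [← not_lt, ← not_lt, mul_pos_iff_of_pos_left h5]

theorem Slot.isSD (h : Slot (1 / 2) (1 / 32) f A B) : ∃ g g' : E3 → E3,
    IsSD g g' (twoSided A B) (HS E2) ∧ ∀ w : E3, 3 / 4 ≤ w.1.2 ^ 2 + w.2 ^ 2 →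
      (w ∈ twoSided A B → g w = w) ∧ (w ∈ HS E2 → g' w = w) := by
  obtain ⟨f', A', B', h', hm⟩ := h.vslot
  have : cutOpen A' B' = twoSided A B := by
    ext w
    simp only [cutOpen, twoSided, mem_ofPred_eq]
    refine and_congr (forall_congr' fun hw => (hm w hw).1) (and_congr (forall_congr' fun hw => ?_)
      Iff.rfl)
    have := (hm (rot w) (by simpa [rot] using hw)).2
    rwa [sqm_rot] at this
  rw [← this]
  exact h'.isSD

end

/-- Translation in the second coordinate. -/
def sh (s : ℝ) (p : E3) : E3 := ((p.1.1, p.1.2 + s), p.2)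

@[simp] theorem sh_fst_fst (s : ℝ) (p : E3) : (sh s p).1.1 = p.1.1 := rfl
@[simp] theorem sh_fst_snd (s : ℝ) (p : E3) : (sh s p).1.2 = p.1.2 + s := rfl
@[simp] theorem sh_snd (s : ℝ) (p : E3) : (sh s p).2 = p.2 := rfl

theorem sh_smooth (s : ℝ) : ContDiff ℝ ∞ (sh s) := by
  unfold sh
  fun_prop

/-- Translation in the second coordinate as a diffeomorphism. -/
def shDfm (s : ℝ) : Dfm E3 E3 :=
  ⟨⟨sh s, sh (-s), fun p => by simp [sh], fun p => by simp [sh]⟩, sh_smooth s, sh_smooth (-s)⟩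

/-- The half turn as a diffeomorphism. -/
def rotDfm : Dfm E3 E3 := ⟨⟨rot, rot, rot_rot, rot_rot⟩, rot_smooth, rot_smooth⟩

/-- Translation of the plane in the second coordinate. -/
def shPlane (s : ℝ) : Dfm E2 E2 :=
  ⟨⟨fun q => (q.1, q.2 + s), fun q => (q.1, q.2 - s), fun p => by simp, fun p => by simp⟩,
    show ContDiff ℝ ∞ fun q : E2 => (q.1, q.2 + s) by fun_prop,
    show ContDiff ℝ ∞ fun q : E2 => (q.1, q.2 - s) by fun_prop⟩

/-- Reflection of the plane in the second coordinate. -/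
def flipPlane : Dfm E2 E2 :=
  ⟨⟨fun q => (q.1, -q.2), fun q => (q.1, -q.2), fun p => by simp, fun p => by simp⟩,
    show ContDiff ℝ ∞ fun q : E2 => (q.1, -q.2) by fun_prop,
    show ContDiff ℝ ∞ fun q : E2 => (q.1, -q.2) by fun_prop⟩

theorem range_dfm_comp {f : E2 → E3} (D : Dfm E3 E3) (d : Dfm E2 E2) :
    (range fun q => D (f (d q))) = D.symm ⁻¹' range f := by
  ext v
  constructor
  · rintro ⟨q, rfl⟩
    exact ⟨d q, by simp⟩
  · rintro ⟨q, hq⟩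
    exact ⟨d.symm q, by simp [hq]⟩

section
variable {c r : ℝ} {f : E2 → E3} {A B : Set E3}

theorem Slot.shift (h : Slot c r f A B) (s : ℝ) :
    Slot (c + s) r (fun q => shDfm s (f ((shPlane s).symm q))) (sh (-s) ⁻¹' A) (sh (-s) ⁻¹' B) where
  hp := (h.hp.dfm_comp (shDfm s)).comp_dfm _
  closedA := h.closedA.preimage (sh_smooth _).continuous
  closedB := h.closedB.preimage (sh_smooth _).continuous
  cover p := h.cover _
  inter := by
    rw [← preimage_inter, h.inter]
    exact (range_dfm_comp (shDfm s) (shPlane s).symm).symm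
  stdA p hp := by
    rw [mem_preimage, h.stdA, sh_snd]
    rwa [sh_fst_snd, sh_snd, show p.1.2 + -s - c = p.1.2 - (c + s) by ring]
  stdB p hp := by
    rw [mem_preimage, h.stdB, sh_snd]
    rwa [sh_fst_snd, sh_snd, show p.1.2 + -s - c = p.1.2 - (c + s) by ring]
  stdf q hq := by
    have h1 : (shPlane s).symm q = (q.1, q.2 - s) := rfl
    rw [h1, h.stdf]
    · show sh s (incl _) = _
      simp [sh, incl]
    · rwa [show q.2 - s - c = q.2 - (c + s) by ring]

theorem Slot.half_turn (h : Slot c r f A B) :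
    Slot (-c) r (fun q => rotDfm (f (flipPlane q))) (rot ⁻¹' B) (rot ⁻¹' A) where
  hp := (h.hp.dfm_comp rotDfm).comp_dfm _
  closedA := h.closedB.preimage rot_smooth.continuous
  closedB := h.closedA.preimage rot_smooth.continuous
  cover p := (h.cover _).symm
  inter := by
    rw [← preimage_inter, inter_comm, h.inter]
    exact (range_dfm_comp rotDfm flipPlane).symm
  stdA p hp := by
    rw [mem_preimage, h.stdB]
    · simp [rot]
    · simp only [rot]
      rwa [abs_neg, show -p.1.2 - c = -(p.1.2 - -c) by ring, abs_neg]
  stdB p hp := by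
    rw [mem_preimage, h.stdA]
    · simp [rot]
    · simp only [rot]
      rwa [abs_neg, show -p.1.2 - c = -(p.1.2 - -c) by ring, abs_neg]
  stdf q hq := by
    have h1 : flipPlane q = (q.1, -q.2) := rfl
    rw [h1, h.stdf]
    · show rot (incl _) = _
      simp [rot, incl]
    · rwa [show -q.2 - c = -(q.2 - -c) by ring, abs_neg]
end

/-- Index of the block of length two around `c + 2 j` containing `y`. -/
noncomputable def blk (c y : ℝ) : ℤ := ⌊(y - c + 1) / 2⌋

theorem blk_le (c y : ℝ) : c + 2 * blk c y - 1 ≤ y := by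
  have := Int.floor_le ((y - c + 1) / 2)
  rw [blk]
  linarith

theorem lt_blk (c y : ℝ) : y < c + 2 * blk c y + 1 := by
  have := Int.lt_floor_add_one ((y - c + 1) / 2)
  rw [blk]
  linarith

theorem abs_sub_blk (c y : ℝ) : |y - (c + 2 * blk c y)| ≤ 1 := by
  have := blk_le c y
  have := lt_blk c y
  rw [abs_le]
  constructor <;> linarith

theorem blk_eq {c y : ℝ} {j : ℤ} (h : c + 2 * j - 1 ≤ y) (h' : y < c + 2 * j + 1) :
    blk c y = j := by
  rw [blk, Int.floor_eq_iff]
  constructor <;> linarith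

section
variable {c : ℝ} {S T : Set E3} {S' T' : ℤ → Set E3} {g g' : ℤ → E3 → E3}

theorem blocks_smooth (hg : ∀ j, ContDiffOn ℝ ∞ (g j) (S' j))
    (hid : ∀ (j : ℤ) w, 7 / 8 ≤ |w.1.2 - (c + 2 * j)| → w ∈ S' j → g j w = w)
    (hS : ∀ (j : ℤ) w, |w.1.2 - (c + 2 * j)| ≤ 1 → (w ∈ S ↔ w ∈ S' j)) :
    ContDiffOn ℝ ∞ (fun w : E3 => g (blk c w.1.2) w) S := by
  intro w hw
  have h1 := blk_le c w.1.2
  have h2 := lt_blk c w.1.2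
  set j := blk c w.1.2 with hj
  have hwj := (hS j w (abs_sub_blk _ _)).1 hw
  rcases h1.eq_or_lt with h1 | h1
  · refine contDiffWithinAt_id.congr_of_eventuallyEq (f := id) ?_ (hid j w ?_ hwj)
    · have : ∀ᶠ v : E3 in 𝓝 w, |v.1.2 - w.1.2| < 1 / 8 := by
        have h3 : Continuous fun v : E3 => |v.1.2 - w.1.2| := by fun_prop
        exact (h3.tendsto' w 0 (by simp)).eventually_lt_const (by norm_num)
      filter_upwards [self_mem_nhdsWithin, mem_nhdsWithin_of_mem_nhds this] with v hv hv'
      refine hid _ v ?_ ((hS _ v (abs_sub_blk _ _)).1 hv)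
      rw [abs_lt] at hv'
      rcases le_or_gt w.1.2 v.1.2 with h | h
      · rw [blk_eq (j := j) (by linarith) (by linarith), abs_of_neg (by linarith)]
        linarith
      · rw [blk_eq (j := j - 1) (by push_cast; linarith) (by push_cast; linarith),
          abs_of_pos (by push_cast; linarith)]
        push_cast
        linarith
    · rw [← h1, abs_of_neg (by linarith)]
      linarith
  · have hn : ∀ᶠ v : E3 in 𝓝 w, v.1.2 ∈ Ioo (c + 2 * j - 1) (c + 2 * j + 1) := by
      have h3 : Continuous fun v : E3 => v.1.2 := by fun_prop
      exact h3.continuousAt (isOpen_Ioo.mem_nhds ⟨h1, h2⟩)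
    have h4 : ContDiffWithinAt ℝ ∞ (g j) S w := by
      refine (hg j w hwj).mono_of_mem_nhdsWithin ?_
      filter_upwards [self_mem_nhdsWithin, mem_nhdsWithin_of_mem_nhds hn] with v hv hv'
      refine (hS j v ?_).1 hv
      rw [abs_le]
      constructor <;> linarith [hv'.1, hv'.2]
    refine h4.congr_of_eventuallyEq ?_ rfl
    filter_upwards [mem_nhdsWithin_of_mem_nhds hn] with v hv
    rw [blk_eq hv.1.le hv.2]

theorem blocks_maps (hg : ∀ j, IsSD (g j) (g' j) (S' j) (T' j))
    (hid : ∀ (j : ℤ) w, 7 / 8 ≤ |w.1.2 - (c + 2 * j)| → w ∈ S' j → g j w = w)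
    (hid' : ∀ (j : ℤ) w, 7 / 8 ≤ |w.1.2 - (c + 2 * j)| → w ∈ T' j → g' j w = w)
    (hS : ∀ (j : ℤ) w, |w.1.2 - (c + 2 * j)| ≤ 1 → (w ∈ S ↔ w ∈ S' j))
    (hT : ∀ (j : ℤ) w, |w.1.2 - (c + 2 * j)| ≤ 1 → (w ∈ T ↔ w ∈ T' j)) {w : E3} (hw : w ∈ S) :
    g (blk c w.1.2) w ∈ T ∧ blk c (g (blk c w.1.2) w).1.2 = blk c w.1.2 := by
  have h0 := abs_sub_blk c w.1.2
  set j := blk c w.1.2 with hj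
  have hwj := (hS j w h0).1 hw
  have hm := (hg j).maps hwj
  by_cases h : 7 / 8 ≤ |w.1.2 - (c + 2 * j)|
  · rw [hid j w h hwj] at hm ⊢
    exact ⟨(hT j w h0).2 hm, hj.symm⟩
  · have h3 : |(g j w).1.2 - (c + 2 * j)| < 7 / 8 := by
      by_contra h3
      have h4 := hid' j _ (not_lt.1 h3) hm
      rw [(hg j).left w hwj] at h4
      rw [← h4] at h3
      exact h (not_lt.1 h3)
    refine ⟨(hT j _ (by linarith)).2 hm, ?_⟩
    rw [abs_lt] at h3
    exact blk_eq (by linarith) (by linarith)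

theorem sd_of_blocks (hg : ∀ j, IsSD (g j) (g' j) (S' j) (T' j))
    (hid : ∀ (j : ℤ) w, 7 / 8 ≤ |w.1.2 - (c + 2 * j)| → w ∈ S' j → g j w = w)
    (hid' : ∀ (j : ℤ) w, 7 / 8 ≤ |w.1.2 - (c + 2 * j)| → w ∈ T' j → g' j w = w)
    (hS : ∀ (j : ℤ) w, |w.1.2 - (c + 2 * j)| ≤ 1 → (w ∈ S ↔ w ∈ S' j))
    (hT : ∀ (j : ℤ) w, |w.1.2 - (c + 2 * j)| ≤ 1 → (w ∈ T ↔ w ∈ T' j)) : SD S T := by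
  refine ⟨fun w => g (blk c w.1.2) w, fun w => g' (blk c w.1.2) w,
    blocks_smooth (fun j => (hg j).smooth) hid hS, blocks_smooth (fun j => (hg j).smooth') hid' hT,
    fun w hw => (blocks_maps hg hid hid' hS hT hw).1,
    fun w hw => (blocks_maps (fun j => (hg j).symm) hid' hid hT hS hw).1, fun w hw => ?_,
    fun w hw => ?_⟩
  · show g' (blk c (g (blk c w.1.2) w).1.2) _ = w
    rw [(blocks_maps hg hid hid' hS hT hw).2]
    exact (hg _).left w ((hS _ w (abs_sub_blk _ _)).1 hw)
  · show g (blk c (g' (blk c w.1.2) w).1.2) _ = w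
    rw [(blocks_maps (fun j => (hg j).symm) hid' hid hT hS hw).2]
    exact (hg _).right w ((hT _ w (abs_sub_blk _ _)).1 hw)
end

section
variable {f : E2 → E3} {A B : Set E3}

/-- The cancelling pair of a slot centred at `c`. -/
theorem Slot.isSD_at (h : Slot (1 / 2) (1 / 32) f A B) (c : ℝ) : ∃ g g' : E3 → E3,
    IsSD g g' (sh (-c) ⁻¹' twoSided A B) (HS E2) ∧ ∀ w : E3, 7 / 8 ≤ |w.1.2 - c| →
      (w ∈ sh (-c) ⁻¹' twoSided A B → g w = w) ∧ (w ∈ HS E2 → g' w = w) := by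
  obtain ⟨g, g', hg, hid⟩ := h.isSD
  have h1 : IsSD (shDfm (-c)) (shDfm (-c)).symm (sh (-c) ⁻¹' twoSided A B) (twoSided A B) :=
    Dfm.isSD _ fun _ => Iff.rfl
  have h2 : IsSD (shDfm c) (shDfm c).symm (HS E2) (HS E2) := Dfm.isSD _ fun _ => Iff.rfl
  refine ⟨_, _, (h1.trans hg).trans h2, fun w hw => ?_⟩
  have h3 : 3 / 4 ≤ (sh (-c) w).1.2 ^ 2 + (sh (-c) w).2 ^ 2 := by
    have : (7 / 8) ^ 2 ≤ |w.1.2 - c| ^ 2 := pow_le_pow_left₀ (by norm_num) hw 2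
    rw [sq_abs] at this
    simp only [sh_fst_snd, sh_snd]
    nlinarith [sq_nonneg w.2]
  have h4 : (shDfm c).symm w = sh (-c) w := rfl
  have h5 : shDfm (-c) w = sh (-c) w := rfl
  have h6 : shDfm c (sh (-c) w) = w := (shDfm c).apply_symm_apply w
  have h7 : (shDfm (-c)).symm (sh (-c) w) = w := (shDfm (-c)).symm_apply_apply w
  constructor
  · intro hm
    simp only [Function.comp_apply, h5, (hid _ h3).1 hm, h6]
  · intro hm
    simp only [Function.comp_apply, h4, (hid _ h3).2 hm, h7]

/-- The condition defining the infinite alternating region at the `n`-th slot. -/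
def serAt (A B : Set E3) (n : ℤ) (p : E3) : Prop :=
  if n < 0 then 0 ≤ p.2 else if Even n then sh (-n) p ∈ A else rot (sh (-n) p) ∈ B

/-- The infinite alternating region. -/
def ser (A B : Set E3) : Set E3 := {p | serAt A B (round p.1.2) p}

theorem Slot.serAt_std (h : Slot 0 (1 / 32) f A B) (n : ℤ) {p : E3} (hp : 1 / 32 < |p.1.2 - n|) :
    serAt A B n p ↔ 0 ≤ p.2 := by
  unfold serAt
  split_ifs
  · rfl
  · rw [h.stdA]
    · rfl
    · rw [sh_fst_snd, sub_zero, ← sub_eq_add_neg]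
      exact fun h' => hp.not_ge h'.1
  · rw [h.stdB]
    · simp [rot]
    · simp only [rot, sh_fst_snd, sub_zero, ← sub_eq_add_neg, abs_neg]
      exact fun h' => hp.not_ge h'.1

theorem Slot.mem_ser (h : Slot 0 (1 / 32) f A B) (n : ℤ) {p : E3} (hp : |p.1.2 - n| ≤ 1 / 2) :
    p ∈ ser A B ↔ serAt A B n p := by
  show serAt A B (round p.1.2) p ↔ _
  by_cases hr : round p.1.2 = n
  · rw [hr]
  · have h1 : (1 : ℝ) ≤ |(round p.1.2 : ℝ) - n| := by
      rw [← Int.cast_sub, ← Int.cast_abs]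
      exact_mod_cast Int.one_le_abs (sub_ne_zero.2 hr)
    have h2 := abs_sub_round p.1.2
    have h3 : |(round p.1.2 : ℝ) - n| ≤ |p.1.2 - round p.1.2| + |p.1.2 - n| := by
      rw [abs_sub_comm p.1.2 (round p.1.2 : ℝ)]
      exact abs_sub_le _ _ _
    rw [h.serAt_std _ (by linarith), h.serAt_std _ (by linarith)]

theorem Slot.mem_ser_pair (h : Slot 0 (1 / 32) f A B) {A₁ B₁ : Set E3} (n : ℤ)
    (hA : ∀ p, serAt A B (n + 1) p ↔ sh (-(n + 1 / 2)) p ∈ A₁)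
    (hB : ∀ p, serAt A B n p ↔ rot (sh (-(n + 1 / 2)) p) ∈ B₁) {p : E3}
    (hp : |p.1.2 - (n + 1 / 2)| ≤ 1) :
    p ∈ ser A B ↔ p ∈ sh (-(n + 1 / 2)) ⁻¹' twoSided A₁ B₁ := by
  have hp := abs_le.1 hp
  simp only [twoSided, mem_preimage, mem_ofPred_eq, sh_fst_snd, sh_snd, ← sub_eq_add_neg]
  rcases lt_trichotomy (p.1.2 - (n + 1 / 2)) 0 with h1 | h1 | h1
  · simp only [h1, h1.ne, not_lt_of_gt h1, false_imp_iff, true_imp_iff, true_and, and_true, ← hB]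
    exact h.mem_ser n (by rw [abs_le]; constructor <;> linarith)
  · simp only [h1, lt_irrefl, false_imp_iff, true_imp_iff, true_and]
    rw [h.mem_ser n (by rw [show p.1.2 - n = 1 / 2 by linarith]; norm_num), h.serAt_std n
      (by rw [show p.1.2 - n = 1 / 2 by linarith]; norm_num)]
  · simp only [h1, h1.ne', not_lt_of_gt h1, false_imp_iff, true_imp_iff, and_true, ← hA]
    exact h.mem_ser (n + 1) (by push_cast; rw [abs_le]; constructor <;> linarith)

theorem Slot.sd_HS (h : Slot 0 (1 / 32) f A B) : SD A (HS E2) := by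
  have hodd := h.shift (1 / 2)
  have heven := h.half_turn.shift (1 / 2)
  rw [zero_add] at hodd
  rw [neg_zero, zero_add] at heven
  have hp1 : ∀ (n : ℤ), 0 ≤ n → Odd n → ∀ p : E3, |p.1.2 - (n + 1 / 2)| ≤ 1 →
      (p ∈ ser A B ↔ p ∈ sh (-(n + 1 / 2)) ⁻¹' twoSided (sh (-(1 / 2)) ⁻¹' A)
        (sh (-(1 / 2)) ⁻¹' B)) := by
    intro n hn hn' p hp
    refine h.mem_ser_pair n (fun p => ?_) (fun p => ?_) hp
    · simp only [serAt, not_lt.2 (show 0 ≤ n + 1 by omega), hn'.add_one, if_true, if_false,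
        mem_preimage]
      refine iff_of_eq (congrArg (· ∈ A) ?_)
      simp only [sh]
      push_cast
      ring_nf
    · simp only [serAt, not_lt.2 hn, Int.not_even_iff_odd.2 hn', if_false, mem_preimage]
      refine iff_of_eq (congrArg (· ∈ B) ?_)
      simp only [sh, rot]
      ring_nf
  have hp2 : ∀ (n : ℤ), 0 ≤ n → Even n → ∀ p : E3, |p.1.2 - (n + 1 / 2)| ≤ 1 →
      (p ∈ ser A B ↔ p ∈ sh (-(n + 1 / 2)) ⁻¹' twoSided (sh (-(1 / 2)) ⁻¹' (rot ⁻¹' B))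
        (sh (-(1 / 2)) ⁻¹' (rot ⁻¹' A))) := by
    intro n hn hn' p hp
    refine h.mem_ser_pair n (fun p => ?_) (fun p => ?_) hp
    · simp only [serAt, not_lt.2 (show 0 ≤ n + 1 by omega), Int.not_even_iff_odd.2 hn'.add_one,
        if_false, mem_preimage]
      refine iff_of_eq (congrArg (· ∈ B) ?_)
      simp only [sh, rot]
      push_cast
      ring_nf
    · simp only [serAt, not_lt.2 hn, hn', if_true, if_false, mem_preimage]
      refine iff_of_eq (congrArg (· ∈ A) ?_)
      simp only [sh, rot]
      ring_nf
  have hid : ∀ S : Set E3, IsSD id id S S := fun S =>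
    ⟨contDiffOn_id, contDiffOn_id, fun _ h => h, fun _ h => h, fun _ _ => rfl, fun _ _ => rfl⟩
  have h1 : SD (ser A B) (HS E2) := by
    have : ∀ j : ℤ, ∃ (g g' : E3 → E3) (S' : Set E3), IsSD g g' S' (HS E2) ∧
        (∀ w : E3, 7 / 8 ≤ |w.1.2 - (1 / 2 + 2 * j)| →
          (w ∈ S' → g w = w) ∧ (w ∈ HS E2 → g' w = w)) ∧
        ∀ w : E3, |w.1.2 - (1 / 2 + 2 * j)| ≤ 1 → (w ∈ ser A B ↔ w ∈ S') := by
      intro j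
      by_cases hj : 0 ≤ j
      · obtain ⟨g, g', hg, hi⟩ := heven.isSD_at ((2 * j : ℤ) + 1 / 2)
        have hc : (((2 * j : ℤ) : ℝ) + 1 / 2) = 1 / 2 + 2 * j := by push_cast; ring
        have hm := hp2 (2 * j) (by omega) (even_two_mul j)
        rw [hc] at hg hi hm
        exact ⟨g, g', _, hg, hi, hm⟩
      · refine ⟨id, id, HS E2, hid _, fun _ _ => ⟨fun _ => rfl, fun _ => rfl⟩, fun w hw => ?_⟩
        have hj' : (j : ℝ) ≤ -1 := by exact_mod_cast (show j ≤ -1 by omega)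
        have hw := abs_le.1 hw
        rcases (show w.1.2 ≤ -(1 / 2) by linarith).lt_or_eq with h0 | h0
        · have hr : round w.1.2 < 0 := by
            rw [round_eq, Int.floor_lt]
            push_cast
            linarith
          show serAt A B (round w.1.2) w ↔ _
          simp only [serAt, hr, if_true]
          rfl
        · rw [h.mem_ser (-1) (by rw [h0]; norm_num)]
          simp only [serAt, show (-1 : ℤ) < 0 by decide, if_true]
          rfl
    choose g g' S' hg hi hm using this
    exact sd_of_blocks hg (fun j w hw => (hi j w hw).1) (fun j w hw => (hi j w hw).2) hm
      fun _ _ _ => Iff.rfl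
  have h2 : SD (ser A B) A := by
    have : ∀ j : ℤ, ∃ (g g' : E3 → E3) (S' T' : Set E3), IsSD g g' S' T' ∧
        (∀ w : E3, 7 / 8 ≤ |w.1.2 - (3 / 2 + 2 * j)| →
          (w ∈ S' → g w = w) ∧ (w ∈ T' → g' w = w)) ∧
        ∀ w : E3, |w.1.2 - (3 / 2 + 2 * j)| ≤ 1 → (w ∈ ser A B ↔ w ∈ S') ∧ (w ∈ A ↔ w ∈ T') := by
      intro j
      by_cases hj : 0 ≤ j
      · obtain ⟨g, g', hg, hi⟩ := hodd.isSD_at ((2 * j + 1 : ℤ) + 1 / 2)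
        have hc : (((2 * j + 1 : ℤ) : ℝ) + 1 / 2) = 3 / 2 + 2 * j := by push_cast; ring
        have hm := hp1 (2 * j + 1) (by omega) (odd_two_mul_add_one j)
        rw [hc] at hg hi hm
        refine ⟨g, g', _, _, hg, hi, fun w hw => ⟨hm w hw, h.stdA w fun h' => ?_⟩⟩
        have hj' : (0 : ℝ) ≤ j := by exact_mod_cast hj
        linarith [(abs_le.1 hw).1, (abs_le.1 h'.1).2]
      · refine ⟨id, id, A, A, hid _, fun _ _ => ⟨fun _ => rfl, fun _ => rfl⟩,
          fun w hw => ⟨?_, Iff.rfl⟩⟩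
        have hj' : (j : ℝ) ≤ -1 := by exact_mod_cast (show j ≤ -1 by omega)
        have hw := abs_le.1 hw
        by_cases h0 : -(1 / 2) ≤ w.1.2
        · rw [h.mem_ser 0 (by rw [abs_le]; push_cast; constructor <;> linarith)]
          have : sh (-((0 : ℤ) : ℝ)) w = w := by simp [sh]
          rw [serAt, if_neg (lt_irrefl _), if_pos Even.zero, this]
        · have hr : round w.1.2 < 0 := by
            rw [round_eq, Int.floor_lt]
            push_cast
            linarith
          rw [h.stdA w fun h' => by linarith [(abs_le.1 h'.1).1]]
          show serAt A B (round w.1.2) w ↔ _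
          simp only [serAt, hr, if_true]
    choose g g' S' T' hg hi hm using this
    exact sd_of_blocks hg (fun j w hw => (hi j w hw).1) (fun j w hw => (hi j w hw).2)
      (fun j w hw => (hm j w hw).1) fun j w hw => (hm j w hw).2
  exact h2.symm.trans h1

theorem Slot.sd_HS' (h : Slot 0 (1 / 32) f A B) : SD B (HS E2) := by
  have h1 := h.half_turn
  rw [neg_zero] at h1
  exact (rotDfm.sd fun p => by
    show p ∈ B ↔ rot (rot p) ∈ B
    rw [rot_rot]).trans h1.sd_HS
end

theorem exists_smooth_primitive {F : Type} [NormedAddCommGroup F] [NormedSpace ℝ F]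
    [CompleteSpace F] {g : ℝ → F} (hg : ContDiff ℝ ∞ g) (c : F) :
    ∃ G : ℝ → F, ContDiff ℝ ∞ G ∧ (∀ t, HasDerivAt G (g t) t) ∧ G 0 = c := by
  have h : ∀ t, HasDerivAt (fun t => c + ∫ s in (0 : ℝ)..t, g s) (g t) t := fun t =>
    (intervalIntegral.integral_hasDerivAt_right (hg.continuous.intervalIntegrable _ _)
      hg.continuous.stronglyMeasurable.stronglyMeasurableAtFilter
      hg.continuous.continuousAt).const_add c
  refine ⟨_, contDiff_infty_iff_deriv.2 ⟨fun t => (h t).differentiableAt, ?_⟩, h, by simp⟩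
  rwa [show deriv (fun t => c + ∫ s in (0 : ℝ)..t, g s) = g from funext fun t => (h t).deriv]

/-- Smooth polar coordinates along a curve avoiding the origin. -/
theorem exists_polar {σ : ℝ → E2} (hσ : ContDiff ℝ ∞ σ) (h0 : ∀ t, σ t ≠ 0) :
    ∃ ς θ : ℝ → ℝ, ContDiff ℝ ∞ ς ∧ ContDiff ℝ ∞ θ ∧ (∀ t, 0 < ς t) ∧
      ∀ t, σ t = (ς t * Real.cos (θ t), ς t * Real.sin (θ t)) := by
  set w : ℝ → ℂ := fun t => Complex.equivRealProdCLM.symm (σ t) with hw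
  have hws : ContDiff ℝ ∞ w := Complex.equivRealProdCLM.symm.contDiff.comp hσ
  have hw0 : ∀ t, w t ≠ 0 := fun t h => h0 t (by simpa [hw] using h)
  have hwd : ContDiff ℝ ∞ (deriv w) := (contDiff_infty_iff_deriv.1 hws).2
  obtain ⟨l, hls, hl, hl0⟩ := exists_smooth_primitive (hwd.mul (hws.inv hw0)) (Complex.log (w 0))
  have hc : ∀ t, w t * Complex.exp (-l t) = w 0 * Complex.exp (-l 0) := fun t => by
    refine is_const_of_deriv_eq_zero (f := fun t => w t * Complex.exp (-l t)) (fun t => ?_)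
      (fun t => ?_) t 0
    · exact ((hws.differentiable (by simp)).mul
        (hls.differentiable (by simp)).neg.cexp) t
    · have h1 : HasDerivAt w (deriv w t) t := ((hws.differentiable (by simp)) t).hasDerivAt
      have h2 := h1.mul (hl t).neg.cexp
      rw [show deriv (fun t => w t * Complex.exp (-l t)) t = _ from h2.deriv]
      have := hw0 t
      simp only [Pi.inv_apply, Pi.neg_apply]
      field_simp
      ring
  have he : ∀ t, w t = Complex.exp (l t) := fun t => by
    have := hc t
    rw [hl0, Complex.exp_neg, Complex.exp_neg, Complex.exp_log (hw0 0), mul_inv_cancel₀ (hw0 0),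
      mul_inv_eq_one₀ (Complex.exp_ne_zero _)] at this
    exact this
  have hre : ContDiff ℝ ∞ fun t => (l t).re := Complex.reCLM.contDiff.comp hls
  refine ⟨fun t => Real.exp (l t).re, fun t => (l t).im, hre.exp,
    Complex.imCLM.contDiff.comp hls, fun t => Real.exp_pos _, fun t => ?_⟩
  have h1 : σ t = ((w t).re, (w t).im) := by simp [hw]
  rw [h1, he, Complex.exp_re, Complex.exp_im]

/-- The inverse of the squeezing function. -/
noncomputable def usq (z : ℝ) : ℝ := z / √(1 - z ^ 2)

theorem usq_sqz (t : ℝ) : usq (sqz t) = t := by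
  have h : 0 < 1 + t ^ 2 := by positivity
  have h1 : 1 - sqz t ^ 2 = (√(1 + t ^ 2))⁻¹ ^ 2 := by
    rw [sqz, div_pow, inv_pow, Real.sq_sqrt h.le]
    field_simp
    ring
  rw [usq, h1, Real.sqrt_sq (by positivity), sqz]
  have := (Real.sqrt_pos.2 h).ne'
  field_simp

theorem sqz_usq {z : ℝ} (hz : |z| < 1) : sqz (usq z) = z := by
  have h : 0 < 1 - z ^ 2 := by
    have := (sq_lt_one_iff_abs_lt_one z).2 hz
    linarith
  have h1 : 1 + usq z ^ 2 = (√(1 - z ^ 2))⁻¹ ^ 2 := by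
    rw [usq, div_pow, inv_pow, Real.sq_sqrt h.le]
    field_simp
    ring
  rw [sqz, h1, Real.sqrt_sq (by positivity), usq]
  have := (Real.sqrt_pos.2 h).ne'
  field_simp

theorem usq_smooth {z : ℝ} (hz : |z| < 1) : ContDiffAt ℝ ∞ usq z := by
  have h : 0 < 1 - z ^ 2 := by
    have := (sq_lt_one_iff_abs_lt_one z).2 hz
    linarith
  exact contDiffAt_id.div (ContDiffAt.sqrt (by fun_prop) h.ne') (Real.sqrt_pos.2 h).ne'

theorem lt_usq {z t : ℝ} (hz : |z| < 1) (h : sqz t < z) : t < usq z := by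
  rw [← sqz_usq hz] at h
  exact sqz_strictMono.lt_iff_lt.1 h

open Real in
/-- A level-dependent function which vanishes on larger and larger sets as the level tends to
one. -/
noncomputable def lev (m s : ℝ → ℝ) (q : E3 → ℝ) (w : E3) : ℝ :=
  if |w.2| < 1 then smoothTransition (2 * w.2 + 1) * m (usq w.2) *
    smoothTransition (2 * (q w / s (usq w.2)) - 1) else 0

section
variable {m s : ℝ → ℝ} {q : E3 → ℝ}

theorem lev_of_le {w : E3} (h : 1 ≤ |w.2|) : lev m s q w = 0 := if_neg h.not_gt

theorem lev_sqz {w : E3} {t : ℝ} (ht : 0 ≤ t) (hw : w.2 = sqz t) (hs : 0 < s t)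
    (hq : s t ≤ q w) : lev m s q w = m t := by
  have h0 : 0 ≤ sqz t := by simpa using sqz_strictMono.monotone ht
  rw [lev, hw, if_pos (sqz_lt t), usq_sqz, Real.smoothTransition.one_of_one_le (by linarith),
    Real.smoothTransition.one_of_one_le, one_mul, mul_one]
  have := (one_le_div hs).2 hq
  linarith

theorem lev_smooth (hm : ContDiff ℝ ∞ m) (hs : ContDiff ℝ ∞ s) (hpos : ∀ t, 0 < s t)
    (hlim : Tendsto s atTop atTop) (hq : ContDiff ℝ ∞ q) : ContDiff ℝ ∞ (lev m s q) := by
  rw [contDiff_iff_contDiffAt]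
  intro w
  have hc2 : Continuous fun v : E3 => v.2 := continuous_snd
  rcases lt_or_ge w.2 (-(1 / 2)) with h | h
  · refine contDiffAt_const (c := (0 : ℝ)) |>.congr_of_eventuallyEq ?_
    filter_upwards [hc2.continuousAt.eventually_lt continuousAt_const h] with v hv
    rw [lev, Real.smoothTransition.zero_of_nonpos (by linarith)]
    simp
  rcases lt_or_ge w.2 1 with h1 | h1
  · have ha : |w.2| < 1 := abs_lt.2 ⟨by linarith, h1⟩
    have hu : ContDiffAt ℝ ∞ (fun v : E3 => usq v.2) w :=
      ContDiffAt.comp (g := usq) w (usq_smooth ha) contDiffAt_snd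
    have h2 : ContDiffAt ℝ ∞ (fun v : E3 => m (usq v.2)) w := hm.contDiffAt.comp w hu
    have h3 : ContDiffAt ℝ ∞ (fun v : E3 => s (usq v.2)) w := hs.contDiffAt.comp w hu
    have h4 : ContDiffAt ℝ ∞ (fun v : E3 => 2 * (q v / s (usq v.2)) - 1) w :=
      (contDiffAt_const.mul (hq.contDiffAt.div h3 (hpos _).ne')).sub contDiffAt_const
    have h5 : ContDiffAt ℝ ∞ (fun v : E3 => 2 * v.2 + 1) w := by fun_prop
    have h6 := ((Real.smoothTransition.contDiff (n := ⊤)).contDiffAt.comp w h5).mul h2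
      |>.mul ((Real.smoothTransition.contDiff (n := ⊤)).contDiffAt.comp w h4)
    refine h6.congr_of_eventuallyEq ?_
    filter_upwards [hc2.abs.continuousAt.eventually_lt continuousAt_const ha] with v hv
    rw [lev, if_pos hv]
    rfl
  · refine contDiffAt_const (c := (0 : ℝ)) |>.congr_of_eventuallyEq ?_
    obtain ⟨T, hT⟩ := (hlim.eventually_ge_atTop (2 * (q w + 1))).exists_forall_of_atTop
    have hT1 : sqz T < w.2 := (abs_lt.1 (sqz_lt T)).2.trans_le h1
    filter_upwards [hq.continuous.continuousAt.eventually_lt continuousAt_const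
      (show q w < q w + 1 by linarith), continuousAt_const.eventually_lt hc2.continuousAt hT1]
      with v hv hv'
    by_cases hv1 : |v.2| < 1
    · have h2 := hT _ (lt_usq hv1 hv').le
      have h3 : q v / s (usq v.2) ≤ 1 / 2 := by
        rw [div_le_iff₀ (hpos _)]
        linarith
      rw [lev, Real.smoothTransition.zero_of_nonpos (x := 2 * (q v / s (usq v.2)) - 1)
        (by linarith)]
      simp
    · rw [lev, if_neg hv1]
end

/-- Rotation of the horizontal planes by the angle function `α`. -/
noncomputable def turn (α : E3 → ℝ) (w : E3) : E3 :=
  ((w.1.1 * Real.cos (α w) - w.1.2 * Real.sin (α w),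
    w.1.1 * Real.sin (α w) + w.1.2 * Real.cos (α w)), w.2)

theorem turn_turn {α β : E3 → ℝ} {w : E3} (h : α (turn β w) = -β w) : turn α (turn β w) = w := by
  have hsc := Real.sin_sq_add_cos_sq (β w)
  rw [turn, h, Real.cos_neg, Real.sin_neg]
  refine Prod.ext (Prod.ext ?_ ?_) rfl
  · simp only [turn]
    linear_combination w.1.1 * hsc
  · simp only [turn]
    linear_combination w.1.2 * hsc

theorem turn_smooth {α : E3 → ℝ} (h : ContDiff ℝ ∞ α) : ContDiff ℝ ∞ (turn α) := by
  have h1 := h.cos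
  have h2 := h.sin
  unfold turn
  fun_prop

theorem turn_sq (α : E3 → ℝ) (w : E3) :
    (turn α w).1.1 ^ 2 + (turn α w).1.2 ^ 2 = w.1.1 ^ 2 + w.1.2 ^ 2 := by
  have hsc := Real.sin_sq_add_cos_sq (α w)
  simp only [turn]
  linear_combination (w.1.1 ^ 2 + w.1.2 ^ 2) * hsc

theorem exists_turn_dfm {α : E3 → ℝ} (h : ContDiff ℝ ∞ α)
    (hinv : ∀ β w, α (turn β w) = α w) : ∃ D : Dfm E3 E3, ∀ w, D w = turn (fun w => -α w) w :=
  ⟨⟨⟨turn fun w => -α w, turn α, fun w => turn_turn (by rw [hinv, neg_neg]),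
    fun w => turn_turn (by rw [hinv])⟩, turn_smooth h.neg, turn_smooth h⟩, fun _ => rfl⟩

theorem exists_stretch_dfm {F : E3 → ℝ} (h : ContDiff ℝ ∞ F) (h0 : ∀ w, 0 ≤ F w)
    (hmono : ∀ y z, Monotone fun x => F ((x, y), z)) (hb : ∀ y z, ∃ b, ∀ x, F ((x, y), z) ≤ b) :
    ∃ D : Dfm E3 E3, ∀ w, D w = ((w.1.1 + F w, w.1.2), w.2) := by
  have hc : ContDiff ℝ ∞ fun v : E3 => v.2 + F ((v.2, v.1.2), v.1.1) := by fun_prop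
  obtain ⟨d, hd⟩ := exists_dfm_of_mono (E := E2) _ hc
    (by
      rintro ⟨e, s⟩
      have h1 := hasDerivAt_slice hc e s
      have h2 : HasDerivAt (fun s => F ((s, e.2), e.1))
          (fderiv ℝ (fun v : E3 => v.2 + F ((v.2, v.1.2), v.1.1)) (e, s) (0, 1) - 1) s := by
        have := h1.sub (hasDerivAt_id s)
        refine this.congr_of_eventuallyEq (Eventually.of_forall fun t => ?_)
        simp
      have h3 := (hmono e.2 e.1).deriv_nonneg (x := s)
      rw [h2.deriv] at h3
      linarith)
    (by
      intro e y
      obtain ⟨b, hb⟩ := hb e.2 e.1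
      have := mem_range_of_exists_le_of_exists_ge (c := y)
        (f := fun s => s + F ((s, e.2), e.1)) (hc.continuous.comp (f := fun s => (e, s))
          (by fun_prop)) ⟨y - b, by linarith [hb (y - b)]⟩ ⟨y, by linarith [h0 ((y, e.2), e.1)]⟩
      exact this)
  refine ⟨((Dfm.ofCLE κ13).trans d).trans (Dfm.ofCLE κ13), fun w => ?_⟩
  simp [hd]

/-- A smooth curve which restricts to a proper embedding of the half line. -/
structure PRay {V : Type} [NormedAddCommGroup V] [NormedSpace ℝ V] (σ : ℝ → V) : Prop where
  smooth : ContDiff ℝ ∞ σ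
  inj : InjOn σ (Ici 0)
  deriv_ne : ∀ t, 0 ≤ t → deriv σ t ≠ 0
  proper : Tendsto (fun t => ‖σ t‖) atTop atTop

theorem PRay.isClosed_image {σ : ℝ → E2} (h : PRay σ) {C : Set ℝ} (hC : IsClosed C)
    (hC0 : C ⊆ Ici 0) : IsClosed (σ '' C) := by
  rw [← isOpen_compl_iff, isOpen_iff_mem_nhds]
  intro x hx
  obtain ⟨T, hT⟩ := (h.proper.eventually_ge_atTop (‖x‖ + 1)).exists_forall_of_atTop
  have h1 : IsCompact (σ '' (C ∩ Icc 0 T)) :=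
    (isCompact_Icc.inter_left hC).image h.smooth.continuous
  have h2 : (σ '' (C ∩ Icc 0 T))ᶜ ∈ 𝓝 x := h1.isClosed.isOpen_compl.mem_nhds
    fun ⟨t, ht, hx'⟩ => hx ⟨t, ht.1, hx'⟩
  have h3 : ∀ᶠ y in 𝓝 x, ‖y‖ < ‖x‖ + 1 :=
    continuous_norm.continuousAt.eventually_lt continuousAt_const (by linarith)
  filter_upwards [h2, h3] with y hy hy' ⟨t, ht, hty⟩
  rcases le_or_gt t T with h4 | h4
  · exact hy ⟨t, ⟨ht, hC0 ht, h4⟩, hty⟩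
  · have := hT t h4.le
    rw [hty] at this
    linarith

theorem PRay.exists_height {σ : ℝ → E2} (h : PRay σ) : ∃ φ : E2 → ℝ, ContDiff ℝ ∞ φ ∧
    (∀ q, |φ q| ≤ 1) ∧ ∀ t, 0 ≤ t → φ (σ t) = sqz t := by
  obtain ⟨φ, hφ, hφ'⟩ := exists_smooth_mem_convex
    (fun x : E2 => {y : ℝ | y ∈ Icc (-1 : ℝ) 1 ∧ ∀ t, 0 ≤ t → σ t = x → y = sqz t})
    (fun x y hy z hz a b ha hb hab => ⟨convex_Icc _ _ hy.1 hz.1 ha hb hab, fun t ht hx => by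
      rw [hy.2 t ht hx, hz.2 t ht hx, ← add_smul, hab, one_smul]⟩)
    (fun x => by
      by_cases hx : x ∈ σ '' Ici 0
      swap
      · refine ⟨_, (h.isClosed_image isClosed_Ici subset_rfl).isOpen_compl.mem_nhds hx, fun _ => 0,
          contDiffOn_const, fun y hy => ⟨by constructor <;> norm_num, fun t ht hty => ?_⟩⟩
        exact absurd ⟨t, ht, hty⟩ hy
      obtain ⟨t₀, ht₀, rfl⟩ := hx
      have hd : HasDerivAt σ (deriv σ t₀) t₀ :=
        (h.smooth.differentiable (by simp) t₀).hasDerivAt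
      obtain ⟨l, hl⟩ : ∃ l : E2 →L[ℝ] ℝ, l (deriv σ t₀) ≠ 0 := by
        by_contra! hl
        exact h.deriv_ne t₀ ht₀ (Prod.ext (hl (.fst ℝ ℝ ℝ)) (hl (.snd ℝ ℝ ℝ)))
      have hus : ContDiff ℝ ∞ fun t => l (σ t) := l.contDiff.comp h.smooth
      have hud : HasDerivAt (fun t => l (σ t)) (l (deriv σ t₀)) t₀ :=
        l.hasFDerivAt.comp_hasDerivAt t₀ hd
      set e := hus.contDiffAt.toOpenPartialHomeomorph _ (hud.hasFDerivAt_equiv hl) (by simp)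
      have he : ∀ t, e t = l (σ t) := fun t => rfl
      have hes : t₀ ∈ e.source :=
        hus.contDiffAt.mem_toOpenPartialHomeomorph_source (hud.hasFDerivAt_equiv hl) (by simp)
      have hdc : Continuous (deriv fun t => l (σ t)) := hus.continuous_deriv (by simp)
      have het : e.target ∩ e.symm ⁻¹' {t | deriv (fun t => l (σ t)) t ≠ 0} ∈ 𝓝 (l (σ t₀)) := by
        refine (e.isOpen_inter_preimage_symm (isOpen_ne_fun hdc continuous_const)).mem_nhds
          ⟨e.map_source hes, ?_⟩
        show deriv _ (e.symm (e t₀)) ≠ 0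
        rw [e.left_inv hes, hud.deriv]
        exact hl
      have hCl : IsClosed (σ '' (Ici 0 ∩ e.sourceᶜ)) :=
        h.isClosed_image (isClosed_Ici.inter e.open_source.isClosed_compl) inter_subset_left
      refine ⟨_, inter_mem (hCl.isOpen_compl.mem_nhds ?_) (l.continuous.continuousAt het),
        fun y => sqz (e.symm (l y)), fun y hy => ?_, fun y hy => ⟨?_, fun t ht hty => ?_⟩⟩
      · rintro ⟨t, ht, hx⟩
        exact ht.2 (h.inj ht.1 ht₀ hx ▸ hes)
      · have h1 : ContDiffAt ℝ ∞ e.symm (l y) := e.contDiffAt_symm_deriv hy.2.2 hy.2.1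
          ((hus.differentiable (by simp) _).hasDerivAt) hus.contDiffAt
        exact (sqz_smooth.contDiffAt.comp y (h1.comp y l.contDiff.contDiffAt)).contDiffWithinAt
      · exact abs_le.1 (sqz_lt _).le
      · have h1 : t ∈ e.source := by
          by_contra h1
          exact hy.1 ⟨t, ⟨ht, h1⟩, hty⟩
        show sqz (e.symm (l y)) = sqz t
        rw [← hty, ← he, e.left_inv h1])
  exact ⟨φ, hφ, fun q => abs_le.2 (hφ' q).1, fun t ht => (hφ' _).2 t ht rfl⟩

/-- A vertical shear with bounded vertical support raising the plane to a given graph. -/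
theorem exists_upshear {φ : E2 → ℝ} (hφ : ContDiff ℝ ∞ φ) (hb : ∀ q, |φ q| ≤ 1) :
    ∃ (U : Dfm E3 E3) (K : ℝ), (∀ q, U (q, 0) = (q, φ q)) ∧ ∀ w, K ≤ |w.2| → U w = w := by
  obtain ⟨g, hg, ⟨V, -, hV, hV1⟩, hgt, hgI⟩ := exists_smooth_one_nhds_of_subset (E := ℝ) (Z := {0})
    (O := Ioo (-1) 1) isClosed_singleton isOpen_Ioo (by simp)
  have hg0 : g 0 = 1 := hV1 0 (hV rfl)
  have hgc : HasCompactSupport g :=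
    isCompact_Icc.of_isClosed_subset (isClosed_tsupport g) (hgt.trans Ioo_subset_Icc_self)
  obtain ⟨M, hM⟩ := (hg.continuous_deriv (by simp)).bounded_above_of_compact_support hgc.deriv
  have hM0 : 0 ≤ M := (norm_nonneg _).trans (hM 0)
  have hK : 0 < 2 * M + 2 := by linarith
  have hc : ContDiff ℝ ∞ fun w : E3 => w.2 + φ w.1 * g (w.2 / (2 * M + 2)) := by fun_prop
  have hb' : ∀ q s, |φ q * g s| ≤ 1 := fun q s => by
    rw [abs_mul, abs_of_nonneg (hgI s).1]
    exact mul_le_one₀ (hb q) (hgI s).1 (hgI s).2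
  obtain ⟨U, hU⟩ := exists_dfm_of_mono (E := E2) _ hc
    (by
      rintro ⟨q, s⟩
      have h1 := hasDerivAt_slice hc q s
      have h2 : HasDerivAt (fun s => s + φ q * g (s / (2 * M + 2)))
          (1 + φ q * (deriv g (s / (2 * M + 2)) * (1 / (2 * M + 2)))) s :=
        (hasDerivAt_id s).add ((((hg.differentiable (by simp) _).hasDerivAt).comp s
          ((hasDerivAt_id s).div_const _)).const_mul _)
      rw [h1.unique h2]
      have h3 : |φ q * (deriv g (s / (2 * M + 2)) * (1 / (2 * M + 2)))| ≤ 1 / 2 := by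
        rw [abs_mul, abs_mul, abs_of_pos (one_div_pos.2 hK), mul_one_div]
        have h4 : |deriv g (s / (2 * M + 2))| / (2 * M + 2) ≤ 1 / 2 := by
          rw [div_le_iff₀ hK]
          have := hM (s / (2 * M + 2))
          rw [Real.norm_eq_abs] at this
          linarith
        have h5 : 0 ≤ |deriv g (s / (2 * M + 2))| / (2 * M + 2) := by positivity
        nlinarith [hb q, abs_nonneg (φ q)]
      linarith [(abs_le.1 h3).1])
    (by
      intro q y
      have := mem_range_of_exists_le_of_exists_ge (c := y)
        (f := fun s => s + φ q * g (s / (2 * M + 2))) (hc.continuous.comp (f := fun s => (q, s))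
          (by fun_prop)) ⟨y - 1, by linarith [(abs_le.1 (hb' q ((y - 1) / (2 * M + 2)))).2]⟩
            ⟨y + 1, by linarith [(abs_le.1 (hb' q ((y + 1) / (2 * M + 2)))).1]⟩
      exact this)
  refine ⟨U, 2 * M + 2, fun q => by simp [hU, hg0], fun w hw => ?_⟩
  have : g (w.2 / (2 * M + 2)) = 0 := by
    refine image_eq_zero_of_notMem_tsupport fun h => ?_
    have h1 := abs_lt.2 (hgt h)
    rw [abs_div, abs_of_pos hK, div_lt_one hK] at h1
    linarith
  rw [hU, this]
  simp

theorem exists_dfm_of_one_le_deriv {r r' : ℝ → ℝ} (hr : ContDiff ℝ ∞ r)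
    (hd : ∀ t, HasDerivAt r (r' t) t) (h1 : ∀ t, 1 ≤ r' t) :
    (∃ d : Dfm ℝ ℝ, ∀ t, d t = r t) ∧ StrictMono r := by
  have hm : StrictMono r := strictMono_of_deriv_pos fun t => by
    rw [(hd t).deriv]
    linarith [h1 t]
  have hm' : Monotone fun t => r t - t := monotone_of_deriv_nonneg
    (fun t => ((hd t).sub (hasDerivAt_id t)).differentiableAt) fun t => by
      have := ((hd t).sub (hasDerivAt_id t)).deriv
      rw [show deriv (fun t => r t - t) t = _ from this]
      linarith [h1 t]
  refine ⟨exists_dfm_of_bijective r hr ⟨hm.injective, fun y => ?_⟩ fun t =>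
    ⟨_, (hd t).hasFDerivAt_equiv (by linarith [h1 t] : (0 : ℝ) < r' t).ne'⟩, hm⟩
  refine mem_range_of_exists_le_of_exists_ge hr.continuous ⟨min 0 (y - r 0), ?_⟩
    ⟨max 0 (y - r 0), ?_⟩
  · have := hm' (min_le_left 0 (y - r 0))
    have := min_le_right 0 (y - r 0)
    simp only [sub_zero] at *
    linarith
  · have := hm' (le_max_left 0 (y - r 0))
    have := le_max_right 0 (y - r 0)
    simp only [sub_zero] at *
    linarith

theorem Dfm.image_eq {E F : Type} [NormedAddCommGroup E] [NormedSpace ℝ E]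
    [NormedAddCommGroup F] [NormedSpace ℝ F] (d : Dfm E F) {S : Set E} {T : Set F}
    (h1 : ∀ x ∈ S, d x ∈ T) (h2 : ∀ y ∈ T, d.symm y ∈ S) : d '' S = T := by
  refine Subset.antisymm (image_subset_iff.2 h1) fun y hy => ⟨_, h2 y hy, by simp⟩

theorem exists_ray_exchange_of_ne_zero {σ : ℝ → E2} (h : PRay σ) (h0 : ∀ t, σ t ≠ 0) :
    ∃ (Θ : Dfm E3 E3) (C c : ℝ), (∀ p, C ≤ |p.2| → Θ p = p) ∧
      Θ '' ((fun t => (σ t, (0 : ℝ))) '' Ici 0) = {p | p.2 = 0 ∧ p.1.2 = 0 ∧ c ≤ p.1.1} := by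
  obtain ⟨ς, θ, hς, hθ, hpos, hpol⟩ := exists_polar h.smooth h0
  have hςlim : Tendsto ς atTop atTop := by
    refine tendsto_atTop_mono (fun t => ?_) h.proper
    rw [hpol, Prod.norm_mk, sup_le_iff, norm_mul, norm_mul, Real.norm_eq_abs, Real.norm_eq_abs,
      Real.norm_eq_abs, abs_of_pos (hpos t)]
    exact ⟨mul_le_of_le_one_right (hpos t).le (Real.abs_cos_le_one _),
      mul_le_of_le_one_right (hpos t).le (Real.abs_sin_le_one _)⟩
  have hςd : ∀ t, HasDerivAt ς (deriv ς t) t := fun t =>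
    (hς.differentiable (by simp) t).hasDerivAt
  have hςd' : ContDiff ℝ ∞ (deriv ς) := (contDiff_infty_iff_deriv.1 hς).2
  obtain ⟨r, hr, hrd, hr0⟩ := exists_smooth_primitive
    (g := fun t => 1 + deriv ς t ^ 2) (by fun_prop) (ς 0 + 1)
  obtain ⟨⟨d, hd⟩, hrm⟩ := exists_dfm_of_one_le_deriv hr hrd fun t => by nlinarith [sq_nonneg (deriv ς t)]
  have hge : ∀ t, 0 ≤ t → 1 ≤ r t - ς t := fun t ht => by
    have : Monotone fun t => r t - ς t := monotone_of_deriv_nonneg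
      (fun t => ((hrd t).sub (hςd t)).differentiableAt) fun t => by
        rw [show deriv (fun t => r t - ς t) t = _ from ((hrd t).sub (hςd t)).deriv]
        nlinarith [sq_nonneg (deriv ς t - 1)]
    have := this ht
    simp only [hr0] at this
    linarith
  obtain ⟨φ, hφ, hφ1, hφσ⟩ := h.exists_height
  obtain ⟨U, K, hU, hUK⟩ := exists_upshear hφ hφ1
  obtain ⟨U', K', hU', hUK'⟩ := exists_upshear (φ := fun q => sqz (d.symm q.1))
    (sqz_smooth.comp (d.symm.contDiff.comp contDiff_fst)) (fun q => (sqz_lt _).le)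
  have hq : ContDiff ℝ ∞ fun w : E3 => w.1.1 ^ 2 + w.1.2 ^ 2 := by fun_prop
  have hςlim2 : Tendsto (fun t => ς t ^ 2) atTop atTop :=
    (tendsto_pow_atTop two_ne_zero).comp hςlim
  obtain ⟨R, hR⟩ := exists_turn_dfm (lev_smooth hθ (hς.pow 2) (fun t => pow_pos (hpos t) 2) hςlim2 hq)
    (fun β w => by
      have := turn_sq β w
      simp only [lev, this]
      rfl)
  have hT0 : ∀ x, 0 ≤ Real.smoothTransition x := Real.smoothTransition.nonneg
  have hm0 : ∀ t, 0 ≤ (r t - ς t) * Real.smoothTransition (r t - ς t) := fun t => by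
    rcases le_total (r t - ς t) 0 with h1 | h1
    · rw [Real.smoothTransition.zero_of_nonpos h1, mul_zero]
    · exact mul_nonneg h1 (hT0 _)
  obtain ⟨S, hS⟩ := exists_stretch_dfm
    (F := lev (fun t => (r t - ς t) * Real.smoothTransition (r t - ς t)) ς fun w => w.1.1)
    (lev_smooth ((hr.sub hς).mul ((Real.smoothTransition.contDiff (n := ⊤)).comp (hr.sub hς)))
      hς hpos hςlim (by fun_prop))
    (fun w => by
      unfold lev
      split_ifs
      · exact mul_nonneg (mul_nonneg (hT0 _) (hm0 _)) (hT0 _)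
      · exact le_rfl)
    (fun y z x x' hx => by
      unfold lev
      dsimp only
      split_ifs
      · refine mul_le_mul_of_nonneg_left (Real.smoothTransition.monotone ?_)
          (mul_nonneg (hT0 _) (hm0 _))
        have := div_le_div_of_nonneg_right hx (hpos (usq z)).le
        linarith
      · exact le_rfl)
    (fun y z => ⟨(r (usq z) - ς (usq z)) * Real.smoothTransition (r (usq z) - ς (usq z)),
      fun x => by
        unfold lev
        dsimp only
        split_ifs
        · refine (mul_le_of_le_one_right (mul_nonneg (hT0 _) (hm0 _))
            (Real.smoothTransition.le_one _)).trans (mul_le_of_le_one_left (hm0 _)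
            (Real.smoothTransition.le_one _))
        · exact hm0 _⟩)
  have key : ∀ t, 0 ≤ t → U'.symm (S (R (U (σ t, 0)))) = ((r t, 0), 0) := fun t ht => by
    have hsc := Real.sin_sq_add_cos_sq (θ t)
    have e1 : R (U (σ t, 0)) = ((ς t, 0), sqz t) := by
      rw [hU, hφσ t ht, hR, turn, lev_sqz ht rfl (pow_pos (hpos t) 2)]
      · rw [hpol, Real.cos_neg, Real.sin_neg]
        refine Prod.ext (Prod.ext ?_ ?_) rfl
        · show ς t * Real.cos (θ t) * Real.cos (θ t) - ς t * Real.sin (θ t) * -Real.sin (θ t) = ς t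
          linear_combination ς t * hsc
        · show ς t * Real.cos (θ t) * -Real.sin (θ t) + ς t * Real.sin (θ t) * Real.cos (θ t) = 0
          ring
      · rw [hpol]
        refine le_of_eq ?_
        show ς t ^ 2 = (ς t * Real.cos (θ t)) ^ 2 + (ς t * Real.sin (θ t)) ^ 2
        linear_combination -ς t ^ 2 * hsc
    have e2 : S ((ς t, 0), sqz t) = ((r t, 0), sqz t) := by
      rw [hS, lev_sqz ht rfl (hpos t) le_rfl, Real.smoothTransition.one_of_one_le (hge t ht)]
      refine Prod.ext (Prod.ext ?_ rfl) rfl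
      show ς t + (r t - ς t) * 1 = r t
      ring
    have e3 : U' ((r t, 0), 0) = ((r t, 0), sqz t) := by
      rw [hU', ← hd t, Dfm.symm_apply_apply]
    rw [e1, e2, ← e3, Dfm.symm_apply_apply]
  refine ⟨((U.trans R).trans S).trans U'.symm, max (max K K') 1, r 0, fun p hp => ?_, ?_⟩
  · rw [max_le_iff, max_le_iff] at hp
    have e1 : R p = p := by
      rw [hR, turn, lev_of_le hp.2]
      simp
    have e2 : S p = p := by
      rw [hS, lev_of_le hp.2]
      simp
    have e3 : U'.symm p = p := by
      conv_lhs => rw [← hUK' p hp.1.2]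
      simp
    simp [hUK p hp.1.1, e1, e2, e3]
  · rw [image_image]
    ext p
    constructor
    · rintro ⟨t, ht, rfl⟩
      simp only [Dfm.trans_apply, key t ht]
      exact ⟨rfl, rfl, hrm.monotone ht⟩
    · rintro ⟨h1, h2, h3⟩
      have h4 : r (d.symm p.1.1) = p.1.1 := by rw [← hd, Dfm.apply_symm_apply]
      have h5 : 0 ≤ d.symm p.1.1 := by
        rw [← hrm.le_iff_le, h4]
        exact h3
      refine ⟨_, h5, ?_⟩
      simp only [Dfm.trans_apply, key _ h5, h4]
      exact Prod.ext (Prod.ext rfl h2.symm) h1.symm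

/-- Any ray in the plane can be straightened by a diffeomorphism of space supported near the
plane. -/
theorem PRay.exists_exchange {σ : ℝ → E2} (h : PRay σ) :
    ∃ (Θ : Dfm E3 E3) (C : ℝ) (c : E2), (∀ p, C ≤ |p.2| → Θ p = p) ∧
      Θ '' ((fun t => (σ t, (0 : ℝ))) '' Ici 0) = {p | p.2 = 0 ∧ p.1.2 = c.2 ∧ c.1 ≤ p.1.1} := by
  obtain ⟨c₀, hc₀⟩ : ∃ c₀, c₀ ∉ range σ := by
    have := (h.smooth.of_le (by simp) : ContDiff ℝ 1 σ).dense_compl_range_of_finrank_lt_finrank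
      (by simp)
    exact this.nonempty
  have h' : PRay fun t => σ t - c₀ :=
    ⟨h.smooth.sub contDiff_const, fun s hs t ht hst => h.inj hs ht (sub_left_injective hst),
      fun t ht => by simpa using h.deriv_ne t ht, by
        refine tendsto_atTop_mono (fun t => norm_sub_norm_le (σ t) c₀)
          (tendsto_atTop_add_const_right _ _ h.proper)⟩
  obtain ⟨Θ, C, c, h1, h2⟩ := exists_ray_exchange_of_ne_zero h' fun t ht =>
    hc₀ ⟨t, sub_eq_zero.1 ht⟩
  let τ : Dfm E3 E3 := ⟨⟨fun p => p - (c₀, 0), fun p => p + (c₀, 0), fun p => by simp,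
    fun p => by simp⟩, contDiff_id.sub contDiff_const, contDiff_id.add contDiff_const⟩
  have hτ : ∀ p, τ p = p - (c₀, 0) := fun _ => rfl
  have hτ' : ∀ p, τ.symm p = p + (c₀, 0) := fun _ => rfl
  refine ⟨(τ.trans Θ).trans τ.symm, C, (c + c₀.1, c₀.2), fun p hp => ?_, ?_⟩
  · simp only [Dfm.trans_apply]
    rw [h1 (τ p) (by simpa [hτ] using hp), Dfm.symm_apply_apply]
  · have e1 : (fun t => (σ t, (0 : ℝ))) '' Ici 0 =
        τ.symm '' ((fun t => (σ t - c₀, (0 : ℝ))) '' Ici 0) := by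
      rw [image_image]
      simp [hτ']
    have e2 : ∀ S : Set E3, ((τ.trans Θ).trans τ.symm) '' (τ.symm '' S) = τ.symm '' (Θ '' S) := by
      intro S
      simp only [image_image, Dfm.trans_apply, Dfm.apply_symm_apply]
    rw [e1, e2, h2]
    refine Dfm.image_eq _ ?_ ?_
    · rintro p ⟨h1, h2, h3⟩
      simp [hτ', h1, h2, h3]
    · rintro p ⟨h1, h2, h3⟩
      show τ p ∈ _
      simp only [hτ]
      refine ⟨by simp [h1], by simp [h2], ?_⟩
      show c ≤ p.1.1 - c₀.1
      simp only at h3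
      linarith

theorem PRay.dfm_comp {V W : Type} [NormedAddCommGroup V] [NormedSpace ℝ V]
    [NormedAddCommGroup W] [NormedSpace ℝ W] [ProperSpace W] {ρ : ℝ → V} (h : PRay ρ) (D : Dfm V W) :
    PRay fun t => D (ρ t) where
  smooth := D.contDiff.comp h.smooth
  inj := fun s hs t ht hst => h.inj hs ht (D.injective hst)
  deriv_ne := fun t ht h0 => by
    have h1 := ((D.contDiff.differentiable (by simp) (ρ t)).hasFDerivAt).comp_hasDerivAt t
      (h.smooth.differentiable (by simp) t).hasDerivAt
    rw [show deriv (fun t => D (ρ t)) t = _ from h1.deriv] at h0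
    exact h.deriv_ne t ht (D.fderiv_injective _ (by rw [h0, map_zero]))
  proper := by
    refine tendsto_atTop.2 fun b => ?_
    obtain ⟨M, hM⟩ := ((isCompact_closedBall (0 : W) b).image D.symm.continuous).isBounded.exists_norm_le
    filter_upwards [h.proper.eventually_gt_atTop M] with t ht
    by_contra! hb
    have := hM _ ⟨_, mem_closedBall_zero_iff.2 hb.le, D.symm_apply_apply _⟩
    linarith

theorem PRay.exists_lift {f : E2 → E3} (hf : HP f) {ρ : ℝ → E3} (h : PRay ρ)
    (hsub : ∀ t, 0 ≤ t → ρ t ∈ range f) : ∃ σ : ℝ → E2, PRay σ ∧ ∀ t, 0 ≤ t → f (σ t) = ρ t := by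
  obtain ⟨ε, -, -, hG⟩ := hf.exists_tub one_pos
  set G := tub f ε
  have hG0 : ∀ q, G (q, 0) = f q := fun q => tub_zero _ _ _
  have hinv : ∀ p, Function.invFun G (G p) = p := Function.leftInverse_invFun hG.inj
  obtain ⟨σ, hσ, hσ'⟩ := exists_smooth_mem_convex
    (fun t : ℝ => {y : E2 | 0 ≤ t → y = (Function.invFun G (ρ t)).1})
    (fun t y hy z hz a b ha hb hab h0 => by
      rw [hy h0, hz h0, ← add_smul, hab, one_smul])
    (fun t => by
      rcases lt_or_ge t 0 with ht | ht
      · exact ⟨_, Iio_mem_nhds ht, fun _ => 0, contDiffOn_const, fun s hs h0 => absurd h0 hs.not_ge⟩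
      obtain ⟨q, hq⟩ := hsub t ht
      have hop : IsOpen (ρ ⁻¹' range G) :=
        hG.isOpenMap.isOpen_range.preimage h.smooth.continuous
      refine ⟨_, hop.mem_nhds ⟨(q, 0), (hG0 q).trans hq⟩, _, fun s hs => ?_, fun s _ _ => rfl⟩
      obtain ⟨p, hp⟩ := hs
      have h1 : ContDiffAt ℝ ∞ (Function.invFun G) (ρ s) := by
        rw [← hp]
        exact contDiffAt_invFun hG.smooth hG.inj hG.deriv _
      exact (ContDiffAt.comp s h1 h.smooth.contDiffAt).fst.contDiffWithinAt)
  have hfσ : ∀ t, 0 ≤ t → f (σ t) = ρ t := fun t ht => by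
    obtain ⟨q, hq⟩ := hsub t ht
    rw [hσ' t ht, ← hq, ← hG0 q, hinv]
    exact (hG0 q).symm
  refine ⟨σ, ⟨hσ, fun s hs t ht hst => h.inj hs ht (by rw [← hfσ s hs, ← hfσ t ht, hst]),
    fun t ht h0 => h.deriv_ne t ht ?_, ?_⟩, hfσ⟩
  · have h1 := ((hf.smooth.differentiable (by simp) (σ t)).hasFDerivAt).comp_hasDerivAt t
      (hσ.differentiable (by simp) t).hasDerivAt
    rw [h0, map_zero] at h1
    have h2 : HasDerivWithinAt ρ 0 (Ici 0) t := h1.hasDerivWithinAt.congr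
      (fun s hs => (hfσ s hs).symm) (hfσ t ht).symm
    exact (uniqueDiffOn_Ici (0 : ℝ) t ht).eq_deriv _
      (h.smooth.differentiable (by simp) t).hasDerivAt.hasDerivWithinAt h2
  · refine tendsto_atTop.2 fun b => ?_
    obtain ⟨M, hM⟩ := ((isCompact_closedBall (0 : E2) b).image
      hf.smooth.continuous).isBounded.exists_norm_le
    filter_upwards [h.proper.eventually_gt_atTop M, eventually_ge_atTop 0] with t ht ht0
    by_contra! hb
    have := hM _ ⟨_, mem_closedBall_zero_iff.2 hb.le, rfl⟩
    rw [hfσ t ht0] at this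
    linarith

/-- The standard straight ray. -/
def ell : Set E3 := {p | p.2 = 0 ∧ p.1.2 = 0 ∧ 0 ≤ p.1.1}

theorem HP.exists_exchange {f : E2 → E3} (hf : HP f) {ρ : ℝ → E3} (h : PRay ρ)
    (hsub : ∀ t, 0 ≤ t → ρ t ∈ range f) : ∃ (D : Dfm E3 E3) (c : E2),
      D '' (ρ '' Ici 0) = f '' {q | q.2 = c.2 ∧ c.1 ≤ q.1} := by
  obtain ⟨σ, hσ, hfσ⟩ := h.exists_lift hf hsub
  obtain ⟨ε, -, -, hG⟩ := hf.exists_tub one_pos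
  have hG0 : ∀ q, tub f ε (q, 0) = f q := fun q => tub_zero _ _ _
  obtain ⟨Θ, C, c, hC, hΘ⟩ := hσ.exists_exchange
  obtain ⟨D, hD, -⟩ := hG.exists_dfm Θ hC
  refine ⟨D, c, ?_⟩
  have e1 : ρ '' Ici 0 = tub f ε '' ((fun t => (σ t, (0 : ℝ))) '' Ici 0) := by
    rw [image_image]
    exact image_congr fun t ht => by rw [hG0, hfσ t ht]
  rw [e1, image_image]
  simp only [hD]
  rw [← image_image (tub f ε) Θ, hΘ]
  ext p
  constructor
  · rintro ⟨⟨q, z⟩, ⟨rfl, h1⟩, rfl⟩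
    exact ⟨q, h1, (hG0 q).symm⟩
  · rintro ⟨q, h1, rfl⟩
    exact ⟨(q, 0), ⟨rfl, h1⟩, hG0 q⟩

theorem unknotted_ray_of_unknotted_plane {ρ : ℝ → E3} (h : PRay ρ) (Φ : Dfm E3 E3)
    (hΦ : ∀ t, 0 ≤ t → (Φ (ρ t)).2 = 0) : ∃ Ψ : Dfm E3 E3, Ψ '' (ρ '' Ici 0) = ell := by
  obtain ⟨D, c, hD⟩ := hp_incl.exists_exchange (h.dfm_comp Φ) fun t ht =>
    ⟨(Φ (ρ t)).1, Prod.ext rfl (hΦ t ht).symm⟩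
  let τ : Dfm E3 E3 := ⟨⟨fun p => p - (c, 0), fun p => p + (c, 0), fun p => by simp,
    fun p => by simp⟩, contDiff_id.sub contDiff_const, contDiff_id.add contDiff_const⟩
  have hτ : ∀ p, τ p = p - (c, 0) := fun _ => rfl
  have hτ' : ∀ p, τ.symm p = p + (c, 0) := fun _ => rfl
  refine ⟨(Φ.trans D).trans τ, ?_⟩
  have : ((Φ.trans D).trans τ) '' (ρ '' Ici 0) = τ '' (D '' ((fun t => Φ (ρ t)) '' Ici 0)) := by
    simp only [image_image, Dfm.trans_apply]
  rw [this, hD]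
  refine Dfm.image_eq _ ?_ ?_
  · rintro _ ⟨q, ⟨h1, h2⟩, rfl⟩
    rw [hτ]
    exact ⟨by simp [incl], by simp [incl, h1], by simpa [incl] using h2⟩
  · rintro p ⟨h1, h2, h3⟩
    rw [hτ']
    exact ⟨p.1 + c, ⟨by simp [h2], by simpa using h3⟩, by simp [incl, h1, Prod.ext_iff]⟩

/-- If a properly embedded plane contains an unknotted ray, then it can be moved so that a
coordinate half-line is mapped onto the standard ray. -/
theorem HP.exists_dfm_straight_ray {f : E2 → E3} (hf : HP f) {ρ : ℝ → E3} (h : PRay ρ)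
    (hsub : ∀ t, 0 ≤ t → ρ t ∈ range f) (Φ : Dfm E3 E3) (hΦ : Φ '' (ρ '' Ici 0) = ell) :
    ∃ (D : Dfm E3 E3) (τ : Dfm E2 E2), (fun q => D (f (τ q))) '' {q | q.2 = 0 ∧ 0 ≤ q.1} = ell := by
  obtain ⟨D, c, hD⟩ := hf.exists_exchange h hsub
  refine ⟨D.symm.trans Φ, ⟨⟨fun p => p + c, fun p => p - c, fun p => by simp,
    fun p => by simp⟩, contDiff_id.add contDiff_const, contDiff_id.sub contDiff_const⟩, ?_⟩
  rw [← hΦ]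
  have e1 : ρ '' Ici 0 = D.symm '' (f '' {q | q.2 = c.2 ∧ c.1 ≤ q.1}) := by
    rw [← hD, image_image]
    simp
  rw [e1, ← image_image (fun q => (D.symm.trans Φ) (f q)), ← image_image (D.symm.trans Φ) f]
  have e2 : (fun p : E2 => p + c) '' {q | q.2 = 0 ∧ 0 ≤ q.1} = {q | q.2 = c.2 ∧ c.1 ≤ q.1} := by
    ext q
    constructor
    · rintro ⟨p, ⟨h1, h2⟩, rfl⟩
      exact ⟨by simp [h1], by simpa using h2⟩
    · rintro ⟨h1, h2⟩
      exact ⟨q - c, ⟨by simp [h1], by simpa using h2⟩, by simp⟩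
  erw [e2]
  rw [image_image Φ]
  rfl

theorem HP.hasDerivAt_fst {f : E2 → E3} (hf : HP f) (q : E2) :
    HasDerivAt (fun t => f (t, q.2)) (fderiv ℝ f q (1, 0)) q.1 :=
  ((hf.smooth.differentiable (by simp) q).hasFDerivAt).comp_hasDerivAt (f := fun t => (t, q.2)) q.1
    ((hasDerivAt_id q.1).prodMk (hasDerivAt_const q.1 q.2))

theorem HP.hasDerivAt_snd {f : E2 → E3} (hf : HP f) (q : E2) :
    HasDerivAt (fun t => f (q.1, t)) (fderiv ℝ f q (0, 1)) q.2 :=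
  ((hf.smooth.differentiable (by simp) q).hasFDerivAt).comp_hasDerivAt (f := fun t => (q.1, t)) q.2
    ((hasDerivAt_const q.2 q.1).prodMk (hasDerivAt_id q.2))

theorem HP.fderiv_fst_of_eqOn {f : E2 → E3} (hf : HP f) {j : ℝ → ℝ} {x j' : ℝ} (hx : 0 ≤ x)
    (hj : HasDerivAt j j' x) (h : ∀ t, 0 ≤ t → f (t, 0) = ((j t, 0), 0)) :
    fderiv ℝ f (x, 0) (1, 0) = ((j', 0), 0) := by
  have h1 : HasDerivWithinAt (fun t => f (t, 0)) ((j', 0), 0) (Ici 0) x :=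
    (((hj.prodMk (hasDerivAt_const x (0 : ℝ))).prodMk
      (hasDerivAt_const x (0 : ℝ))).hasDerivWithinAt).congr (fun t ht => h t ht) (h x hx)
  exact (uniqueDiffOn_Ici (0 : ℝ) x hx).eq_deriv _ (hf.hasDerivAt_fst (x, 0)).hasDerivWithinAt h1

theorem HP.exists_reparam {f : E2 → E3} (hf : HP f)
    (hray : f '' {q | q.2 = 0 ∧ 0 ≤ q.1} = ell) :
    ∃ τ : Dfm E2 E2, ∀ x, 0 ≤ x → f (τ (x, 0)) = ((x, 0), 0) := by
  have hfl : ∀ t, 0 ≤ t → f (t, 0) ∈ ell := fun t ht => hray ▸ mem_image_of_mem f ⟨rfl, ht⟩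
  set j : ℝ → ℝ := fun t => (f (t, 0)).1.1 with hj
  have hfj : ∀ t, 0 ≤ t → f (t, 0) = ((j t, 0), 0) := fun t ht =>
    Prod.ext (Prod.ext rfl (hfl t ht).2.1) (hfl t ht).1
  have hjs : ContDiff ℝ ∞ j :=
    contDiff_fst.comp (contDiff_fst.comp (hf.smooth.comp (contDiff_id.prodMk contDiff_const)))
  have hjd : ∀ t, HasDerivAt j (deriv j t) t := fun t =>
    (hjs.differentiable (by simp) t).hasDerivAt
  have hjd' : ContDiff ℝ ∞ (deriv j) := (contDiff_infty_iff_deriv.1 hjs).2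
  have hsurj : ∀ y, 0 ≤ y → ∃ t, 0 ≤ t ∧ j t = y := fun y hy => by
    have : ((y, 0), 0) ∈ ell := ⟨rfl, rfl, hy⟩
    rw [← hray] at this
    obtain ⟨⟨t, s⟩, ⟨hs, ht⟩, h⟩ := this
    obtain rfl : s = 0 := hs
    exact ⟨t, ht, by rw [hj]; simp only [h]⟩
  have hne : ∀ t, 0 ≤ t → deriv j t ≠ 0 := fun t ht h0 => by
    have h1 := hf.fderiv_fst_of_eqOn ht (hjd t) hfj
    rw [h0] at h1
    have := hf.imm (t, 0) (h1.trans (map_zero (fderiv ℝ f (t, 0))).symm)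
    simp at this
  have hpos : ∀ t, 0 ≤ t → 0 < deriv j t := by
    by_contra! hneg
    obtain ⟨t₀, ht₀, h0⟩ := hneg
    have hall : ∀ t, 0 ≤ t → deriv j t < 0 := fun t ht => by
      by_contra! h
      obtain ⟨s, hs, hs0⟩ := (convex_Ici (0 : ℝ)).isPreconnected.intermediate_value ht₀ ht
        hjd'.continuous.continuousOn ⟨h0, h⟩
      exact hne s hs hs0
    have hanti : AntitoneOn j (Ici 0) := antitoneOn_of_deriv_nonpos (convex_Ici 0)
      hjs.continuous.continuousOn (hjs.differentiable (by simp)).differentiableOn fun t ht =>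
        (hall t (interior_subset ht)).le
    obtain ⟨t, ht, hjt⟩ := hsurj (j 0 + 1) (by linarith [(hfl 0 le_rfl).2.2])
    have := hanti (mem_Ici.2 le_rfl) ht ht
    linarith
  have hmono : MonotoneOn j (Ici 0) := monotoneOn_of_deriv_nonneg (convex_Ici 0)
      hjs.continuous.continuousOn (hjs.differentiable (by simp)).differentiableOn fun t ht =>
        (hpos t (interior_subset ht)).le
  have hj0 : j 0 = 0 := by
    obtain ⟨t, ht, hjt⟩ := hsurj 0 le_rfl
    have := hmono (mem_Ici.2 le_rfl) ht ht
    have h1 : 0 ≤ j 0 := (hfl 0 le_rfl).2.2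
    linarith
  obtain ⟨g, hg, hg'⟩ := exists_smooth_mem_convex
    (fun t : ℝ => {y : ℝ | (0 ≤ t → y = deriv j t) ∧ 0 < y ∧ (t ≤ -1 → 1 ≤ y)})
    (fun t => by
      have e : {y : ℝ | (0 ≤ t → y = deriv j t) ∧ 0 < y ∧ (t ≤ -1 → 1 ≤ y)} =
          {y | 0 ≤ t → y = deriv j t} ∩ (Ioi 0 ∩ {y | t ≤ -1 → 1 ≤ y}) := rfl
      rw [e]
      refine Convex.inter ?_ ((convex_Ioi 0).inter ?_)
      · by_cases h : 0 ≤ t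
        · simp [h]
        · simp [h, convex_univ]
      · by_cases h : t ≤ -1
        · simp only [h, forall_const]
          exact convex_Ici 1
        · simp [h, convex_univ])
    (fun t => by
      rcases lt_or_ge t 0 with ht | ht
      · exact ⟨_, Iio_mem_nhds ht, fun _ => 1, contDiffOn_const, fun s hs =>
          ⟨fun h0 => absurd h0 hs.not_ge, one_pos, fun _ => le_rfl⟩⟩
      · refine ⟨_, inter_mem (hjd'.continuous.continuousAt (Ioi_mem_nhds (hpos t ht)))
          (Ioi_mem_nhds (by linarith : -1 < t)), _, hjd'.contDiffOn, fun s hs =>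
            ⟨fun _ => rfl, hs.1, fun h => absurd h (not_le.2 hs.2)⟩⟩)
  obtain ⟨J, hJ, hJd, hJ0⟩ := exists_smooth_primitive hg 0
  have hJj : ∀ t, 0 ≤ t → J t = j t := fun t ht => by
    have hD : ∀ t, HasDerivAt (fun t => J t - j t) (g t - deriv j t) t := fun t =>
      (hJd t).sub (hjd t)
    have h0 : ∀ t ∈ interior (Ici (0 : ℝ)), deriv (fun t => J t - j t) t = 0 := fun t ht => by
      rw [(hD t).deriv, (hg' t).1 (interior_subset ht), sub_self]
    have h1 := monotoneOn_of_deriv_nonneg (convex_Ici 0) (hJ.sub hjs).continuous.continuousOn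
      (fun t _ => (hD t).differentiableAt.differentiableWithinAt) (fun t ht => (h0 t ht).ge)
      (mem_Ici.2 le_rfl) ht ht
    have h2 := antitoneOn_of_deriv_nonpos (convex_Ici 0) (hJ.sub hjs).continuous.continuousOn
      (fun t _ => (hD t).differentiableAt.differentiableWithinAt) (fun t ht => (h0 t ht).le)
      (mem_Ici.2 le_rfl) ht ht
    simp only [hJ0, hj0] at h1 h2
    linarith
  have hJm : StrictMono J := strictMono_of_deriv_pos fun t => by
    rw [(hJd t).deriv]
    exact (hg' t).2.1
  obtain ⟨d, hd⟩ := exists_dfm_of_bijective J hJ ⟨hJm.injective, fun y => by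
      refine mem_range_of_exists_le_of_exists_ge hJ.continuous ?_ ?_
      · have hD : ∀ t, HasDerivAt (fun t => J t - t) (g t - 1) t := fun t =>
          (hJd t).sub (hasDerivAt_id t)
        have h1 := monotoneOn_of_deriv_nonneg (convex_Iic (-1 : ℝ))
          (hJ.sub contDiff_id).continuous.continuousOn
          (fun t _ => (hD t).differentiableAt.differentiableWithinAt) (fun t ht => by
            have := (hg' t).2.2 (interior_subset (s := Iic (-1 : ℝ)) ht)
            rw [show deriv (fun t => J t - id t) t = _ from (hD t).deriv]
            linarith)
        refine ⟨min (-1) (y - J (-1) - 1), ?_⟩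
        have h2 := h1 (mem_Iic.2 (min_le_left _ (y - J (-1) - 1))) (mem_Iic.2 le_rfl)
          (min_le_left _ _)
        have h3 := min_le_right (-1) (y - J (-1) - 1)
        simp only [id] at h2
        linarith
      · obtain ⟨t, ht, hjt⟩ := hsurj (max y 0) (le_max_right _ _)
        exact ⟨t, by rw [hJj t ht, hjt]; exact le_max_left _ _⟩⟩
    fun t => ⟨_, (hJd t).hasFDerivAt_equiv (hg' t).2.1.ne'⟩
  refine ⟨⟨⟨fun q => (d.symm q.1, q.2), fun q => (d q.1, q.2), fun q => by simp, fun q => by simp⟩,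
    (d.symm.contDiff.comp contDiff_fst).prodMk contDiff_snd,
    (d.contDiff.comp contDiff_fst).prodMk contDiff_snd⟩, fun x hx => ?_⟩
  have h1 : 0 ≤ d.symm x := by
    rw [← hJm.le_iff_le, ← hd (d.symm x), hJ0, Dfm.apply_symm_apply]
    exact hx
  show f (d.symm x, 0) = _
  rw [hfj _ h1, ← hJj _ h1, ← hd, Dfm.apply_symm_apply]

/-- A plane containing the standard ray can be twisted about it so that it is nowhere vertical
along the ray. -/
theorem HP.exists_twist {f : E2 → E3} (hf : HP f) (hx : ∀ x, 0 ≤ x → f (x, 0) = ((x, 0), 0)) :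
    ∃ T : Dfm E3 E3, (∀ x, 0 ≤ x → T (f (x, 0)) = ((x, 0), 0)) ∧
      ∀ x, 0 ≤ x → 0 < (fderiv ℝ (fun q => T (f q)) (x, 0) (0, 1)).1.2 := by
  set w : ℝ → E2 := fun x => ((fderiv ℝ f (x, 0) (0, 1)).1.2, (fderiv ℝ f (x, 0) (0, 1)).2) with hw
  have hfc : Continuous fun x : ℝ => fderiv ℝ f (x, 0) (0, 1) :=
    ((hf.smooth.continuous_fderiv (by simp)).comp
      (by fun_prop : Continuous fun x : ℝ => (x, (0 : ℝ)))).clm_apply continuous_const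
  have hwc : Continuous w := by fun_prop
  have hw0 : ∀ x, 0 ≤ x → w x ≠ 0 := fun x h h0 => by
    have h1 := hf.fderiv_fst_of_eqOn h (hasDerivAt_id x) hx
    have h2 : fderiv ℝ f (x, 0) (0, 1) =
        fderiv ℝ f (x, 0) ((fderiv ℝ f (x, 0) (0, 1)).1.1 • (1, 0)) := by
      rw [map_smul, h1]
      have e1 := congrArg Prod.fst h0
      have e2 := congrArg Prod.snd h0
      simp only [hw, Prod.fst_zero, Prod.snd_zero] at e1 e2
      refine Prod.ext (Prod.ext ?_ ?_) ?_ <;> simp [e1, e2]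
    have h3 := congrArg Prod.snd (hf.imm _ h2)
    simp at h3
  have hpos : ∀ v : E2, v ≠ 0 → 0 < v.1 * v.1 + v.2 * v.2 := fun v hv => by
    rcases eq_or_ne v.1 0 with h1 | h1
    · have h2 : v.2 ≠ 0 := fun h2 => hv (Prod.ext h1 h2)
      nlinarith [mul_self_pos.2 h2, mul_self_nonneg v.1]
    · nlinarith [mul_self_pos.2 h1, mul_self_nonneg v.2]
  obtain ⟨m, hm, hm'⟩ := exists_smooth_mem_convex_of_const
    (fun x : ℝ => {m : E2 | 0 < m.1 * (w (max x 0)).1 + m.2 * (w (max x 0)).2})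
    (fun x a ha b hb s t hs ht hst => by
      have ha' : 0 < a.1 * (w (max x 0)).1 + a.2 * (w (max x 0)).2 := ha
      have hb' : 0 < b.1 * (w (max x 0)).1 + b.2 * (w (max x 0)).2 := hb
      show 0 < (s * a.1 + t * b.1) * (w (max x 0)).1 + (s * a.2 + t * b.2) * (w (max x 0)).2
      rcases hs.eq_or_lt with rfl | hs
      · nlinarith [mul_pos (by linarith : 0 < t) hb']
      · nlinarith [mul_pos hs ha', mul_nonneg ht hb'.le])
    (fun x => ⟨w (max x 0), by
      refine continuousAt_const.eventually_lt (f := fun _ => (0 : ℝ)) (g := fun y =>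
        (w (max x 0)).1 * (w (max y 0)).1 + (w (max x 0)).2 * (w (max y 0)).2) ?_
        (hpos _ (hw0 _ (le_max_right _ _)))
      fun_prop⟩)
  have hm0 : ∀ x, 0 < (m x).1 ^ 2 + (m x).2 ^ 2 := fun x => by
    have := hpos (m x) fun h => by
      have := hm' x
      simp [h] at this
    linarith
  have hn : ContDiff ℝ ∞ fun p : E3 => ((m p.1.1).1 ^ 2 + (m p.1.1).2 ^ 2)⁻¹ :=
    ContDiff.inv (by fun_prop) fun p => (hm0 _).ne'
  let T : Dfm E3 E3 := ⟨⟨fun p => ((p.1.1, (m p.1.1).1 * p.1.2 + (m p.1.1).2 * p.2),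
      (m p.1.1).1 * p.2 - (m p.1.1).2 * p.1.2),
    fun p => ((p.1.1, ((m p.1.1).1 * p.1.2 - (m p.1.1).2 * p.2) *
      ((m p.1.1).1 ^ 2 + (m p.1.1).2 ^ 2)⁻¹), ((m p.1.1).1 * p.2 + (m p.1.1).2 * p.1.2) *
      ((m p.1.1).1 ^ 2 + (m p.1.1).2 ^ 2)⁻¹),
    fun p => by
      have := (hm0 p.1.1).ne'
      refine Prod.ext (Prod.ext rfl ?_) ?_ <;> field_simp <;> ring,
    fun p => by
      have := (hm0 p.1.1).ne'
      refine Prod.ext (Prod.ext rfl ?_) ?_ <;> field_simp <;> ring⟩, by fun_prop, by fun_prop⟩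
  have hT : ∀ p, T p = ((p.1.1, (m p.1.1).1 * p.1.2 + (m p.1.1).2 * p.2),
      (m p.1.1).1 * p.2 - (m p.1.1).2 * p.1.2) := fun _ => rfl
  refine ⟨T, fun x h => by rw [hT, hx x h]; simp, fun x h => ?_⟩
  have h1 := (hf.dfm_comp T).hasDerivAt_snd (x, 0)
  have h2 : HasDerivAt (fun t => (T (f (x, t))).1.2)
      (fderiv ℝ (fun q => T (f q)) (x, 0) (0, 1)).1.2 0 :=
    ((ContinuousLinearMap.snd ℝ ℝ ℝ).comp
      (ContinuousLinearMap.fst ℝ E2 ℝ)).hasFDerivAt.comp_hasDerivAt (0 : ℝ) h1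
  have h3 := hf.hasDerivAt_snd (x, 0)
  have hπ : ∀ l : E3 →L[ℝ] ℝ, HasDerivAt (fun t => l (f (x, t))) (l (fderiv ℝ f (x, 0) (0, 1))) 0 :=
    fun l => l.hasFDerivAt.comp_hasDerivAt (0 : ℝ) h3
  have hx1 := hπ ((ContinuousLinearMap.fst ℝ ℝ ℝ).comp (ContinuousLinearMap.fst ℝ E2 ℝ))
  have hy1 := hπ ((ContinuousLinearMap.snd ℝ ℝ ℝ).comp (ContinuousLinearMap.fst ℝ E2 ℝ))
  have hz1 := hπ (ContinuousLinearMap.snd ℝ E2 ℝ)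
  have hm1 : HasDerivAt (fun t => (m (f (x, t)).1.1).1) _ 0 := 
    ((hm.fst.differentiable (by simp) _).hasDerivAt).comp (0 : ℝ) hx1
  have hm2 : HasDerivAt (fun t => (m (f (x, t)).1.1).2) _ 0 := 
    ((hm.snd.differentiable (by simp) _).hasDerivAt).comp (0 : ℝ) hx1
  have h4 := (hm1.mul hy1).add (hm2.mul hz1)
  rw [h2.unique h4]
  have := hm' x
  simp only [max_eq_left h, mem_ofPred_eq, hw] at this
  simp [hx x h]
  linarith

/-- The plane swap. -/
noncomputable def κ12 : E2 ≃L[ℝ] E2 := ContinuousLinearEquiv.prodComm ℝ ℝ ℝ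

theorem HP.exists_flatten {f : E2 → E3} (hf : HP f) (hx : ∀ x, 0 ≤ x → f (x, 0) = ((x, 0), 0))
    (hy : ∀ x, 0 ≤ x → 0 < (fderiv ℝ f (x, 0) (0, 1)).1.2) :
    ∃ τ : Dfm E2 E2, ∃ V, IsOpen V ∧ (∀ x, 0 ≤ x → (x, 0) ∈ V) ∧ ∀ q ∈ V, (f (τ q)).1 = q := by
  have hZ : IsClosed {q : E2 | q.2 = 0 ∧ 0 ≤ q.1} :=
    (isClosed_eq continuous_snd continuous_const).inter (isClosed_le continuous_const continuous_fst)
  have hfc : Continuous fun x : ℝ => (fderiv ℝ f (max x 0, 0) (0, 1)).1.2 := by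
    have : Continuous fun x : ℝ => fderiv ℝ f (max x 0, 0) (0, 1) :=
      ((hf.smooth.continuous_fderiv (by simp)).comp
        (by fun_prop : Continuous fun x : ℝ => (max x 0, (0 : ℝ)))).clm_apply continuous_const
    fun_prop
  have hc1 : ContDiff ℝ ∞ fun q => (f q).1.2 := by
    have := hf.smooth
    fun_prop
  have hc0 : ContDiff ℝ ∞ fun q => (f q).1.1 := by
    have := hf.smooth
    fun_prop
  obtain ⟨d, hd1, -, -, U, hU, hZU, hdU⟩ := exists_dfm_coord (ContinuousLinearEquiv.refl ℝ E2) _ hc1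
    hZ (fun v hv θ hθ => ⟨by simp [hv.1], by simpa using hv.2⟩) _ hfc
    (fun x => hy _ (le_max_right _ _)) (by
      rintro ⟨x, y⟩ ⟨rfl, h⟩
      have h : 0 ≤ x := h
      have h1 := (((ContinuousLinearMap.snd ℝ ℝ ℝ).comp
        (ContinuousLinearMap.fst ℝ E2 ℝ)).hasFDerivAt).comp (x, (0 : ℝ))
        (hf.smooth.differentiable (by simp) (x, 0)).hasFDerivAt
      erw [h1.fderiv]
      simp [max_eq_left h])
  simp only [ContinuousLinearEquiv.refl_apply] at hd1 hdU
  have hd0 : ∀ x, 0 ≤ x → d (x, 0) = (x, 0) := fun x h => by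
    rw [hdU _ (hZU ⟨rfl, h⟩)]
    simp [hx x h]
  have hd0' : ∀ x, 0 ≤ x → d.symm (x, 0) = (x, 0) := fun x h => by
    conv_lhs => rw [← hd0 x h]
    simp
  have hc2 : ContDiff ℝ ∞ fun q => (f (d.symm q)).1.1 := hc0.comp d.symm.contDiff
  obtain ⟨e, he1, -, -, U', hU', hZU', heU⟩ := exists_dfm_coord κ12 _ hc2
    hZ (fun v hv θ hθ => ⟨by simpa [κ12] using hv.1, by simpa [κ12] using mul_nonneg hθ.1 hv.2⟩)
    (fun _ => 1) continuous_const (fun x => one_pos) (by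
      rintro ⟨x, y⟩ ⟨rfl, h⟩
      have h : 0 ≤ x := h
      have h1 : HasDerivAt (fun t : ℝ => (f (d.symm (t, 0))).1.1)
          (fderiv ℝ (fun q => (f (d.symm q)).1.1) (x, 0) (1, 0)) x :=
        ((hc2.differentiable (by simp) (x, 0)).hasFDerivAt).comp_hasDerivAt
          (f := fun t : ℝ => (t, (0 : ℝ))) x
          ((hasDerivAt_id x).prodMk (hasDerivAt_const x 0))
      have h2 : HasDerivWithinAt (fun t : ℝ => (f (d.symm (t, 0))).1.1) 1 (Ici 0) x :=
        (hasDerivAt_id x).hasDerivWithinAt.congr (fun t ht => by simp [hd0' t ht, hx t ht])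
          (by simp [hd0' x h, hx x h])
      refine le_of_eq ?_
      exact (uniqueDiffOn_Ici (0 : ℝ) x h).eq_deriv _ h2 h1.hasDerivWithinAt)
  have hed : ∀ q ∈ U ∩ d ⁻¹' U', e (d q) = (f q).1 := fun q hq => by
    have h1 := heU _ hq.2
    have h2 := hdU _ hq.1
    apply κ12.injective
    rw [h1, Dfm.symm_apply_apply, h2]
    rfl
  refine ⟨(d.trans e).symm, (d.trans e).symm ⁻¹' (U ∩ d ⁻¹' U'),
    (hU.inter (hU'.preimage d.continuous)).preimage (d.trans e).symm.continuous,
    fun x h => ?_, fun q hq => ?_⟩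
  · have h1 : (x, (0 : ℝ)) ∈ U ∩ d ⁻¹' U' := ⟨hZU ⟨rfl, h⟩, by
      rw [mem_preimage, hd0 x h]
      exact hZU' ⟨rfl, h⟩⟩
    have h2 : (d.trans e) (x, 0) = (x, 0) := by
      rw [Dfm.trans_apply, hed _ h1, hx x h]
    rw [mem_preimage]
    nth_rw 1 [← h2]
    rwa [Dfm.symm_apply_apply]
  · rw [← hed _ hq, ← Dfm.trans_apply, Dfm.apply_symm_apply]

/-- Normal form of a properly embedded plane near an unknotted ray. -/
theorem HP.exists_standard_germ {f : E2 → E3} (hf : HP f)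
    (hray : f '' {q | q.2 = 0 ∧ 0 ≤ q.1} = ell) :
    ∃ (D : Dfm E3 E3) (τ : Dfm E2 E2) (N : Set E3), IsOpen N ∧ (∀ x, 0 ≤ x → ((x, 0), 0) ∈ N) ∧
      (∀ q, D (f (τ q)) ∈ N → D (f (τ q)) = incl q) ∧ ∀ q, incl q ∈ N → D (f (τ q)) = incl q := by
  obtain ⟨τ₁, h1⟩ := hf.exists_reparam hray
  obtain ⟨T, h2, h3⟩ := (hf.comp_dfm τ₁).exists_twist h1
  have hf2 := (hf.comp_dfm τ₁).dfm_comp T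
  obtain ⟨τ₂, V, hV, hxV, hVτ⟩ := hf2.exists_flatten h2 h3
  have hf3 := hf2.comp_dfm τ₂
  have hs : ContDiff ℝ ∞ fun p : E3 => (T (f (τ₁ (τ₂ p.1)))).2 :=
    contDiff_snd.comp (hf3.smooth.comp contDiff_fst)
  let S : Dfm E3 E3 := ⟨⟨fun p => (p.1, p.2 - (T (f (τ₁ (τ₂ p.1)))).2),
    fun p => (p.1, p.2 + (T (f (τ₁ (τ₂ p.1)))).2), fun p => by simp, fun p => by simp⟩,
    by fun_prop, by fun_prop⟩
  have hS : ∀ p, S p = (p.1, p.2 - (T (f (τ₁ (τ₂ p.1)))).2) := fun _ => rfl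
  have hf4 := hf3.dfm_comp S
  have hV4 : ∀ q ∈ V, S (T (f (τ₁ (τ₂ q)))) = incl q := fun q hq => by
    rw [hS, hVτ q hq, sub_self]
    rfl
  obtain ⟨N, hN, hNV⟩ := hf4.emb.isInducing.isOpen_iff.1 hV
  have hNV' : ∀ q, S (T (f (τ₁ (τ₂ q)))) ∈ N ↔ q ∈ V := fun q => by rw [← hNV]; rfl
  refine ⟨T.trans S, τ₂.trans τ₁, N ∩ (Prod.fst ⁻¹' V), hN.inter (hV.preimage continuous_fst),
    fun x h => ⟨?_, hxV x h⟩, fun q hq => ?_, fun q hq => ?_⟩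
  · have := (hNV' _).2 (hxV x h)
    rwa [hV4 _ (hxV x h)] at this
  · exact hV4 q ((hNV' q).1 hq.1)
  · exact hV4 q hq.2

/-- The plane `range f` separates space into the two closed sides `A` and `B`. -/
structure Sides (f : E2 → E3) (A B : Set E3) : Prop where
  closedA : IsClosed A
  closedB : IsClosed B
  cover : ∀ p, p ∈ A ∨ p ∈ B
  inter : A ∩ B = range f
  accA : range f ⊆ closure Aᶜ
  accB : range f ⊆ closure Bᶜ

theorem Sides.swap {f : E2 → E3} {A B : Set E3} (h : Sides f A B) : Sides f B A :=
  ⟨h.closedB, h.closedA, fun p => (h.cover p).symm, by rw [inter_comm, h.inter], h.accB, h.accA⟩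

theorem Sides.dfm {f : E2 → E3} {A B : Set E3} (h : Sides f A B) (D : Dfm E3 E3) (d : Dfm E2 E2) :
    Sides (fun q => D (f (d q))) (D.symm ⁻¹' A) (D.symm ⁻¹' B) where
  closedA := h.closedA.preimage D.symm.continuous
  closedB := h.closedB.preimage D.symm.continuous
  cover p := h.cover _
  inter := by rw [range_dfm_comp, ← h.inter]; rfl
  accA := by
    rw [range_dfm_comp, ← preimage_compl]
    exact (preimage_mono h.accA).trans (D.symm.toHomeo.preimage_closure _).subset
  accB := by
    rw [range_dfm_comp, ← preimage_compl]
    exact (preimage_mono h.accB).trans (D.symm.toHomeo.preimage_closure _).subset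

theorem isPreconnected_upper {r : ℝ} (hr : 0 < r) :
    IsPreconnected {p : E3 | 0 < p.2 ∧ ¬(|p.1.2| ≤ r ∧ |p.2| ≤ r)} := by
  have c1 : Convex ℝ {p : E3 | r < p.2} :=
    convex_halfSpace_gt (LinearMap.snd ℝ E2 ℝ).isLinear r
  have c0 : Convex ℝ {p : E3 | 0 < p.2} :=
    convex_halfSpace_gt (LinearMap.snd ℝ E2 ℝ).isLinear 0
  have c2 : Convex ℝ {p : E3 | r < p.1.2} :=
    convex_halfSpace_gt (LinearMap.snd ℝ ℝ ℝ ∘ₗ LinearMap.fst ℝ E2 ℝ).isLinear r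
  have c3 : Convex ℝ {p : E3 | p.1.2 < -r} :=
    convex_halfSpace_lt (LinearMap.snd ℝ ℝ ℝ ∘ₗ LinearMap.fst ℝ E2 ℝ).isLinear (-r)
  have h1 : IsPreconnected ({p : E3 | r < p.2} ∪ {p : E3 | 0 < p.2} ∩ {p : E3 | r < p.1.2}) := by
    have m1 : (((0, r + 1), r + 1) : E3) ∈ {p : E3 | r < p.2} := show r < r + 1 by linarith
    have m2 : (((0, r + 1), r + 1) : E3) ∈ {p : E3 | 0 < p.2} ∩ {p : E3 | r < p.1.2} :=
      ⟨show 0 < r + 1 by linarith, show r < r + 1 by linarith⟩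
    exact IsPreconnected.union _ m1 m2 c1.isPreconnected (c0.inter c2).isPreconnected
  have m3 : (((0, -r - 1), r + 1) : E3) ∈ {p : E3 | r < p.2} ∪ {p : E3 | 0 < p.2} ∩
      {p : E3 | r < p.1.2} := Or.inl (show r < r + 1 by linarith)
  have m4 : (((0, -r - 1), r + 1) : E3) ∈ {p : E3 | 0 < p.2} ∩ {p : E3 | p.1.2 < -r} :=
    ⟨show 0 < r + 1 by linarith, show -r - 1 < -r by linarith⟩
  have h2 := IsPreconnected.union _ m3 m4 h1 (c0.inter c3).isPreconnected
  convert h2 using 1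
  ext p
  simp only [mem_union, mem_inter_iff, mem_ofPred_eq, abs_le]
  constructor
  · rintro ⟨h0, h⟩
    by_contra! hc
    exact h ⟨⟨hc.2 h0, hc.1.2 h0⟩, by linarith, hc.1.1⟩
  · rintro ((h | h) | h)
    · exact ⟨by linarith, fun h' => by linarith [h'.2.2]⟩
    · exact ⟨h.1, fun h' => by linarith [h'.1.2]⟩
    · exact ⟨h.1, fun h' => by linarith [h'.1.1]⟩

theorem isPreconnected_lower {r : ℝ} (hr : 0 < r) :
    IsPreconnected {p : E3 | p.2 < 0 ∧ ¬(|p.1.2| ≤ r ∧ |p.2| ≤ r)} := by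
  have h := (isPreconnected_upper hr).image (fun p : E3 => (p.1, -p.2)) (by fun_prop)
  convert h using 1
  ext p
  constructor
  · rintro ⟨h1, h2⟩
    exact ⟨(p.1, -p.2), ⟨neg_pos.2 h1, by simpa using h2⟩, by simp⟩
  · rintro ⟨p, ⟨h1, h2⟩, rfl⟩
    exact ⟨neg_lt_zero.2 h1, by simpa using h2⟩

theorem Sides.slot {g : E2 → E3} {A B : Set E3} (s : Sides g A B) (hg : HP g) {r : ℝ} (hr : 0 < r)
    (hr1 : r < 1) (h1 : ∀ q, ¬|q.2| ≤ r → g q = incl q)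
    (h2 : ∀ q, ¬(|(g q).1.2| ≤ r ∧ |(g q).2| ≤ r) → g q = incl q) :
    Slot 0 r g A B ∨ Slot 0 r g B A := by
  have hrange : ∀ p : E3, ¬(|p.1.2| ≤ r ∧ |p.2| ≤ r) → (p ∈ range g ↔ p.2 = 0) := by
    intro p hp
    constructor
    · rintro ⟨q, rfl⟩
      rw [h2 q hp]
      rfl
    · intro h0
      refine ⟨p.1, (h1 p.1 fun h => hp ⟨h, ?_⟩).trans (Prod.ext rfl h0.symm)⟩
      rw [h0, abs_zero]
      exact hr.le
  have hdich : ∀ K : Set E3, IsPreconnected K → (∀ p ∈ K, p ∉ range g) → K ⊆ A ∨ K ⊆ B := by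
    intro K hK hKr
    refine (isPreconnected_iff_subset_of_disjoint_closed.1 hK) A B s.closedA s.closedB
      (fun p _ => s.cover p) (eq_empty_iff_forall_notMem.2 fun p hp => ?_)
    exact hKr p hp.1 (s.inter ▸ hp.2)
  have main : ∀ {A B : Set E3}, Sides g A B → {p : E3 | 0 < p.2 ∧ ¬(|p.1.2| ≤ r ∧ |p.2| ≤ r)} ⊆ A →
      {p : E3 | p.2 < 0 ∧ ¬(|p.1.2| ≤ r ∧ |p.2| ≤ r)} ⊆ B → Slot 0 r g A B := by
    intro A B s hA hB
    have e : ∀ p, p ∈ range g → p ∈ A ∧ p ∈ B := fun p hp => by rwa [← s.inter] at hp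
    have e' : ∀ p, p ∈ A → p ∈ B → p ∈ range g := fun p h h' => by
      rw [← s.inter]
      exact ⟨h, h'⟩
    refine ⟨hg, s.closedA, s.closedB, s.cover, s.inter, fun p hp => ?_, fun p hp => ?_,
      fun q hq => h1 q (by simpa using hq)⟩
    all_goals
      rw [sub_zero] at hp
      rcases lt_trichotomy p.2 0 with h | h | h
    · exact ⟨fun h3 => absurd ((hrange p hp).1 (e' p h3 (hB ⟨h, hp⟩))) h.ne,
        fun h3 => absurd h h3.not_gt⟩
    · exact ⟨fun _ => h.ge, fun _ => (e p ((hrange p hp).2 h)).1⟩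
    · exact ⟨fun _ => h.le, fun _ => hA ⟨h, hp⟩⟩
    · exact ⟨fun _ => h.le, fun _ => hB ⟨h, hp⟩⟩
    · exact ⟨fun _ => h.le, fun _ => (e p ((hrange p hp).2 h)).2⟩
    · exact ⟨fun h3 => absurd ((hrange p hp).1 (e' p (hA ⟨h, hp⟩) h3)) h.ne',
        fun h3 => absurd h h3.not_gt⟩
  have bad : ∀ {A B : Set E3}, Sides g A B → {p : E3 | 0 < p.2 ∧ ¬(|p.1.2| ≤ r ∧ |p.2| ≤ r)} ⊆ A →
      {p : E3 | p.2 < 0 ∧ ¬(|p.1.2| ≤ r ∧ |p.2| ≤ r)} ⊆ A → False := by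
    intro A B s hA hA'
    have h3 : ((0, 1), 0) ∈ range g := (hrange ((0, 1), 0) (by simp; intro h; linarith)).2 rfl
    have h4 : IsOpen {p : E3 | r < p.1.2} := isOpen_lt continuous_const (by fun_prop)
    obtain ⟨p, hp, hpA⟩ := mem_closure_iff.1 (s.accA h3) _ h4 hr1
    have hp' : ¬(|p.1.2| ≤ r ∧ |p.2| ≤ r) := fun h => by
      have h5 : r < p.1.2 := hp
      linarith [(abs_le.1 h.1).2]
    rcases lt_trichotomy p.2 0 with h | h | h
    · exact hpA (hA' ⟨h, hp'⟩)
    · have := (hrange p hp').2 h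
      rw [← s.inter] at this
      exact hpA this.1
    · exact hpA (hA ⟨h, hp'⟩)
  rcases hdich _ (isPreconnected_upper hr) fun p hp h => hp.1.ne' ((hrange p hp.2).1 h) with h | h <;>
  rcases hdich _ (isPreconnected_lower hr) fun p hp h => hp.1.ne ((hrange p hp.2).1 h) with h' | h'
  · exact (bad s h h').elim
  · exact Or.inl (main s h h')
  · exact Or.inr (main s.swap h h')
  · exact (bad s.swap h h').elim

/-- The complement of a slab around a line can be moved into any neighbourhood of a ray. -/
theorem exists_squash {N : Set E3} (hN : IsOpen N) (hx : ∀ x, 0 ≤ x → ((x, 0), 0) ∈ N) :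
    ∃ M : Dfm E3 E3, (∀ p : E3, p.2 = 0 ↔ (M p).2 = 0) ∧
      ∀ p : E3, ¬(|p.1.2| ≤ 1 / 32 ∧ |p.2| ≤ 1 / 32) → M p ∈ N := by
  obtain ⟨ε, hε, hε'⟩ := exists_smooth_mem_convex_of_const
    (fun x : ℝ => {b : ℝ | 0 < b ∧ (0 ≤ x → ∀ y z, |y| ≤ b → |z| ≤ b → ((x, y), z) ∈ N)})
    (fun x => by
      refine OrdConnected.convex ⟨fun a ha b hb c hc => ⟨ha.1.trans_le hc.1, fun h y z hy hz =>
        hb.2 h y z (hy.trans hc.2) (hz.trans hc.2)⟩⟩)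
    (fun x => by
      rcases lt_or_ge x 0 with h | h
      · exact ⟨1, Filter.mem_of_superset (Iio_mem_nhds h) fun y hy =>
          ⟨one_pos, fun h' => absurd h' hy.not_ge⟩⟩
      · obtain ⟨δ, hδ, hδN⟩ := Metric.isOpen_iff.1 hN _ (hx x h)
        refine ⟨δ / 2, Filter.mem_of_superset (Metric.ball_mem_nhds x hδ) fun x' hx' =>
          ⟨half_pos hδ, fun _ y z hy hz => hδN ?_⟩⟩
        rw [Metric.mem_ball, Prod.dist_eq, Prod.dist_eq, max_lt_iff, max_lt_iff]
        refine ⟨⟨hx', ?_⟩, ?_⟩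
        · show dist y 0 < δ
          rw [Real.dist_0_eq_abs]
          linarith
        · show dist z 0 < δ
          rw [Real.dist_0_eq_abs]
          linarith)
  have hscale : ∀ b : ℝ → ℝ, ContDiff ℝ ∞ b → (∀ x, 0 < b x) → ∃ d : Dfm E3 E3,
      ∀ p, d p = ((p.1.1, b p.1.1 * p.1.2), b p.1.1 * p.2) := by
    intro b hb hb0
    have hi : ContDiff ℝ ∞ fun p : E3 => (b p.1.1)⁻¹ := ContDiff.inv (by fun_prop) fun p => (hb0 _).ne'
    exact ⟨⟨⟨fun p => ((p.1.1, b p.1.1 * p.1.2), b p.1.1 * p.2),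
      fun p => ((p.1.1, (b p.1.1)⁻¹ * p.1.2), (b p.1.1)⁻¹ * p.2),
      fun p => by
        refine Prod.ext (Prod.ext rfl ?_) ?_ <;> simp [(hb0 _).ne'],
      fun p => by
        refine Prod.ext (Prod.ext rfl ?_) ?_ <;> simp [(hb0 _).ne']⟩, by fun_prop, by fun_prop⟩,
      fun _ => rfl⟩
  obtain ⟨S, hS⟩ := hscale (fun x => 32 * (1 + x ^ 2)) (by fun_prop) (fun x => by positivity)
  obtain ⟨S', hS'⟩ := hscale (fun x => ε x * (1 + x ^ 2)⁻¹)
    (hε.mul (ContDiff.inv (by fun_prop) fun x => by positivity))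
    (fun x => mul_pos (hε' x).1 (by positivity))
  let H : Dfm E3 E3 := ⟨⟨fun p => ((p.1.1 + 2 * (p.1.2 ^ 2 + p.2 ^ 2), p.1.2), p.2),
    fun p => ((p.1.1 - 2 * (p.1.2 ^ 2 + p.2 ^ 2), p.1.2), p.2), fun p => by simp, fun p => by simp⟩,
    by fun_prop, by fun_prop⟩
  have hH : ∀ p, H p = ((p.1.1 + 2 * (p.1.2 ^ 2 + p.2 ^ 2), p.1.2), p.2) := fun _ => rfl
  refine ⟨(S.trans H).trans S', fun p => ?_, fun p hp => ?_⟩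
  · have h1 : 32 * (1 + p.1.1 ^ 2) ≠ 0 := by positivity
    have h2 : ∀ x, ε x * (1 + x ^ 2)⁻¹ ≠ 0 := fun x => (mul_pos (hε' x).1 (by positivity)).ne'
    simp only [Dfm.trans_apply, hS, hH, hS']
    simp [h1, (hε' _).1.ne', show ∀ x : ℝ, 1 + x ^ 2 ≠ 0 from fun x => by positivity]
  · simp only [Dfm.trans_apply]
    rw [hS']
    set p₁ := S p with hp₁
    have hpos : 0 < p₁.1.1 + (p₁.1.2 ^ 2 + p₁.2 ^ 2) := by
      by_contra! hc
      rw [hS] at hp₁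
      have hcy := hp₁ ▸ hc
      dsimp only at hcy
      have h1 : 0 < 1 + p.1.1 ^ 2 := by positivity
      have h2 : ∀ y : ℝ, (32 * (1 + p.1.1 ^ 2) * y) ^ 2 ≤ -p.1.1 → |y| ≤ 1 / 32 := by
        intro y hy
        have h3 : (32 * y) ^ 2 * (1 + p.1.1 ^ 2) ^ 2 ≤ 1 * (1 + p.1.1 ^ 2) ^ 2 := by
          nlinarith [sq_nonneg (p.1.1 + 1), sq_nonneg (p.1.1 ^ 2)]
        have h4 : (32 * y) ^ 2 ≤ 1 := le_of_mul_le_mul_right h3 (by positivity)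
        exact abs_le_of_sq_le_sq (by nlinarith) (by norm_num)
      exact hp ⟨h2 _ (by nlinarith [sq_nonneg (32 * (1 + p.1.1 ^ 2) * p.2)]),
        h2 _ (by nlinarith [sq_nonneg (32 * (1 + p.1.1 ^ 2) * p.1.2)])⟩
    set x := (H p₁).1.1 with hxd
    have hxe : x = p₁.1.1 + 2 * (p₁.1.2 ^ 2 + p₁.2 ^ 2) := rfl
    have hb : ∀ y : ℝ, y ^ 2 ≤ x → |ε x * (1 + x ^ 2)⁻¹ * y| ≤ ε x := by
      intro y hy
      have h1 := (hε' x).1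
      have h2 : |y| ≤ 1 + x ^ 2 := abs_le_of_sq_le_sq (by nlinarith [sq_nonneg (x - 1), sq_nonneg (x^2)]) (by positivity)
      have h3 : 0 < 1 + x ^ 2 := by positivity
      rw [abs_mul, abs_of_pos (by positivity), mul_assoc]
      refine mul_le_of_le_one_right h1.le ?_
      rwa [inv_mul_le_iff₀ h3, mul_one]
    have hx0 : 0 ≤ x := by nlinarith [sq_nonneg p₁.1.2, sq_nonneg p₁.2]
    refine (hε' x).2 hx0 _ _ (hb _ ?_) (hb _ ?_)
    · show p₁.1.2 ^ 2 ≤ x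
      nlinarith [sq_nonneg p₁.1.2, sq_nonneg p₁.2]
    · show p₁.2 ^ 2 ≤ x
      nlinarith [sq_nonneg p₁.1.2, sq_nonneg p₁.2]

theorem Sides.sd_of_slot {g : E2 → E3} {A B : Set E3} (h : Slot 0 (1 / 32) g A B ∨ Slot 0 (1 / 32) g B A) :
    SD A (HS E2) ∧ SD B (HS E2) := by
  rcases h with h | h
  · exact ⟨h.sd_HS, h.sd_HS'⟩
  · exact ⟨h.sd_HS', h.sd_HS⟩

/-- A plane containing an unknotted ray bounds half-spaces on both sides. -/
theorem HP.sd_of_unknotted_ray {f : E2 → E3} (hf : HP f) {A B : Set E3} (s : Sides f A B)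
    {ρ : ℝ → E3} (h : PRay ρ) (hsub : ∀ t, 0 ≤ t → ρ t ∈ range f) (Φ : Dfm E3 E3)
    (hΦ : Φ '' (ρ '' Ici 0) = ell) : SD A (HS E2) ∧ SD B (HS E2) := by
  obtain ⟨D₁, τ₁, h1⟩ := hf.exists_dfm_straight_ray h hsub Φ hΦ
  obtain ⟨D₂, τ₂, N, hN, hx, h2, h2'⟩ := ((hf.comp_dfm τ₁).dfm_comp D₁).exists_standard_germ h1
  obtain ⟨M, hM, hMN⟩ := exists_squash hN hx
  have hμ : ∀ q, M (incl q) = incl (M.plane hM q) := fun q =>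
    Prod.ext rfl ((hM (incl q)).1 rfl)
  have s' := ((s.dfm D₁ τ₁).dfm D₂ τ₂).dfm M.symm (M.plane hM)
  have hs := s'.slot ((((hf.comp_dfm τ₁).dfm_comp D₁).comp_dfm τ₂ |>.dfm_comp D₂).comp_dfm
    (M.plane hM) |>.dfm_comp M.symm) (r := 1 / 32) (by norm_num) (by norm_num)
    (fun q hq => by
      have h3 := hMN (incl q) fun h' => hq h'.1
      rw [hμ] at h3
      show M.symm (D₂ (D₁ (f (τ₁ (τ₂ (M.plane hM q)))))) = incl q
      rw [h2' _ h3, ← hμ, Dfm.symm_apply_apply])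
    (fun q hq => by
      have h3 := hMN _ hq
      rw [Dfm.apply_symm_apply] at h3
      show M.symm (D₂ (D₁ (f (τ₁ (τ₂ (M.plane hM q)))))) = incl q
      rw [h2 _ h3, ← hμ, Dfm.symm_apply_apply])
  obtain ⟨ha, hb⟩ := Sides.sd_of_slot hs
  have key : ∀ S : Set E3, SD S (M.symm.symm ⁻¹' (D₂.symm ⁻¹' (D₁.symm ⁻¹' S))) := fun S =>
    ((D₁.trans D₂).trans M.symm).sd fun x => by simp
  exact ⟨(key A).trans ha, (key B).trans hb⟩

/-- A properly embedded plane has two sides as soon as its complement is disconnected. -/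
theorem HP.sides_of_components {f : E2 → E3} (hf : HP f) {C₁ C₂ : Set E3} (ho₁ : IsOpen C₁)
    (ho₂ : IsOpen C₂) (hn₁ : C₁.Nonempty) (hn₂ : C₂.Nonempty)
    (hd : Disjoint C₁ C₂) (hu : C₁ ∪ C₂ = (range f)ᶜ) :
    Sides f (closure C₁) (closure C₂) ∧ ∃ G : E3 → E3, Tube G ∧ (∀ q, G (q, 0) = f q) ∧
      (∀ p : E3, 0 ≤ p.2 → G p ∈ closure C₁) ∧ ∀ p : E3, p.2 ≤ 0 → G p ∈ closure C₂ := by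
  obtain ⟨ε, -, -, hG⟩ := hf.exists_tub one_pos
  set G := tub f ε with hGd
  have hG0 : ∀ q, G (q, 0) = f q := tub_zero f ε
  have hGr : ∀ p : E3, p.2 ≠ 0 → G p ∈ C₁ ∪ C₂ := by
    intro p hp
    rw [hu]
    rintro ⟨q, hq⟩
    rw [← hG0] at hq
    exact hp (congrArg Prod.snd (hG.inj hq)).symm
  have cp : Convex ℝ {p : E3 | 0 < p.2} :=
    convex_halfSpace_gt (LinearMap.snd ℝ E2 ℝ).isLinear 0
  have cn : Convex ℝ {p : E3 | p.2 < 0} :=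
    convex_halfSpace_lt (LinearMap.snd ℝ E2 ℝ).isLinear 0
  have hdich : ∀ K : Set E3, IsPreconnected K → (∀ p ∈ K, p.2 ≠ 0) →
      K ⊆ G ⁻¹' C₁ ∨ K ⊆ G ⁻¹' C₂ := by
    intro K hK hK0
    have h1 := (hK.image G hG.smooth.continuous.continuousOn)
    rcases h1.subset_or_subset ho₁ ho₂ hd (image_subset_iff.2 fun p hp => hGr p (hK0 p hp)) with h | h
    · exact Or.inl (image_subset_iff.1 h)
    · exact Or.inr (image_subset_iff.1 h)
  have main : ∀ {C₁ C₂ : Set E3} {G : E3 → E3}, IsOpen C₁ → IsOpen C₂ → Disjoint C₁ C₂ →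
      C₁ ∪ C₂ = (range f)ᶜ → Tube G → (∀ q, G (q, 0) = f q) → {p : E3 | 0 < p.2} ⊆ G ⁻¹' C₁ →
      {p : E3 | p.2 < 0} ⊆ G ⁻¹' C₂ →
      Sides f (closure C₁) (closure C₂) ∧ ∃ G : E3 → E3, Tube G ∧ (∀ q, G (q, 0) = f q) ∧
      (∀ p : E3, 0 ≤ p.2 → G p ∈ closure C₁) ∧ ∀ p : E3, p.2 ≤ 0 → G p ∈ closure C₂ := by
    intro C₁ C₂ G ho₁ ho₂ hd hu hG hG0 hp hn
    have hpos : ∀ p : E3, 0 ≤ p.2 → G p ∈ closure C₁ := by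
      intro p h
      have h2 : p ∈ closure {p : E3 | 0 < p.2} := by
        have := isOpenMap_snd.preimage_closure_eq_closure_preimage continuous_snd
          (X := E2 × ℝ) (Ioi (0 : ℝ))
        rw [closure_Ioi] at this
        exact this.subset h
      exact (image_subset_iff.2 hp |> closure_mono)
        (image_closure_subset_closure_image hG.smooth.continuous (mem_image_of_mem G h2))
    have hneg : ∀ p : E3, p.2 ≤ 0 → G p ∈ closure C₂ := by
      intro p h
      have h2 : p ∈ closure {p : E3 | p.2 < 0} := by
        have := isOpenMap_snd.preimage_closure_eq_closure_preimage continuous_snd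
          (X := E2 × ℝ) (Iio (0 : ℝ))
        rw [closure_Iio] at this
        exact this.subset h
      exact (image_subset_iff.2 hn |> closure_mono)
        (image_closure_subset_closure_image hG.smooth.continuous (mem_image_of_mem G h2))
    have hr₁ : range f ⊆ closure C₁ := by
      rintro _ ⟨q, rfl⟩
      exact hG0 q ▸ hpos (q, 0) le_rfl
    have hr₂ : range f ⊆ closure C₂ := by
      rintro _ ⟨q, rfl⟩
      exact hG0 q ▸ hneg (q, 0) le_rfl
    have hd₁ : Disjoint (closure C₁) C₂ := hd.closure_left ho₂
    have hd₂ : Disjoint C₁ (closure C₂) := hd.closure_right ho₁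
    refine ⟨⟨isClosed_closure, isClosed_closure, fun p => ?_, ?_, ?_, ?_⟩, G, hG, hG0, hpos, hneg⟩
    · by_cases hp : p ∈ range f
      · exact Or.inl (hr₁ hp)
      · have : p ∈ C₁ ∪ C₂ := hu ▸ hp
        exact this.imp (fun h => subset_closure h) fun h => subset_closure h
    · refine (subset_inter hr₁ hr₂).antisymm' fun p hp => ?_
      by_contra h
      have : p ∈ C₁ ∪ C₂ := hu ▸ h
      rcases this with h' | h'
      · exact hd₂.notMem_of_mem_left h' hp.2
      · exact hd₁.notMem_of_mem_left hp.1 h'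
    · exact hr₂.trans (closure_mono hd₁.symm.subset_compl_right)
    · exact hr₁.trans (closure_mono hd₂.subset_compl_right)
  have bad : ∀ {C₁ C₂ : Set E3}, IsOpen C₁ → IsOpen C₂ → C₂.Nonempty → Disjoint C₁ C₂ →
      C₁ ∪ C₂ = (range f)ᶜ → C₁.Nonempty → {p : E3 | 0 < p.2} ⊆ G ⁻¹' C₁ →
      {p : E3 | p.2 < 0} ⊆ G ⁻¹' C₁ → False := by
    intro C₁ C₂ ho₁ ho₂ hn₂ hd hu hn₁ hp hn
    have hGC : range G ⊆ C₁ ∪ range f := by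
      rintro _ ⟨p, rfl⟩
      rcases lt_trichotomy p.2 0 with h | h | h
      · exact Or.inl (hn h)
      · exact Or.inr ⟨p.1, by rw [← hG0, ← h]⟩
      · exact Or.inl (hp h)
    have hfG : range f ⊆ range G := by
      rintro _ ⟨q, rfl⟩
      exact ⟨(q, 0), hG0 q⟩
    have hU : IsOpen (C₁ ∪ range G) := ho₁.union hG.isOpenMap.isOpen_range
    obtain ⟨x, -, hx, hx'⟩ := isPreconnected_univ (α := E3) _ _ hU ho₂ (fun x _ => by
      by_cases h : x ∈ range f
      · exact Or.inl (Or.inr (hfG h))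
      · have : x ∈ C₁ ∪ C₂ := hu ▸ h
        exact this.imp_left Or.inl) (by simpa using Or.inl hn₁) (by simpa using hn₂)
    have hx2 : x ∈ C₁ ∪ range f := hx.elim Or.inl fun h => hGC h
    rcases hx2 with h | h
    · exact hd.notMem_of_mem_left h hx'
    · have : x ∈ (range f)ᶜ := hu ▸ Or.inr hx'
      exact this h
  have hu' : C₂ ∪ C₁ = (range f)ᶜ := union_comm C₁ C₂ ▸ hu
  rcases hdich _ cp.isPreconnected fun p hp => ne_of_gt hp with h | h <;>
  rcases hdich _ cn.isPreconnected fun p hp => ne_of_lt hp with h' | h'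
  · exact (bad ho₁ ho₂ hn₂ hd hu hn₁ h h').elim
  · exact main ho₁ ho₂ hd hu hG hG0 h h'
  · exact main ho₁ ho₂ hd hu hG.comp_refl (fun q => by simp [hG0])
      (fun p hp => h' (show -p.2 < 0 from neg_lt_zero.2 hp))
      fun p hp => h (show 0 < -p.2 from neg_pos.2 hp)
  · exact (bad ho₂ ho₁ hn₁ hd.symm hu' hn₂ h h').elim

section
variable {E F : Type} [NormedAddCommGroup E] [NormedSpace ℝ E] [NormedAddCommGroup F]
  [NormedSpace ℝ F]

theorem PRay.of_properMap {ρ : ℝ → F} [ProperSpace F] (hinj : InjOn ρ (Ici 0))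
    (hsmooth : ContDiffOn ℝ ∞ ρ (Ici 0))
    (hderiv : ∀ t ∈ Ici (0 : ℝ), derivWithin ρ (Ici 0) t ≠ 0)
    (hproper : IsProperMap fun t : Ici (0 : ℝ) => ρ t) :
    ∃ σ : ℝ → F, PRay σ ∧ EqOn σ ρ (Ici 0) := by
  obtain ⟨g, hg, hgρ⟩ := exists_extension (E := ℝ) (fun p => ρ p.2)
    (hsmooth.comp contDiff_snd.contDiffOn fun p hp => hp)
  have hσ : ContDiff ℝ ∞ fun t : ℝ => g (0, t) := by fun_prop
  have heq : EqOn (fun t : ℝ => g (0, t)) ρ (Ici 0) := fun t ht => hgρ (x := (0, t)) ht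
  refine ⟨fun t => g (0, t), ⟨hσ, heq.injOn_iff.2 hinj, fun t ht h0 => ?_, ?_⟩, heq⟩
  · refine hderiv t ht ?_
    rw [← derivWithin_congr heq (heq ht), (hσ.differentiable (by simp) t).derivWithin
      (uniqueDiffOn_Ici 0 t ht), h0]
  · refine tendsto_atTop.2 fun c => ?_
    obtain ⟨M, hM⟩ := ((hproper.isCompact_preimage (isCompact_closedBall (0 : F) c)).image
      continuous_subtype_val).bddAbove
    filter_upwards [eventually_gt_atTop M, eventually_ge_atTop 0] with t ht ht0
    by_contra! hc
    refine ht.not_ge (hM ⟨⟨t, ht0⟩, ?_, rfl⟩)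
    simpa [← heq ht0] using hc.le

theorem SetDiffeo.sd {S T : Set (EuclideanSpace ℝ (Fin 3))} : SetDiffeo S T ↔ SD S T := by
  constructor
  · rintro ⟨g, h, hg, hh, rfl, hT, hl, hr⟩
    exact ⟨g, h, hg, hh, mapsTo_image g S, fun x hx => hT ▸ mem_image_of_mem h hx, hl, hr⟩
  · rintro ⟨g, h, H⟩
    refine ⟨g, h, H.smooth, H.smooth', H.maps.image_subset.antisymm fun y hy => ?_,
      H.maps'.image_subset.antisymm fun x hx => ?_, H.left, H.right⟩
    · exact ⟨h y, H.maps' hy, H.right y hy⟩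
    · exact ⟨g x, H.maps hx, H.left x hx⟩

theorem exists_diffeoR3_iff (S T : Set (EuclideanSpace ℝ (Fin 3)))
    (e : EuclideanSpace ℝ (Fin 3) ≃L[ℝ] E) :
    (∃ Φ, DiffeoR3 Φ ∧ Φ '' S = T) ↔ ∃ d : Dfm E E, d '' (e '' S) = e '' T := by
  constructor
  · rintro ⟨Φ, ⟨hb, hs, hs'⟩, rfl⟩
    let d : Dfm (EuclideanSpace ℝ (Fin 3)) (EuclideanSpace ℝ (Fin 3)) :=
      ⟨⟨Φ, Function.invFun Φ, Function.leftInverse_invFun hb.1,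
        Function.rightInverse_invFun hb.2⟩, hs, hs'⟩
    refine ⟨((Dfm.ofCLE e.symm).trans d).trans (Dfm.ofCLE e), ?_⟩
    rw [image_image, image_image]
    refine image_congr fun x _ => ?_
    show e (Φ (e.symm (e x))) = e (Φ x)
    rw [e.symm_apply_apply]
  · rintro ⟨d, hd⟩
    let d' := ((Dfm.ofCLE e).trans d).trans (Dfm.ofCLE e.symm)
    refine ⟨d', ⟨d'.bijective, d'.contDiff, ?_⟩, ?_⟩
    · rw [show Function.invFun d' = d'.symm from funext fun x => d'.injective (by
        rw [Function.rightInverse_invFun d'.surjective x, Dfm.apply_symm_apply])]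
      exact d'.symm.contDiff
    · have h1 : d' '' S = e.symm '' (d '' (e '' S)) := by
        rw [image_image, image_image]
        rfl
      rw [h1, hd, image_image]
      simp

end

/-- Three-dimensional Euclidean space as an iterated product. -/
noncomputable def cle3 : EuclideanSpace ℝ (Fin 3) ≃L[ℝ] E3 :=
  LinearEquiv.toContinuousLinearEquiv
    { toFun := fun x => ((x 0, x 1), x 2)
      invFun := fun p => !₂[p.1.1, p.1.2, p.2]
      map_add' := fun _ _ => rfl
      map_smul' := fun _ _ => rfl
      left_inv := fun x => by ext i; fin_cases i <;> rfl
      right_inv := fun _ => rfl }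

/-- The Euclidean plane as a product. -/
noncomputable def cle2 : E2 ≃L[ℝ] EuclideanSpace ℝ (Fin 2) :=
  LinearEquiv.toContinuousLinearEquiv
    { toFun := fun p => !₂[p.1, p.2]
      invFun := fun x => (x 0, x 1)
      map_add' := fun _ _ => by ext i; fin_cases i <;> rfl
      map_smul' := fun _ _ => by ext i; fin_cases i <;> rfl
      left_inv := fun _ => rfl
      right_inv := fun x => by ext i; fin_cases i <;> rfl }

theorem image_cle3_eq {S : Set (EuclideanSpace ℝ (Fin 3))} {T : Set E3}
    (h : ∀ x, x ∈ S ↔ cle3 x ∈ T) : cle3 '' S = T :=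
  (show S = cle3 ⁻¹' T from Set.ext h) ▸ image_preimage_eq T cle3.surjective

theorem sd_image_iff (S : Set (EuclideanSpace ℝ (Fin 3))) :
    SetDiffeo S {x | 0 ≤ x 2} ↔ SD (cle3 '' S) (HS E2) := by
  have h1 : SD S (cle3 '' S) := (Dfm.ofCLE cle3).sd fun x => by simp
  have h2 : SD {x : EuclideanSpace ℝ (Fin 3) | 0 ≤ x 2} (HS E2) :=
    (Dfm.ofCLE cle3).sd fun x => Iff.rfl
  rw [SetDiffeo.sd]
  exact ⟨fun h => h1.symm.trans (h.trans h2), fun h => h1.trans (h.trans h2.symm)⟩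

theorem hp_conj {f : EuclideanSpace ℝ (Fin 2) → EuclideanSpace ℝ (Fin 3)}
    (hs : ContDiff ℝ ∞ f) (hi : Function.Injective f) (hp : IsProperMap f)
    (him : ∀ x, Function.Injective (fderiv ℝ f x)) : HP fun q => cle3 (f (cle2 q)) where
  smooth := cle3.contDiff.comp (hs.comp cle2.contDiff)
  emb := cle3.toHomeomorph.isClosedEmbedding.comp
    ((Topology.IsClosedEmbedding.of_continuous_injective_isClosedMap hp.continuous hi
      hp.isClosedMap).comp cle2.toHomeomorph.isClosedEmbedding)
  imm q := by
    have h := cle3.hasFDerivAt.comp q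
      (((hs.differentiable (by simp)) (cle2 q)).hasFDerivAt.comp q cle2.hasFDerivAt)
    rw [show fderiv ℝ (fun q => cle3 (f (cle2 q))) q = _ from h.fderiv]
    exact cle3.injective.comp ((him _).comp cle2.injective)

end

/-- Let `H = range f` be a smooth proper hyperplane in ℝ³ whose complement has exactly two
connected components, with closures `A` and `B`, and let `ρ` be a ray contained in `H`.
Then the following are equivalent: (1) `H` is unknotted; (2) `ρ` is unknotted;
(3) both `A` and `B` are diffeomorphic to the closed half-space `ℝ³₊`. -/
theorem hyperplane_ray_unknotted_tfae
    (f : EuclideanSpace ℝ (Fin 2) → EuclideanSpace ℝ (Fin 3))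
    (hf_smooth : ContDiff ℝ (⊤ : ℕ∞) f)
    (hf_inj : Function.Injective f)
    (hf_proper : IsProperMap f)
    (hf_imm : ∀ x, Function.Injective (fderiv ℝ f x))
    (hf_zero : f 0 = 0)
    -- `ℝ³ \ H` has exactly two connected components `C₁` and `C₂`
    (C₁ C₂ : Set (EuclideanSpace ℝ (Fin 3)))
    (x₁ x₂ : EuclideanSpace ℝ (Fin 3))
    (hx₁ : x₁ ∈ (Set.range f)ᶜ) (hx₂ : x₂ ∈ (Set.range f)ᶜ)
    (hC₁ : C₁ = connectedComponentIn (Set.range f)ᶜ x₁)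
    (hC₂ : C₂ = connectedComponentIn (Set.range f)ᶜ x₂)
    (hne : C₁ ≠ C₂)
    (hcover : C₁ ∪ C₂ = (Set.range f)ᶜ)
    -- `ρ` is a ray contained in `H`
    (ρ : ℝ → EuclideanSpace ℝ (Fin 3))
    (hρ_inj : Set.InjOn ρ (Set.Ici 0))
    (hρ_smooth : ContDiffOn ℝ (⊤ : ℕ∞) ρ (Set.Ici 0))
    (hρ_deriv : ∀ t ∈ Set.Ici (0 : ℝ), derivWithin ρ (Set.Ici 0) t ≠ 0)
    (hρ_proper : IsProperMap fun t : Set.Ici (0 : ℝ) => ρ (t : ℝ))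
    (hρ_sub : ρ '' Set.Ici 0 ⊆ Set.range f) :
    List.TFAE
      [HyperplaneUnknotted (Set.range f),
       RayUnknotted (ρ '' Set.Ici 0),
       SetDiffeo (closure C₁) {x : EuclideanSpace ℝ (Fin 3) | 0 ≤ x 2} ∧
         SetDiffeo (closure C₂) {x : EuclideanSpace ℝ (Fin 3) | 0 ≤ x 2}] := by
  have hf := hp_conj hf_smooth hf_inj hf_proper hf_imm
  set F : E2 → E3 := fun q => cle3 (f (cle2 q)) with hF
  have hrange : range F = cle3 '' range f := by
    rw [← range_comp]
    exact (cle2.surjective.range_comp (cle3 ∘ f))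
  have hHo : IsOpen (range f)ᶜ := hf_proper.isClosedMap.isClosed_range.isOpen_compl
  have hd : Disjoint C₁ C₂ := disjoint_left.2 fun x h₁ h₂ => hne <| by
    rw [hC₁] at h₁ ⊢
    rw [hC₂] at h₂ ⊢
    rw [connectedComponentIn_eq h₁, connectedComponentIn_eq h₂]
  obtain ⟨s, G, hG, hG0, hGA, hGB⟩ := hf.sides_of_components (C₁ := cle3 '' C₁) (C₂ := cle3 '' C₂)
    (cle3.toHomeomorph.isOpenMap _ (hC₁ ▸ hHo.connectedComponentIn))
    (cle3.toHomeomorph.isOpenMap _ (hC₂ ▸ hHo.connectedComponentIn))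
    (Nonempty.image _ ⟨x₁, hC₁ ▸ mem_connectedComponentIn hx₁⟩)
    (Nonempty.image _ ⟨x₂, hC₂ ▸ mem_connectedComponentIn hx₂⟩)
    ((disjoint_image_iff cle3.injective).2 hd)
    (by rw [← image_union, hcover, hrange, image_compl_eq cle3.bijective])
  have hcl : ∀ S, cle3 '' closure S = closure (cle3 '' S) := fun S =>
    cle3.toHomeomorph.image_closure S
  obtain ⟨σ₀, hσ₀, heq⟩ := PRay.of_properMap hρ_inj hρ_smooth hρ_deriv hρ_proper
  have hσ := hσ₀.dfm_comp (Dfm.ofCLE cle3)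
  have hσi : (fun t => cle3 (σ₀ t)) '' Ici 0 = cle3 '' (ρ '' Ici 0) := by
    rw [image_image]
    exact image_congr fun t ht => by rw [heq ht]
  have hsub : ∀ t, 0 ≤ t → cle3 (σ₀ t) ∈ range F := fun t ht => by
    rw [hrange, heq ht]
    exact mem_image_of_mem _ (hρ_sub ⟨t, ht, rfl⟩)
  have e1 : cle3 '' {x : EuclideanSpace ℝ (Fin 3) | x 2 = 0} = {p | p.2 = 0} :=
    image_cle3_eq fun x => Iff.rfl
  have e2 : cle3 '' {x : EuclideanSpace ℝ (Fin 3) | 0 ≤ x 0 ∧ x 1 = 0 ∧ x 2 = 0} = ell :=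
    image_cle3_eq fun x => by
      show 0 ≤ x 0 ∧ x 1 = 0 ∧ x 2 = 0 ↔ x 2 = 0 ∧ x 1 = 0 ∧ 0 ≤ x 0
      tauto
  rw [HyperplaneUnknotted, RayUnknotted, exists_diffeoR3_iff _ _ cle3, exists_diffeoR3_iff _ _ cle3,
    sd_image_iff, sd_image_iff, e1, e2, ← hrange, ← hσi, hcl, hcl]
  tfae_have 1 → 2 := by
    rintro ⟨Φ, hΦ⟩
    refine unknotted_ray_of_unknotted_plane hσ Φ fun t ht => ?_
    exact hΦ.subset (mem_image_of_mem Φ (hsub t ht))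
  tfae_have 2 → 3 := by
    rintro ⟨Φ, hΦ⟩
    exact hf.sd_of_unknotted_ray s hσ hsub Φ hΦ
  tfae_have 3 → 1 := by
    rintro ⟨hA, hB⟩
    have hr : (range fun q => G (q, 0)) = range F := by simp_rw [hG0]
    obtain ⟨Φ, hΦ⟩ := exists_dfm_of_sides hG s.closedA s.closedB
      (eq_univ_of_forall fun p => s.cover p) (s.inter.trans hr.symm) hGA hGB hA hB
    rw [hr] at hΦ
    refine ⟨Φ, Φ.image_eq (fun x hx => (hΦ x).2 hx) fun y hy => (hΦ _).1 ?_⟩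
    rwa [Dfm.apply_symm_apply]
  tfae_finish
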